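/- Let c > 0 and define a_j := −(c·2^j)^{1/(c+1)} and b_j := |a_j|^{−c} for j ≥ 0, so that (a_j) and (b_j) are strictly decreasing and (a_j, b_j) lies on the curve η = |ξ|^{−c}, ξ < 0. Then for every triple of exponents with 1 < p₁, p₂, p₃ < ∞ and 1/p₁ + 1/p₂ + 1/p₃ = 1, there exists a finite constant C = C(p₁,p₂,c) such that ‖B_{m_{a,b}}(f,g)‖_{L^{p₃'}(ℝ)} ≤ C ‖f‖_{L^{p₁}(ℝ)} ‖g‖_{L^{p₂}(ℝ)} for all Schwartz functions f, g on ℝ. -/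

import Mathlib

open MeasureTheory Set
open scoped ENNReal NNReal

noncomputable section

/-- The character `e^{2π i t x}`. -/
def eChar (t x : ℝ) : ℂ := Complex.exp (2 * Real.pi * Complex.I * t * x)

/-- The Fourier transform `f̂(ξ) = ∫ f(x) e^{-2π i ξ x} dx`. -/
def fourierT (f : ℝ → ℂ) (ξ : ℝ) : ℂ := ∫ x : ℝ, f x * eChar (-ξ) x

/-- The bilinear multiplier operator `B_m` with symbol `m`. -/
def Bm (m : ℝ → ℝ → ℂ) (f g : ℝ → ℂ) (x : ℝ) : ℂ :=
  ∫ ξ : ℝ, ∫ η : ℝ, m ξ η * fourierT f ξ * fourierT g η * eChar (ξ + η) x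

/-- Complex-valued indicator function of a set of reals. -/
def indC (s : Set ℝ) (x : ℝ) : ℂ := s.indicator 1 x

/-- The set `-A - B = {-x-y : x ∈ A, y ∈ B}`. -/
def mink2 (A B : Set ℝ) : Set ℝ := Set.image2 (fun x y => -x - y) A B

/-- The paraproduct symbol `m_{a,b}(ξ,η) = Σ_{j≥1} 1_{[a_{j+1},a_j)}(ξ) 1_{[b_j,b_0)}(η)`. -/
def mab (a b : ℕ → ℝ) (ξ η : ℝ) : ℂ :=
  ∑' j : ℕ, indC (Ico (a (j + 2)) (a (j + 1))) ξ * indC (Ico (b (j + 1)) (b 0)) η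

/-- The interval `-[a_{j+1},a_j) - [b_j, b_0)` from the collection `I_{a,b}`. -/
def Iab (a b : ℕ → ℝ) (j : ℕ) : Set ℝ := mink2 (Ico (a (j + 1)) (a j)) (Ico (b j) (b 0))

/-- The interval `-[a_{j+1},a_j) - (b_∞, b_j)` from the collection `J_{a,b}`. -/
def Jab (a b : ℕ → ℝ) (binf : ℝ) (j : ℕ) : Set ℝ :=
  mink2 (Ico (a (j + 1)) (a j)) (Ioo binf (b j))

/-- The symbol `m̃_{u,v}(ξ,η) = Σ_{j≥1} 1_{(u_0,u_j]}(ξ) 1_{[v_j,v_{j+1})}(η)`. -/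
def muv (u v : ℕ → ℝ) (ξ η : ℝ) : ℂ :=
  ∑' j : ℕ, indC (Ioc (u 0) (u (j + 1))) ξ * indC (Ico (v (j + 1)) (v (j + 2))) η

/-- The interval `-(u_0,u_j] - [v_j, v_{j+1})`. -/
def Iuv (u v : ℕ → ℝ) (j : ℕ) : Set ℝ :=
  mink2 (Ioc (u 0) (u j)) (Ico (v j) (v (j + 1)))

/-- The frequency projection `(1_S f̂)^∨`. -/
def fproj (S : Set ℝ) (f : ℝ → ℂ) (x : ℝ) : ℂ := ∫ ξ in S, fourierT f ξ * eChar ξ x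

/-- The `L^p(ℓ²)` norm of the family of frequency projections onto the sets `T i`. -/
def sqNormLp {ι : Type*} (T : ι → Set ℝ) (f : ℝ → ℂ) (p : ℝ) : ℝ≥0∞ :=
  (∫⁻ x : ℝ, (∑' i, ((‖fproj (T i) f x‖₊ : ℝ≥0∞)) ^ 2) ^ (p / 2)) ^ (1 / p)

/-- The collection of connected components of a set `U ⊆ ℝ`. -/
def componentsOf (U : Set ℝ) : Set (Set ℝ) := {S | ∃ x ∈ U, S = connectedComponentIn U x}

/-- A closed Lebesgue-null set `E ⊆ ℝ` is Littlewood–Paley if for every `1 < p < ∞` the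
square function associated with the connected components of `ℝ \ E` is comparable with the
`L^p` norm (stated on the dense class of Schwartz functions). -/
def IsLPSet (E : Set ℝ) : Prop :=
  IsClosed E ∧ volume E = 0 ∧
    ∀ p : ℝ, 1 < p → ∃ c : ℝ, 0 < c ∧ ∃ C : ℝ, 0 < C ∧
      ∀ f : SchwartzMap ℝ ℂ,
        ENNReal.ofReal c * eLpNorm (⇑f) (ENNReal.ofReal p) volume ≤
            sqNormLp (fun ω : componentsOf Eᶜ => (ω : Set ℝ)) (⇑f) p ∧
          sqNormLp (fun ω : componentsOf Eᶜ => (ω : Set ℝ)) (⇑f) p ≤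
            ENNReal.ofReal C * eLpNorm (⇑f) (ENNReal.ofReal p) volume

/-- A strictly monotone real sequence is Littlewood–Paley if the closure of its range is a
Littlewood–Paley set. -/
def IsLPSeq (a : ℕ → ℝ) : Prop := IsLPSet (closure (Set.range a))

/-- A family of (pairwise disjoint) intervals is Littlewood–Paley if for every `1 < p < ∞`
the associated square function is bounded by the `L^p` norm. -/
def IsLPFamily {ι : Type*} (T : ι → Set ℝ) : Prop :=
  ∀ p : ℝ, 1 < p → ∃ C : ℝ, 0 < C ∧ ∀ f : SchwartzMap ℝ ℂ,
    sqNormLp T (⇑f) p ≤ ENNReal.ofReal C * eLpNorm (⇑f) (ENNReal.ofReal p) volume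

/-- Slope of the `j`-th segment of the piecewise linear curve with vertices `(a_j, b_j)`. -/
def pslope (a b : ℕ → ℝ) (j : ℕ) : ℝ := (b j - b (j + 1)) / (a j - a (j + 1))

/-- The epigraph of the piecewise linear curve with vertices `(a_j, b_j)`. -/
def polyEpi (a b : ℕ → ℝ) : Set (ℝ × ℝ) :=
  ⋃ j : ℕ, {p : ℝ × ℝ | a (j + 1) ≤ p.1 ∧ p.1 ≤ a j ∧
    b (j + 1) + pslope a b j * (p.1 - a (j + 1)) ≤ p.2}

end

/-- Complex-valued indicator function of a set in the plane, as a bilinear symbol. -/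
noncomputable def indC2 (S : Set (ℝ × ℝ)) (ξ η : ℝ) : ℂ := S.indicator 1 (ξ, η)

lemma abs_two_mul_le_add {P A B : ℝ} (hA : 0 ≤ A) (hB : 0 ≤ B) (h : P ^ 2 ≤ A * B) :
    |2 * P| ≤ A + B := by
  apply abs_le_of_sq_le_sq _ (by positivity)
  nlinarith [sq_nonneg (A - B)]

set_option maxHeartbeats 1000000 in
/-- The algebraic core of the Bellman inequality. -/
lemma bellman_core {r θ X Z R S T a d X1 X2 Y1 Y2 : ℝ} (hr : 1 ≤ r) (hθ0 : 0 ≤ θ)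
    (hθr : 2 * θ * r = r - 1) (hX : 0 ≤ X) (hZ : 0 < Z) (hR : 0 < R) (hS : S = X + R * Z)
    (hT : 0 < T) (hZT : Z * T ^ 2 ≤ S) (ha : 0 ≤ a) (hd : 0 ≤ d)
    (hXa : X1 ^ 2 + X2 ^ 2 ≤ 4 * X * a) (hYd : Y1 ^ 2 + Y2 ^ 2 ≤ 4 * Z * d) :
    d * T + a / T ≤ 2 * d * T
      + 2 * θ * (T / S) * (Y1 * (X1 + r * R * Y1) + Y2 * (X2 + r * R * Y2))
      + θ * (θ - 1) * Z * (T / S ^ 2) * ((X1 + r * R * Y1) ^ 2 + (X2 + r * R * Y2) ^ 2)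
      + θ * Z * (T / S) * (2 * a + r * (r - 1) * (R / Z) * (Y1 ^ 2 + Y2 ^ 2) + 2 * r * R * d)
      + 11 * r * (1 - θ) * (1 / T) *
        ((2 * a + r * (r - 1) * (R / Z) * (Y1 ^ 2 + Y2 ^ 2) + 2 * r * R * d)
          - θ / S * ((X1 + r * R * Y1) ^ 2 + (X2 + r * R * Y2) ^ 2)) := by
  have hSpos : 0 < S := by rw [hS]; positivity
  have hr0 : 0 < r := by linarith
  have hθ : θ ≤ 1 / 2 := by nlinarith
  set ζ := Y1 ^ 2 + Y2 ^ 2 with hζ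
  set S1 := X1 + r * R * Y1 with hS1
  set S2 := X2 + r * R * Y2 with hS2
  set σ := S1 ^ 2 + S2 ^ 2 with hσ
  have hζ0 : 0 ≤ ζ := by positivity
  have hσ0 : 0 ≤ σ := by positivity
  set k := ζ / Z with hk
  have hk0 : 0 ≤ k := by positivity
  have hζk : ζ = k * Z := by rw [hk]; field_simp
  have hkd : k ≤ 4 * d := by rw [hk, div_le_iff₀ hZ]; linarith
  -- the cross term
  have hcross : 2 * r * (X1 * Y1 + X2 * Y2) ≤ 4 * Z * a + X * r ^ 2 * k := by
    have h1 : (X1 * Y1 + X2 * Y2) ^ 2 ≤ (X1 ^ 2 + X2 ^ 2) * ζ := by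
      rw [hζ]; nlinarith [sq_nonneg (X1 * Y2 - X2 * Y1)]
    have h2 : (X1 * Y1 + X2 * Y2) ^ 2 ≤ 4 * X * a * ζ :=
      h1.trans (mul_le_mul_of_nonneg_right hXa hζ0)
    have h3 : (r * (X1 * Y1 + X2 * Y2)) ^ 2 ≤ (4 * Z * a) * (X * r ^ 2 * k) := by
      have := mul_le_mul_of_nonneg_left h2 (show 0 ≤ r ^ 2 by positivity)
      rw [hζk] at this
      linarith
    have := (abs_le.1 (abs_two_mul_le_add (by positivity) (by positivity) h3)).2
    linarith
  have hσS : σ ≤ S * (4 * a + r ^ 2 * R * k) := by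
    have : σ = (X1 ^ 2 + X2 ^ 2) + R * (2 * r * (X1 * Y1 + X2 * Y2)) + r ^ 2 * R ^ 2 * ζ := by
      rw [hσ, hS1, hS2, hζ]; ring
    rw [this, hS, hζk]
    nlinarith [mul_le_mul_of_nonneg_left hcross hR.le]
  set w := σ / S with hw
  have hw0 : 0 ≤ w := by positivity
  have hσw : σ = w * S := by rw [hw]; field_simp
  have hwle : w ≤ 4 * a + r ^ 2 * R * k := by
    rw [hw, div_le_iff₀ hSpos]; linarith
  have hL : r * (r - 1) * (R / Z) * ζ = r * (r - 1) * R * k := by rw [hζk]; field_simp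
  rw [hL]
  set D := 2 * a + r * (r - 1) * R * k + 2 * r * R * d with hD
  have hD0 : 0 ≤ D := by
    have : 0 ≤ r - 1 := by linarith
    positivity
  have hDw : 2 * a / r + 2 * r * R * d ≤ D - θ * w := by
    have h1 : θ * w ≤ θ * (4 * a + r ^ 2 * R * k) := mul_le_mul_of_nonneg_left hwle hθ0
    have h2 : θ * (r ^ 2 * R * k) = r * (r - 1) / 2 * R * k := by
      rw [← hθr]; ring
    have h3 : 0 ≤ r * (r - 1) * R * k := by
      have : 0 ≤ r - 1 := by linarith
      positivity
    have h4 : 2 * a / r = 2 * a - 4 * θ * a := by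
      rw [div_eq_iff hr0.ne']; linear_combination (2 * a) * hθr
    rw [h4, hD]; linarith
  have e1 : θ / S * σ = θ * w := by rw [hσw]; field_simp
  rw [e1]
  have hlast : (11 * a + 11 * r ^ 2 * R * d) / T ≤ 11 * r * (1 - θ) * (1 / T) * (D - θ * w) := by
    rw [show 11 * r * (1 - θ) * (1 / T) * (D - θ * w) = (11 * r * (1 - θ) * (D - θ * w)) / T by ring]
    apply div_le_div_of_nonneg_right _ hT.le
    have h5 : 11 * r / 2 ≤ 11 * r * (1 - θ) := by
      have := mul_le_mul_of_nonneg_left hθ hr0.le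
      linarith
    calc 11 * a + 11 * r ^ 2 * R * d = 11 * r / 2 * (2 * a / r + 2 * r * R * d) := by
          field_simp
      _ ≤ 11 * r * (1 - θ) * (2 * a / r + 2 * r * R * d) :=
          mul_le_mul_of_nonneg_right h5 (by positivity)
      _ ≤ _ := mul_le_mul_of_nonneg_left hDw (by linarith)
  have e2 : θ * (θ - 1) * Z * (T / S ^ 2) * σ = - (θ * (1 - θ) * (Z * T / S) * w) := by
    rw [hσw]; field_simp; ring
  rw [e2]
  have hZTS : Z * T / S ≤ 1 / T := by
    rw [div_le_div_iff₀ hSpos hT]; linarith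
  have hmid : 0 ≤ θ * Z * (T / S) * D := by positivity
  have hfirst : -(θ * T * d) - 4 * θ * (Z * T / S) * w
      ≤ 2 * θ * (T / S) * (Y1 * S1 + Y2 * S2) := by
    have h6 : -(2 * (Y1 * S1 + Y2 * S2)) ≤ S * k / 4 + 4 * Z * w := by
      have h7 : (Y1 * S1 + Y2 * S2) ^ 2 ≤ ζ * σ := by
        rw [hζ, hσ]; nlinarith [sq_nonneg (Y1 * S2 - Y2 * S1)]
      rw [hζk, hσw] at h7
      have h7' : (Y1 * S1 + Y2 * S2) ^ 2 ≤ (S * k / 4) * (4 * Z * w) := by linarith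
      exact (neg_le_abs _).trans (abs_two_mul_le_add (by positivity) (by positivity) h7')
    have h8 : S * k / 4 + 4 * Z * w ≤ S * d + 4 * Z * w := by
      have := mul_le_mul_of_nonneg_left hkd hSpos.le
      linarith
    have h9 : θ * (T / S) * (-(2 * (Y1 * S1 + Y2 * S2))) ≤ θ * (T / S) * (S * d + 4 * Z * w) :=
      mul_le_mul_of_nonneg_left (h6.trans h8) (by positivity)
    have e3 : θ * (T / S) * (S * d + 4 * Z * w) = θ * T * d + 4 * θ * (Z * T / S) * w := by
      field_simp
    rw [e3] at h9
    linarith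
  have hq : (Z * T / S) * w ≤ (4 * a + 4 * r ^ 2 * R * d) / T := by
    calc (Z * T / S) * w ≤ 1 / T * w := mul_le_mul_of_nonneg_right hZTS hw0
      _ ≤ 1 / T * (4 * a + 4 * r ^ 2 * R * d) := by
          apply mul_le_mul_of_nonneg_left _ (by positivity)
          have := mul_le_mul_of_nonneg_left hkd (show 0 ≤ r ^ 2 * R by positivity)
          linarith
      _ = _ := by ring
  set ww := (Z * T / S) * w with hww
  have hww0 : 0 ≤ ww := by positivity
  have h10 : θ * (1 - θ) * (Z * T / S) * w + 4 * θ * (Z * T / S) * w ≤ 5 / 2 * ww := by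
    have : θ * (1 - θ) * (Z * T / S) * w + 4 * θ * (Z * T / S) * w
      = (θ * (1 - θ) + 4 * θ) * ww := by rw [hww]; ring
    rw [this]
    apply mul_le_mul_of_nonneg_right _ hww0
    have : 0 ≤ θ ^ 2 := by positivity
    linarith [mul_nonneg hθ0 hθ0]
  have h11 : θ * T * d ≤ T * d / 2 := by
    have := mul_le_mul_of_nonneg_right hθ (mul_nonneg hT.le hd)
    linarith
  have e4 : (4 * a + 4 * r ^ 2 * R * d) / T = 4 * (a / T) + 4 * (r ^ 2 * R * d / T) := by ring
  have e5 : (11 * a + 11 * r ^ 2 * R * d) / T = 11 * (a / T) + 11 * (r ^ 2 * R * d / T) := by ring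
  rw [e4] at hq
  rw [e5] at hlast
  have h12 : 0 ≤ r ^ 2 * R * d / T := by positivity
  have h13 : 0 ≤ T * d := by positivity
  linarith

noncomputable section

/-- The Bellman function. -/
def bellB (r θ X Z : ℝ) : ℝ := Z * (X + Z ^ r) ^ θ + 11 * r * (X + Z ^ r) ^ (1 - θ)

/-- First derivative of the Bellman function along a path. -/
def bellB1 (r θ X Z X1 Z1 : ℝ) : ℝ :=
  Z1 * (X + Z ^ r) ^ θ + Z * (θ * (X + Z ^ r) ^ (θ - 1) * (X1 + r * Z ^ (r - 1) * Z1))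
    + 11 * r * ((1 - θ) * (X + Z ^ r) ^ (-θ) * (X1 + r * Z ^ (r - 1) * Z1))

/-- Second derivative of the Bellman function along a path. -/
def bellB2 (r θ X Z X1 Z1 X2 Z2 : ℝ) : ℝ :=
  Z2 * (X + Z ^ r) ^ θ + 2 * Z1 * (θ * (X + Z ^ r) ^ (θ - 1) * (X1 + r * Z ^ (r - 1) * Z1))
    + Z * (θ * ((θ - 1) * (X + Z ^ r) ^ (θ - 2)) * (X1 + r * Z ^ (r - 1) * Z1) ^ 2)
    + Z * (θ * (X + Z ^ r) ^ (θ - 1)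
        * (X2 + r * ((r - 1) * Z ^ (r - 2)) * Z1 ^ 2 + r * Z ^ (r - 1) * Z2))
    + 11 * r * ((1 - θ) * (-θ * (X + Z ^ r) ^ (-θ - 1)) * (X1 + r * Z ^ (r - 1) * Z1) ^ 2
      + (1 - θ) * (X + Z ^ r) ^ (-θ)
        * (X2 + r * ((r - 1) * Z ^ (r - 2)) * Z1 ^ 2 + r * Z ^ (r - 1) * Z2))

lemma bellS_pos {r X Z : ℝ} (hX : 0 ≤ X) (hZ : 0 < Z) : 0 < X + Z ^ r := by positivity

lemma hasDerivAt_bellB {r θ : ℝ} {X Z : ℝ → ℝ} {X1 Z1 s : ℝ} (hX0 : 0 ≤ X s) (hZ0 : 0 < Z s)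
    (hX : HasDerivAt X X1 s) (hZ : HasDerivAt Z Z1 s) :
    HasDerivAt (fun y => bellB r θ (X y) (Z y)) (bellB1 r θ (X s) (Z s) X1 Z1) s := by
  have hS := bellS_pos (r := r) hX0 hZ0
  have h1 := hX.add (hZ.rpow_const (p := r) (Or.inl hZ0.ne'))
  have h2 := h1.rpow_const (p := θ) (Or.inl hS.ne')
  have h3 := h1.rpow_const (p := 1 - θ) (Or.inl hS.ne')
  have h4 := (hZ.mul h2).add (h3.const_mul (11 * r))
  refine h4.congr_deriv ?_
  simp only [bellB1, Pi.add_apply]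
  rw [show 1 - θ - 1 = -θ by ring]
  ring

lemma hasDerivAt_bellB1 {r θ : ℝ} {X Z X1 Z1 : ℝ → ℝ} {X2 Z2 s : ℝ} (hX0 : 0 ≤ X s)
    (hZ0 : 0 < Z s) (hX : HasDerivAt X (X1 s) s) (hZ : HasDerivAt Z (Z1 s) s)
    (hX1 : HasDerivAt X1 X2 s) (hZ1 : HasDerivAt Z1 Z2 s) :
    HasDerivAt (fun y => bellB1 r θ (X y) (Z y) (X1 y) (Z1 y))
      (bellB2 r θ (X s) (Z s) (X1 s) (Z1 s) X2 Z2) s := by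
  have hS := bellS_pos (r := r) hX0 hZ0
  have h1 := hX.add (hZ.rpow_const (p := r) (Or.inl hZ0.ne'))
  have h2 := h1.rpow_const (p := θ) (Or.inl hS.ne')
  have h3 := h1.rpow_const (p := θ - 1) (Or.inl hS.ne')
  have h4 := h1.rpow_const (p := -θ) (Or.inl hS.ne')
  have h5 := hX1.add (((hZ.rpow_const (p := r - 1) (Or.inl hZ0.ne')).const_mul r).mul hZ1)
  have h6 := ((hZ1.mul h2).add (hZ.mul ((h3.const_mul θ).mul h5))).add
    (((h4.const_mul (1 - θ)).mul h5).const_mul (11 * r))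
  refine h6.congr_deriv ?_
  simp only [bellB2, Pi.add_apply, Pi.mul_apply]
  rw [show θ - 1 - 1 = θ - 2 by ring, show r - 1 - 1 = r - 2 by ring]
  ring

lemma bellB2_add_ge {r θ X Z a d X1 X2 Z1 Z2 X11 X22 Z11 Z22 α β : ℝ} (hr : 1 ≤ r) (hθ0 : 0 ≤ θ)
    (hθr : 2 * θ * r = r - 1) (hX : 0 ≤ X) (hZ : 0 < Z)
    (hXa : X1 ^ 2 + X2 ^ 2 ≤ 4 * X * a) (hYd : Z1 ^ 2 + Z2 ^ 2 ≤ 4 * Z * d)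
    (hXX : X11 + X22 = 2 * a) (hZZ : Z11 + Z22 = 2 * d)
    (hα : α ^ 2 ≤ a) (hβ : β ^ 2 ≤ d) :
    2 * (α * β) ≤ bellB2 r θ X Z X1 Z1 X11 Z11 + bellB2 r θ X Z X2 Z2 X22 Z22 := by
  have hS := bellS_pos (r := r) hX hZ
  have hr0 : 0 < r := by linarith
  have ha : 0 ≤ a := (sq_nonneg _).trans hα
  have hd : 0 ≤ d := (sq_nonneg _).trans hβ
  have hZr : Z ^ r = Z ^ (r - 1) * Z := by
    rw [← Real.rpow_add_one hZ.ne']; congr 1; ring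
  set S := X + Z ^ r with hSdef
  have hT : 0 < S ^ θ := Real.rpow_pos_of_pos hS _
  have hR : 0 < Z ^ (r - 1) := Real.rpow_pos_of_pos hZ _
  have hZT : Z * (S ^ θ) ^ 2 ≤ S := by
    have h1 : Z ≤ S ^ (1 / r) := by
      calc Z = (Z ^ r) ^ (1 / r) := by
            rw [← Real.rpow_mul hZ.le, mul_one_div_cancel hr0.ne', Real.rpow_one]
        _ ≤ S ^ (1 / r) := Real.rpow_le_rpow (by positivity) (by linarith) (by positivity)
    calc Z * (S ^ θ) ^ 2 ≤ S ^ (1 / r) * (S ^ θ) ^ 2 := by gcongr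
      _ = S ^ (1 / r + (θ + θ)) := by rw [Real.rpow_add hS, Real.rpow_add hS]; ring
      _ = S := by
        rw [show 1 / r + (θ + θ) = 1 by field_simp; linarith, Real.rpow_one]
  have key := bellman_core hr hθ0 hθr hX hZ hR (by rw [hSdef, hZr]) hT hZT ha hd hXa hYd
  have e1 : S ^ (θ - 1) = S ^ θ / S := by rw [Real.rpow_sub_one hS.ne']
  have e2 : S ^ (θ - 2) = S ^ θ / S ^ 2 := by
    rw [Real.rpow_sub hS]; norm_num
  have e3 : S ^ (-θ) = 1 / S ^ θ := by rw [Real.rpow_neg hS.le, one_div]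
  have e4 : S ^ (-θ - 1) = 1 / S ^ θ / S := by rw [Real.rpow_sub_one hS.ne', e3]
  have e5 : Z ^ (r - 2) = Z ^ (r - 1) / Z := by
    rw [← Real.rpow_sub_one hZ.ne']; congr 1; ring
  have hfin : 2 * (α * β) ≤ d * S ^ θ + a / S ^ θ := by
    have h1 : (α * β) ^ 2 ≤ (d * S ^ θ) * (a / S ^ θ) := by
      rw [show (d * S ^ θ) * (a / S ^ θ) = a * d by field_simp, mul_pow]
      gcongr
    exact (le_abs_self _).trans (abs_two_mul_le_add (by positivity) (by positivity) h1)
  refine hfin.trans (key.trans (le_of_eq ?_))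
  have hX22 : X22 = 2 * a - X11 := by linarith
  have hZ22 : Z22 = 2 * d - Z11 := by linarith
  simp only [bellB2]
  rw [← hSdef, e1, e2, e3, e4, e5, hX22, hZ22]
  ring

lemma rpow_le_of_mem {m M z s : ℝ} (hm : 0 < m) (h1 : m ≤ z) (h2 : z ≤ M) :
    z ^ s ≤ m ^ s + M ^ s := by
  have hz : 0 < z := hm.trans_le h1
  have hM : 0 < M := hz.trans_le h2
  have a1 : 0 < m ^ s := Real.rpow_pos_of_pos hm _
  have a2 : 0 < M ^ s := Real.rpow_pos_of_pos hM _
  rcases le_total 0 s with hs | hs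
  · have := Real.rpow_le_rpow hz.le h2 hs; linarith
  · have := Real.rpow_le_rpow_of_nonpos hm h1 hs; linarith

lemma bellB_bounds (r θ ε M : ℝ) (hε : 0 < ε) (hr : 1 ≤ r) : ∃ K : ℝ, 0 ≤ K ∧
    ∀ X Z X1 Z1 X2 Z2 w : ℝ, 0 ≤ X → X ≤ M → ε ≤ Z → Z ≤ M → 0 ≤ w → w ≤ M →
      |X1| ≤ w → |Z1| ≤ w → |X2| ≤ w → |Z2| ≤ w →
      |bellB1 r θ X Z X1 Z1| ≤ K * w ∧ |bellB2 r θ X Z X1 Z1 X2 Z2| ≤ K * w := by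
  set m := ε ^ r with hm
  have hm0 : 0 < m := Real.rpow_pos_of_pos hε _
  set N := M + M ^ r with hN
  let c : ℝ → ℝ := fun s => m ^ s + N ^ s
  let e : ℝ → ℝ := fun s => ε ^ s + M ^ s
  let k1 := 1 + r * e (r - 1)
  let k2 := 1 + r * (|r - 1| * e (r - 2)) * M + r * e (r - 1)
  let K1 := c θ + M * (|θ| * c (θ - 1) * k1) + 11 * r * (|1 - θ| * c (-θ) * k1)
  let K2 := c θ + 2 * M * (|θ| * c (θ - 1) * k1) + M * (|θ| * (|θ - 1| * c (θ - 2)) * (k1 ^ 2 * M))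
    + M * (|θ| * c (θ - 1) * k2) + 11 * r * (|1 - θ| * (|θ| * c (-θ - 1)) * (k1 ^ 2 * M)
      + |1 - θ| * c (-θ) * k2)
  refine ⟨max 0 (max K1 K2), le_max_left _ _, ?_⟩
  intro X Z X1 Z1 X2 Z2 w hX hXM hZ hZM hw hwM h1 h2 h3 h4
  have hM : 0 < M := hε.trans_le (hZ.trans hZM)
  have hZ0 : 0 < Z := hε.trans_le hZ
  have hr0 : 0 < r := by linarith
  have hS := bellS_pos (r := r) hX hZ0
  have hSm : m ≤ X + Z ^ r := by
    have := Real.rpow_le_rpow hε.le hZ hr0.le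
    linarith
  have hSN : X + Z ^ r ≤ N := by
    have := Real.rpow_le_rpow hZ0.le hZM hr0.le
    linarith
  have hc : ∀ s, |(X + Z ^ r) ^ s| ≤ c s := fun s => by
    rw [abs_of_pos (Real.rpow_pos_of_pos hS s)]; exact rpow_le_of_mem hm0 hSm hSN
  have he : ∀ s, |Z ^ s| ≤ e s := fun s => by
    rw [abs_of_pos (Real.rpow_pos_of_pos hZ0 s)]; exact rpow_le_of_mem hε hZ hZM
  have hc0 : ∀ s, 0 ≤ c s := fun s => (abs_nonneg _).trans (hc s)
  have he0 : ∀ s, 0 ≤ e s := fun s => (abs_nonneg _).trans (he s)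
  have hZa : |Z| ≤ M := by rwa [abs_of_pos hZ0]
  have hra : |r| = r := abs_of_pos hr0
  have hk1 : |X1 + r * Z ^ (r - 1) * Z1| ≤ k1 * w := by
    calc _ ≤ |X1| + |r * Z ^ (r - 1) * Z1| := abs_add_le _ _
      _ ≤ w + r * e (r - 1) * w := by
        rw [abs_mul, abs_mul, hra]
        have := he (r - 1)
        have := he0 (r - 1)
        gcongr
      _ = k1 * w := by simp only [k1]; ring
  have hk10 : 0 ≤ k1 := by have := he0 (r - 1); positivity
  have hk20 : 0 ≤ k2 := by have := he0 (r - 1); have := he0 (r - 2); positivity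
  have hsq : Z1 ^ 2 ≤ M * w := by
    rw [← sq_abs, sq]; exact mul_le_mul (h2.trans hwM) h2 (abs_nonneg _) hM.le
  have hk1s : |(X1 + r * Z ^ (r - 1) * Z1) ^ 2| ≤ k1 ^ 2 * M * w := by
    rw [abs_pow]
    calc _ ≤ (k1 * w) ^ 2 := by gcongr
      _ = k1 ^ 2 * w * w := by ring
      _ ≤ k1 ^ 2 * M * w := by gcongr
  have hk2 : |X2 + r * ((r - 1) * Z ^ (r - 2)) * Z1 ^ 2 + r * Z ^ (r - 1) * Z2| ≤ k2 * w := by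
    calc _ ≤ |X2| + |r * ((r - 1) * Z ^ (r - 2)) * Z1 ^ 2| + |r * Z ^ (r - 1) * Z2| :=
          abs_add_three _ _ _
      _ ≤ w + r * (|r - 1| * e (r - 2)) * (M * w) + r * e (r - 1) * w := by
        rw [abs_mul, abs_mul, abs_mul, abs_mul, abs_mul, hra, abs_of_nonneg (sq_nonneg Z1)]
        have := he (r - 1)
        have := he0 (r - 1)
        have := he (r - 2)
        have := he0 (r - 2)
        gcongr
      _ = k2 * w := by simp only [k2]; ring
  have A1 := hc θ
  have A2 := hc (θ - 1)
  have A3 := hc (-θ)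
  have A4 := hc (θ - 2)
  have A5 := hc (-θ - 1)
  have B1 := hc0 θ
  have B2 := hc0 (θ - 1)
  have B3 := hc0 (-θ)
  have B4 := hc0 (θ - 2)
  have B5 := hc0 (-θ - 1)
  constructor
  · refine le_trans ?_ (mul_le_mul_of_nonneg_right
      ((le_max_left K1 K2).trans (le_max_right 0 _)) hw)
    simp only [bellB1]
    refine (abs_add_three _ _ _).trans ?_
    simp only [abs_mul, hra, abs_of_pos (show (0:ℝ) < 11 by norm_num)]
    calc _ ≤ w * c θ + M * (|θ| * c (θ - 1) * (k1 * w))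
          + 11 * r * (|1 - θ| * c (-θ) * (k1 * w)) := by gcongr
      _ = K1 * w := by simp only [K1]; ring
  · refine le_trans ?_ (mul_le_mul_of_nonneg_right
      ((le_max_right K1 K2).trans (le_max_right 0 _)) hw)
    simp only [bellB2]
    refine (abs_add_le _ _).trans ?_
    refine (add_le_add (add_le_add (abs_add_three _ _ _) le_rfl |>.trans' (abs_add_le _ _)) le_rfl).trans ?_
    simp only [abs_mul, hra, abs_of_pos (show (0:ℝ) < 11 by norm_num), abs_of_pos (show (0:ℝ) < 2 by norm_num)]
    calc _ ≤ w * c θ + 2 * M * (|θ| * c (θ - 1) * (k1 * w))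
          + M * (|θ| * (|θ - 1| * c (θ - 2)) * (k1 ^ 2 * M * w))
          + M * (|θ| * c (θ - 1) * (k2 * w))
          + 11 * r * (|1 - θ| * (|θ| * c (-θ - 1)) * (k1 ^ 2 * M * w)
            + |1 - θ| * c (-θ) * (k2 * w)) := by
            have := h2.trans hwM
            gcongr
            refine (abs_add_le _ _).trans ?_
            simp only [abs_mul, abs_neg]
            gcongr
      _ = K2 * w := by simp only [K2]; ring

/-- Size of the Bellman function, with exponents `r = q - 1`, `θ = 1 - p / 2`. -/
lemma bellB_size {p q X Y ε : ℝ} (hpq : p.HolderConjugate q) (hp2 : p ≤ 2)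
    (hX : 0 ≤ X) (hY : 0 ≤ Y) (hε : 0 < ε) :
    0 ≤ bellB (q - 1) (1 - p / 2) X (Y + ε) - (1 + 11 * (q - 1)) * ε ^ (q / 2) ∧
    bellB (q - 1) (1 - p / 2) X (Y + ε) - (1 + 11 * (q - 1)) * ε ^ (q / 2) ≤
      (1 + 11 * (q - 1)) * (X ^ (p / 2)
        + q / 2 * 2 ^ (q / 2 - 1) * (Y ^ (q / 2) + ε ^ (q / 2 - 1) * Y)) := by
  have hp1 := hpq.lt
  have hq1 := hpq.symm.lt
  have hmul := hpq.mul_eq_add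
  have hq2 : 2 ≤ q := by nlinarith
  have hr0 : 0 < q - 1 := by linarith
  set Z := Y + ε with hZdef
  have hZ : 0 < Z := by positivity
  have hεZ : ε ≤ Z := by linarith
  have hS := bellS_pos (r := q - 1) hX hZ
  set S := X + Z ^ (q - 1) with hSdef
  have hZr : (Z ^ (q - 1)) ^ (p / 2) = Z ^ (q / 2) := by
    rw [← Real.rpow_mul hZ.le]; congr 1; linarith
  have hεr : (ε ^ (q - 1)) ^ (p / 2) = ε ^ (q / 2) := by
    rw [← Real.rpow_mul hε.le]; congr 1; linarith
  have hεr' : ε * (ε ^ (q - 1)) ^ (1 - p / 2) = ε ^ (q / 2) := by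
    rw [← Real.rpow_mul hε.le]
    nth_rewrite 1 [← Real.rpow_one ε]
    rw [← Real.rpow_add hε]; congr 1; linarith
  have hεS : ε ^ (q - 1) ≤ S := by
    have := Real.rpow_le_rpow hε.le hεZ hr0.le
    linarith
  have hεp : 0 < ε ^ (q - 1) := Real.rpow_pos_of_pos hε _
  have hB : bellB (q - 1) (1 - p / 2) X Z = Z * S ^ (1 - p / 2) + 11 * (q - 1) * S ^ (p / 2) := by
    simp only [bellB]; rw [← hSdef]; congr 3; ring
  have hZS : Z * S ^ (1 - p / 2) ≤ S ^ (p / 2) := by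
    have h1 : Z ≤ S ^ (p - 1) := by
      calc Z = (Z ^ (q - 1)) ^ (p - 1) := by
            rw [← Real.rpow_mul hZ.le, show (q - 1) * (p - 1) = 1 by linarith, Real.rpow_one]
        _ ≤ S ^ (p - 1) := Real.rpow_le_rpow (by positivity) (by linarith) (by linarith)
    calc Z * S ^ (1 - p / 2) ≤ S ^ (p - 1) * S ^ (1 - p / 2) := by gcongr
      _ = S ^ (p / 2) := by rw [← Real.rpow_add hS]; congr 1; ring
  have hSκ : S ^ (p / 2) ≤ X ^ (p / 2) + Z ^ (q / 2) := by
    rw [← hZr]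
    exact Real.rpow_add_le_add_rpow hX (by positivity) (by linarith) (by linarith)
  rw [hB]
  constructor
  · have h1 : ε * (ε ^ (q - 1)) ^ (1 - p / 2) ≤ Z * S ^ (1 - p / 2) :=
      mul_le_mul hεZ (Real.rpow_le_rpow hεp.le hεS (by linarith)) (by positivity) hZ.le
    have h2 : (ε ^ (q - 1)) ^ (p / 2) ≤ S ^ (p / 2) :=
      Real.rpow_le_rpow hεp.le hεS (by linarith)
    rw [hεr'] at h1
    rw [hεr] at h2
    have := mul_le_mul_of_nonneg_left h2 hr0.le
    linarith
  · have hZε : Z ^ (q / 2) - ε ^ (q / 2)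
        ≤ q / 2 * 2 ^ (q / 2 - 1) * (Y ^ (q / 2) + ε ^ (q / 2 - 1) * Y) := by
      set s := q / 2 with hs
      have hs1 : 1 ≤ s := by linarith
      have h1 : Z ^ s - ε ^ s ≤ s * Z ^ (s - 1) * Y := by
        have hb := one_add_mul_self_le_rpow_one_add (s := -(Y / Z)) (p := s)
          (by rw [neg_le_neg_iff, div_le_one hZ]; linarith) hs1
        rw [show 1 + -(Y / Z) = ε / Z by rw [hZdef]; field_simp; ring,
          Real.div_rpow hε.le hZ.le, le_div_iff₀ (Real.rpow_pos_of_pos hZ _)] at hb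
        have h3 : Z ^ s = Z ^ (s - 1) * Z := by
          rw [← Real.rpow_add_one hZ.ne']; congr 1; ring
        have h4 : (1 + s * -(Y / Z)) * Z ^ s = Z ^ s - s * Z ^ (s - 1) * Y := by
          rw [h3]; field_simp; ring
        linarith
      have h2 : Z ^ (s - 1) ≤ 2 ^ (s - 1) * (Y ^ (s - 1) + ε ^ (s - 1)) := by
        have a1 : 0 ≤ Y ^ (s - 1) := Real.rpow_nonneg hY _
        have a2 : 0 ≤ ε ^ (s - 1) := Real.rpow_nonneg hε.le _
        rcases le_total Y ε with h | h
        · calc Z ^ (s - 1) ≤ (2 * ε) ^ (s - 1) :=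
                Real.rpow_le_rpow hZ.le (by linarith) (by linarith)
            _ = 2 ^ (s - 1) * ε ^ (s - 1) := Real.mul_rpow (by norm_num) hε.le
            _ ≤ _ := by gcongr; linarith
        · calc Z ^ (s - 1) ≤ (2 * Y) ^ (s - 1) :=
                Real.rpow_le_rpow hZ.le (by linarith) (by linarith)
            _ = 2 ^ (s - 1) * Y ^ (s - 1) := Real.mul_rpow (by norm_num) hY
            _ ≤ _ := by gcongr; linarith
      have h5 : Y ^ s = Y ^ (s - 1) * Y := by
        rw [← Real.rpow_add_one' hY (by linarith)]; congr 1; ring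
      rw [h5]
      calc _ ≤ s * Z ^ (s - 1) * Y := h1
        _ ≤ s * (2 ^ (s - 1) * (Y ^ (s - 1) + ε ^ (s - 1))) * Y := by gcongr
        _ = _ := by ring
    have h6 : Z * S ^ (1 - p / 2) + 11 * (q - 1) * S ^ (p / 2)
        ≤ (1 + 11 * (q - 1)) * (X ^ (p / 2) + Z ^ (q / 2)) := by
      have := mul_le_mul_of_nonneg_left hSκ (show 0 ≤ 1 + 11 * (q - 1) by positivity)
      linarith
    have := mul_le_mul_of_nonneg_left hZε (show 0 ≤ 1 + 11 * (q - 1) by positivity)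
    linarith

end

set_option linter.unusedSectionVars false

noncomputable section

/-- The Poisson kernel of the upper half plane. -/
def pk (t x : ℝ) : ℝ := t / (Real.pi * (x ^ 2 + t ^ 2))

/-- The `t`-derivative of the Poisson kernel. -/
def pkt (t x : ℝ) : ℝ := (x ^ 2 - t ^ 2) / (Real.pi * (x ^ 2 + t ^ 2) ^ 2)

/-- The `x`-derivative of the Poisson kernel. -/
def pkx (t x : ℝ) : ℝ := -(2 * x * t) / (Real.pi * (x ^ 2 + t ^ 2) ^ 2)

/-- The second `t`-derivative of the Poisson kernel. -/
def pktt (t x : ℝ) : ℝ := 2 * t * (t ^ 2 - 3 * x ^ 2) / (Real.pi * (x ^ 2 + t ^ 2) ^ 3)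

lemma hasDerivAt_pk_t {t : ℝ} (ht : 0 < t) (x : ℝ) :
    HasDerivAt (fun s => pk s x) (pkt t x) t := by
  have hD : x ^ 2 + t ^ 2 ≠ 0 := by positivity
  have h := (hasDerivAt_id t).div ((((hasDerivAt_id t).pow 2).const_add (x ^ 2)).const_mul Real.pi)
    (mul_ne_zero Real.pi_ne_zero hD)
  refine h.congr_deriv ?_
  simp only [pkt, id, Pi.pow_apply]
  field_simp
  push_cast
  ring

lemma hasDerivAt_pkt_t {t : ℝ} (ht : 0 < t) (x : ℝ) :
    HasDerivAt (fun s => pkt s x) (pktt t x) t := by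
  have hD : x ^ 2 + t ^ 2 ≠ 0 := by positivity
  have h := (((hasDerivAt_id t).pow 2).const_sub (x ^ 2)).div
    (((((hasDerivAt_id t).pow 2).const_add (x ^ 2)).pow 2).const_mul Real.pi)
    (by simp only [id, Pi.pow_apply]; positivity)
  refine h.congr_deriv ?_
  simp only [pktt, id, Pi.pow_apply]
  field_simp
  push_cast
  ring

lemma hasDerivAt_pk_x {t : ℝ} (ht : 0 < t) (x : ℝ) :
    HasDerivAt (fun y => pk t y) (pkx t x) x := by
  have hD : x ^ 2 + t ^ 2 ≠ 0 := by positivity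
  have h := (hasDerivAt_const x t).div
    ((((hasDerivAt_id x).pow 2).add_const (t ^ 2)).const_mul Real.pi)
    (mul_ne_zero Real.pi_ne_zero hD)
  refine h.congr_deriv ?_
  simp only [pkx, id, Pi.pow_apply]
  field_simp
  push_cast
  ring

lemma hasDerivAt_pkx_x {t : ℝ} (ht : 0 < t) (x : ℝ) :
    HasDerivAt (fun y => pkx t y) (-pktt t x) x := by
  have hD : x ^ 2 + t ^ 2 ≠ 0 := by positivity
  have h := ((((hasDerivAt_id x).const_mul 2).mul_const t).neg).div
    (((((hasDerivAt_id x).pow 2).add_const (t ^ 2)).pow 2).const_mul Real.pi)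
    (by simp only [id, Pi.pow_apply]; positivity)
  refine h.congr_deriv ?_
  simp only [pktt, id, Pi.pow_apply, Pi.neg_apply]
  field_simp
  push_cast
  ring

lemma pk_bounds {t0 T : ℝ} (h0 : 0 < t0) (hT : t0 ≤ T) : ∃ C : ℝ, 0 ≤ C ∧
    ∀ t, t0 ≤ t → t ≤ T → ∀ x, |pk t x| ≤ C / (1 + x ^ 2) ∧ |pkt t x| ≤ C / (1 + x ^ 2) ∧
      |pkx t x| ≤ C / (1 + x ^ 2) ∧ |pktt t x| ≤ C / (1 + x ^ 2) := by
  set m := min 1 (t0 ^ 2) with hm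
  have hm0 : 0 < m := by positivity
  have hT0 : 0 < T := h0.trans_le hT
  refine ⟨(T + 1 + 6 / t0) / m, by positivity, fun t h1 h2 x => ?_⟩
  have ht : 0 < t := h0.trans_le h1
  set D := x ^ 2 + t ^ 2 with hD
  have hD0 : 0 < D := by positivity
  have hmD : m * (1 + x ^ 2) ≤ D := by
    have a1 : m * x ^ 2 ≤ 1 * x ^ 2 := mul_le_mul_of_nonneg_right (min_le_left _ _) (sq_nonneg x)
    have a2 : m ≤ t0 ^ 2 := min_le_right _ _
    have a3 : t0 ^ 2 ≤ t ^ 2 := by gcongr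
    linarith
  have hpi : 1 ≤ Real.pi := by linarith [Real.pi_gt_three]
  have key : ∀ A : ℝ, A ≤ T + 1 + 6 / t0 → A / D ≤ (T + 1 + 6 / t0) / m / (1 + x ^ 2) := by
    intro A hA
    rw [div_div]
    exact div_le_div₀ (by positivity) hA (by positivity) hmD
  have h6 : 0 < 6 / t0 := by positivity
  refine ⟨?_, ?_, ?_, ?_⟩
  · refine le_trans ?_ (key T (by linarith))
    rw [pk, abs_of_nonneg (by positivity)]
    exact div_le_div₀ hT0.le h2 hD0 (le_mul_of_one_le_left hD0.le hpi)
  · refine le_trans ?_ (key 1 (by linarith))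
    rw [pkt, abs_div, abs_of_pos (show 0 < Real.pi * (x ^ 2 + t ^ 2) ^ 2 by positivity), ← hD,
      div_le_div_iff₀ (by positivity) hD0]
    have : |x ^ 2 - t ^ 2| ≤ D := by
      rw [abs_le]; constructor <;> nlinarith [sq_nonneg x, sq_nonneg t]
    nlinarith [mul_le_mul_of_nonneg_right this hD0.le,
      mul_le_mul_of_nonneg_right hpi (sq_nonneg D)]
  · refine le_trans ?_ (key 1 (by linarith))
    rw [pkx, abs_div, abs_of_pos (show 0 < Real.pi * (x ^ 2 + t ^ 2) ^ 2 by positivity), ← hD,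
      div_le_div_iff₀ (by positivity) hD0]
    have : |-(2 * x * t)| ≤ D := by
      rw [abs_le]; constructor <;> nlinarith [sq_nonneg (x - t), sq_nonneg (x + t)]
    nlinarith [mul_le_mul_of_nonneg_right this hD0.le,
      mul_le_mul_of_nonneg_right hpi (sq_nonneg D)]
  · refine le_trans ?_ (key (6 / t0) (by linarith))
    rw [pktt, abs_div, abs_of_pos (show 0 < Real.pi * (x ^ 2 + t ^ 2) ^ 3 by positivity), ← hD]
    have h3 : |2 * t * (t ^ 2 - 3 * x ^ 2)| ≤ 6 * t * D := by
      rw [abs_mul, abs_of_pos (show 0 < 2 * t by positivity)]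
      have : |t ^ 2 - 3 * x ^ 2| ≤ 3 * D := by
        rw [abs_le]; constructor <;> nlinarith [sq_nonneg x, sq_nonneg t]
      nlinarith
    calc |2 * t * (t ^ 2 - 3 * x ^ 2)| / (Real.pi * D ^ 3) ≤ 6 * t * D / (1 * D ^ 3) := by gcongr
      _ = 6 * t / D / D := by field_simp
      _ ≤ 6 / t0 / D := by
        apply div_le_div_of_nonneg_right _ hD0.le
        rw [div_le_div_iff₀ hD0 h0]
        nlinarith [sq_nonneg x]

lemma one_div_shift_le {x h : ℝ} (hh : |h| ≤ 1) : 1 / (1 + (x + h) ^ 2) ≤ 3 / (1 + x ^ 2) := by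
  rw [div_le_div_iff₀ (by positivity) (by positivity)]
  have : h ^ 2 ≤ 1 := by rw [← sq_abs]; nlinarith [abs_nonneg h]
  nlinarith [sq_nonneg (x + 2 * h)]

lemma measurable_pk : Measurable (Function.uncurry pk) := by
  unfold Function.uncurry pk; fun_prop

lemma measurable_pkt : Measurable (Function.uncurry pkt) := by
  unfold Function.uncurry pkt; fun_prop

lemma measurable_pkx : Measurable (Function.uncurry pkx) := by
  unfold Function.uncurry pkx; fun_prop

lemma measurable_pktt : Measurable (Function.uncurry pktt) := by
  unfold Function.uncurry pktt; fun_prop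

variable {E : Type*} [NormedAddCommGroup E] [NormedSpace ℝ E]

/-- Convolution of a kernel depending on a parameter with a function. -/
def kconv (K : ℝ → ℝ → ℝ) (f : ℝ → E) (t x : ℝ) : E := ∫ y, K t (x - y) • f y

/-- A majorant for all Poisson type convolutions. -/
def majo (f : ℝ → E) (x : ℝ) : ℝ := ∫ y, 1 / (1 + (x - y) ^ 2) * ‖f y‖

lemma integrable_one_div (x : ℝ) : Integrable (fun y : ℝ => 1 / (1 + (x - y) ^ 2)) := by
  have := integrable_inv_one_add_sq.comp_sub_left x
  simpa using this

lemma integrable_kernel_smul {k : ℝ → ℝ} {f : ℝ → E} {x C M : ℝ} (hk : Measurable k)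
    (hkC : ∀ y, |k y| ≤ C / (1 + (x - y) ^ 2)) (hf : StronglyMeasurable f)
    (hfM : ∀ y, ‖f y‖ ≤ M) : Integrable (fun y => k y • f y) := by
  refine ((integrable_one_div x).const_mul (C * M)).mono'
    (hk.stronglyMeasurable.smul hf).aestronglyMeasurable (ae_of_all _ fun y => ?_)
  rw [norm_smul, Real.norm_eq_abs]
  calc |k y| * ‖f y‖ ≤ C / (1 + (x - y) ^ 2) * M :=
        mul_le_mul (hkC y) (hfM y) (norm_nonneg _) ((abs_nonneg _).trans (hkC y))
    _ = _ := by ring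

lemma integrable_majo {f : ℝ → E} {M : ℝ} (hf : StronglyMeasurable f) (hfM : ∀ y, ‖f y‖ ≤ M)
    (x : ℝ) : Integrable (fun y => 1 / (1 + (x - y) ^ 2) * ‖f y‖) := by
  have := integrable_kernel_smul (k := fun y => 1 / (1 + (x - y) ^ 2)) (x := x) (C := 1)
    (by fun_prop) (fun y => by rw [abs_of_pos (by positivity)]) hf.norm
    (M := M) (by simpa using hfM)
  simpa using this

lemma norm_kernel_integral_le {k : ℝ → ℝ} {f : ℝ → E} {x C M : ℝ}
    (hkC : ∀ y, |k y| ≤ C / (1 + (x - y) ^ 2)) (hf : StronglyMeasurable f)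
    (hfM : ∀ y, ‖f y‖ ≤ M) : ‖∫ y, k y • f y‖ ≤ C * majo f x := by
  rw [majo, ← integral_const_mul]
  refine norm_integral_le_of_norm_le ((integrable_majo hf hfM x).const_mul C)
    (ae_of_all _ fun y => ?_)
  rw [norm_smul, Real.norm_eq_abs]
  calc |k y| * ‖f y‖ ≤ C / (1 + (x - y) ^ 2) * ‖f y‖ :=
        mul_le_mul_of_nonneg_right (hkC y) (norm_nonneg _)
    _ = _ := by ring

lemma majo_nonneg (f : ℝ → E) (x : ℝ) : 0 ≤ majo f x :=
  integral_nonneg fun y => by positivity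

lemma majo_le {f : ℝ → E} {M : ℝ} (hf : StronglyMeasurable f) (hfM : ∀ y, ‖f y‖ ≤ M) (x : ℝ) :
    majo f x ≤ Real.pi * M := by
  have h1 : ∫ y, 1 / (1 + (x - y) ^ 2) = Real.pi := by
    rw [integral_sub_left_eq_self (fun y => 1 / (1 + y ^ 2)) volume x]
    simp [integral_univ_inv_one_add_sq]
  rw [majo, ← h1, ← integral_mul_const]
  exact integral_mono (integrable_majo hf hfM x) ((integrable_one_div x).mul_const M)
    fun y => mul_le_mul_of_nonneg_left (hfM y) (by positivity)

lemma measurable_majo {f : ℝ → E} (hf : StronglyMeasurable f) : Measurable (majo f) := by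
  have : StronglyMeasurable (Function.uncurry fun x y : ℝ => 1 / (1 + (x - y) ^ 2) * ‖f y‖) := by
    apply StronglyMeasurable.mul
    · exact (by fun_prop : Measurable fun p : ℝ × ℝ => 1 / (1 + (p.1 - p.2) ^ 2)).stronglyMeasurable
    · exact (hf.comp_measurable measurable_snd).norm
  exact this.integral_prod_right.measurable

lemma stronglyMeasurable_kconv {K : ℝ → ℝ → ℝ} {f : ℝ → E} (hK : Measurable (Function.uncurry K))
    (hf : StronglyMeasurable f) : StronglyMeasurable (Function.uncurry (kconv K f)) := by
  have : StronglyMeasurable (Function.uncurry fun (p : ℝ × ℝ) (y : ℝ) =>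
      K p.1 (p.2 - y) • f y) := by
    apply StronglyMeasurable.smul
    · exact (hK.comp (by fun_prop : Measurable fun q : (ℝ × ℝ) × ℝ =>
        (q.1.1, q.1.2 - q.2))).stronglyMeasurable
    · exact hf.comp_measurable measurable_snd
  exact this.integral_prod_right

lemma hasDerivAt_kernel {G G' : ℝ → ℝ → ℝ} {f : ℝ → E} {s0 δ x C M : ℝ} (hδ : 0 < δ)
    (hG : ∀ s ∈ Metric.ball s0 δ, ∀ y, HasDerivAt (fun s => G s y) (G' s y) s)
    (hGm : ∀ s, Measurable (G s)) (hG'm : ∀ s, Measurable (G' s))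
    (hGC : ∀ y, |G s0 y| ≤ C / (1 + (x - y) ^ 2))
    (hG'C : ∀ s ∈ Metric.ball s0 δ, ∀ y, |G' s y| ≤ C / (1 + (x - y) ^ 2))
    (hf : StronglyMeasurable f) (hfM : ∀ y, ‖f y‖ ≤ M) :
    HasDerivAt (fun s => ∫ y, G s y • f y) (∫ y, G' s0 y • f y) s0 := by
  refine (hasDerivAt_integral_of_dominated_loc_of_deriv_le
    (bound := fun y => C * M * (1 / (1 + (x - y) ^ 2)))
    (Metric.ball_mem_nhds s0 hδ) (Filter.Eventually.of_forall fun s =>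
      ((hGm s).stronglyMeasurable.smul hf).aestronglyMeasurable)
    (integrable_kernel_smul (hGm s0) hGC hf hfM)
    ((hG'm s0).stronglyMeasurable.smul hf).aestronglyMeasurable
    (ae_of_all _ fun y s hs => ?_) ((integrable_one_div x).const_mul (C * M))
    (ae_of_all _ fun y s hs => (hG s hs y).smul_const (f y))).2
  rw [norm_smul, Real.norm_eq_abs]
  calc |G' s y| * ‖f y‖ ≤ C / (1 + (x - y) ^ 2) * M :=
        mul_le_mul (hG'C s hs y) (hfM y) (norm_nonneg _) ((abs_nonneg _).trans (hG'C s hs y))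
    _ = _ := by ring

section deriv

variable {f : ℝ → E} {M t : ℝ}

lemma mem_ball_half {s t : ℝ} (hs : s ∈ Metric.ball t (t / 2)) : t / 2 ≤ s ∧ s ≤ 2 * t := by
  rw [Metric.mem_ball, Real.dist_eq, abs_lt] at hs
  constructor <;> linarith

lemma hasDerivAt_kconv_pk_t (hf : StronglyMeasurable f) (hfM : ∀ y, ‖f y‖ ≤ M) (ht : 0 < t)
    (x : ℝ) : HasDerivAt (fun s => kconv pk f s x) (kconv pkt f t x) t := by
  obtain ⟨C, -, hC⟩ := pk_bounds (t0 := t / 2) (T := 2 * t) (by linarith) (by linarith)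
  exact hasDerivAt_kernel (G := fun s y => pk s (x - y)) (G' := fun s y => pkt s (x - y))
    (δ := t / 2) (x := x) (C := C) (by linarith)
    (fun s hs y => hasDerivAt_pk_t (by linarith [(mem_ball_half hs).1]) _)
    (fun s => measurable_pk.comp (by fun_prop : Measurable fun y => (s, x - y)))
    (fun s => measurable_pkt.comp (by fun_prop : Measurable fun y => (s, x - y)))
    (fun y => (hC t (by linarith) (by linarith) _).1)
    (fun s hs y => (hC s (mem_ball_half hs).1 (mem_ball_half hs).2 _).2.1) hf hfM

lemma hasDerivAt_kconv_pkt_t (hf : StronglyMeasurable f) (hfM : ∀ y, ‖f y‖ ≤ M) (ht : 0 < t)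
    (x : ℝ) : HasDerivAt (fun s => kconv pkt f s x) (kconv pktt f t x) t := by
  obtain ⟨C, -, hC⟩ := pk_bounds (t0 := t / 2) (T := 2 * t) (by linarith) (by linarith)
  exact hasDerivAt_kernel (G := fun s y => pkt s (x - y)) (G' := fun s y => pktt s (x - y))
    (δ := t / 2) (x := x) (C := C) (by linarith)
    (fun s hs y => hasDerivAt_pkt_t (by linarith [(mem_ball_half hs).1]) _)
    (fun s => measurable_pkt.comp (by fun_prop : Measurable fun y => (s, x - y)))
    (fun s => measurable_pktt.comp (by fun_prop : Measurable fun y => (s, x - y)))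
    (fun y => (hC t (by linarith) (by linarith) _).2.1)
    (fun s hs y => (hC s (mem_ball_half hs).1 (mem_ball_half hs).2 _).2.2.2) hf hfM

lemma shift_bound {C x s y a : ℝ} (hC : 0 ≤ C) (hs : s ∈ Metric.ball x 1)
    (h : |a| ≤ C / (1 + (s - y) ^ 2)) : |a| ≤ 3 * C / (1 + (x - y) ^ 2) := by
  rw [Metric.mem_ball, Real.dist_eq] at hs
  have := one_div_shift_le (x := x - y) hs.le
  calc |a| ≤ C * (1 / (1 + (x - y + (s - x)) ^ 2)) := by
        refine h.trans (le_of_eq ?_)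
        rw [mul_one_div]; congr 3; ring
    _ ≤ C * (3 / (1 + (x - y) ^ 2)) := mul_le_mul_of_nonneg_left this hC
    _ = _ := by ring

lemma hasDerivAt_kconv_pk_x (hf : StronglyMeasurable f) (hfM : ∀ y, ‖f y‖ ≤ M) (ht : 0 < t)
    (x : ℝ) : HasDerivAt (fun z => kconv pk f t z) (kconv pkx f t x) x := by
  obtain ⟨C, hC0, hC⟩ := pk_bounds ht le_rfl
  exact hasDerivAt_kernel (G := fun s y => pk t (s - y)) (G' := fun s y => pkx t (s - y))
    (δ := 1) (x := x) (C := 3 * C) one_pos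
    (fun s hs y => (hasDerivAt_pk_x ht (s - y)).comp_sub_const s y)
    (fun s => measurable_pk.comp (by fun_prop : Measurable fun y => (t, s - y)))
    (fun s => measurable_pkx.comp (by fun_prop : Measurable fun y => (t, s - y)))
    (fun y => shift_bound hC0 (Metric.mem_ball_self one_pos) (hC t le_rfl le_rfl _).1)
    (fun s hs y => shift_bound hC0 hs (hC t le_rfl le_rfl _).2.2.1) hf hfM

lemma hasDerivAt_kconv_pkx_x (hf : StronglyMeasurable f) (hfM : ∀ y, ‖f y‖ ≤ M) (ht : 0 < t)
    (x : ℝ) : HasDerivAt (fun z => kconv pkx f t z) (-kconv pktt f t x) x := by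
  obtain ⟨C, hC0, hC⟩ := pk_bounds ht le_rfl
  have := hasDerivAt_kernel (G := fun s y => pkx t (s - y)) (G' := fun s y => -pktt t (s - y))
    (f := f) (M := M) (δ := 1) (x := x) (C := 3 * C) one_pos
    (fun s hs y => (hasDerivAt_pkx_x ht (s - y)).comp_sub_const s y)
    (fun s => measurable_pkx.comp (by fun_prop : Measurable fun y => (t, s - y)))
    (fun s => (measurable_pktt.comp (by fun_prop : Measurable fun y => (t, s - y))).neg)
    (fun y => shift_bound hC0 (Metric.mem_ball_self one_pos) (hC t le_rfl le_rfl _).2.2.1)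
    (fun s hs y => by
      rw [abs_neg]; exact shift_bound hC0 hs (hC t le_rfl le_rfl _).2.2.2) hf hfM
  simp only [neg_smul, integral_neg] at this
  exact this

end deriv

lemma kconv_bounds {f : ℝ → E} {M t0 T : ℝ} (hf : StronglyMeasurable f) (hfM : ∀ y, ‖f y‖ ≤ M)
    (h0 : 0 < t0) (hT : t0 ≤ T) : ∃ C : ℝ, 0 ≤ C ∧ ∀ t, t0 ≤ t → t ≤ T → ∀ x,
      ‖kconv pk f t x‖ ≤ C * majo f x ∧ ‖kconv pkt f t x‖ ≤ C * majo f x ∧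
      ‖kconv pkx f t x‖ ≤ C * majo f x ∧ ‖kconv pktt f t x‖ ≤ C * majo f x := by
  obtain ⟨C, hC0, hC⟩ := pk_bounds h0 hT
  exact ⟨C, hC0, fun t h1 h2 x =>
    ⟨norm_kernel_integral_le (fun y => (hC t h1 h2 _).1) hf hfM,
      norm_kernel_integral_le (fun y => (hC t h1 h2 _).2.1) hf hfM,
      norm_kernel_integral_le (fun y => (hC t h1 h2 _).2.2.1) hf hfM,
      norm_kernel_integral_le (fun y => (hC t h1 h2 _).2.2.2) hf hfM⟩⟩

end

/-- Schur's test with a symmetric bound. -/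
lemma lintegral_schur {k : ℝ → ℝ → ℝ≥0∞} {h : ℝ → ℝ≥0∞} {A : ℝ≥0∞} {p : ℝ} (hp : 1 ≤ p)
    (hk : Measurable (Function.uncurry k)) (hh : Measurable h)
    (h1 : ∀ x, ∫⁻ y, k x y ≤ A) (h2 : ∀ y, ∫⁻ x, k x y ≤ A) :
    ∫⁻ x, (∫⁻ y, k x y * h y) ^ p ≤ A ^ p * ∫⁻ y, h y ^ p := by
  have hp0 : 0 < p := by linarith
  have hkx : ∀ x, Measurable (k x) := fun x => hk.comp measurable_prodMk_left
  have key : ∀ x, (∫⁻ y, k x y * h y) ^ p ≤ A ^ (p - 1) * ∫⁻ y, k x y * h y ^ p := by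
    intro x
    rcases hp.eq_or_lt with rfl | hp1
    · simp
    have hpq := Real.HolderConjugate.conjExponent hp1
    set q := p.conjExponent
    have hq0 : 0 < q := hpq.symm.pos
    have e1 : ∀ y, k x y * h y = (fun y => k x y ^ (1 / q)) y * (fun y => k x y ^ (1 / p) * h y) y := by
      intro y
      simp only
      rw [← mul_assoc, ← ENNReal.rpow_add_of_nonneg _ _ (by positivity) (by positivity)]
      have : 1 / q + 1 / p = 1 := by rw [add_comm]; simpa using hpq.inv_add_inv_eq_one
      rw [this, ENNReal.rpow_one]
    have hH := ENNReal.lintegral_mul_le_Lp_mul_Lq volume hpq.symm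
      ((hkx x).pow_const (1 / q)).aemeasurable
      (((hkx x).pow_const (1 / p)).mul hh).aemeasurable
    simp only [Pi.mul_apply] at hH
    simp_rw [← e1] at hH
    have e2 : ∀ y, (k x y ^ (1 / q)) ^ q = k x y := fun y => by
      rw [← ENNReal.rpow_mul, one_div_mul_cancel hq0.ne', ENNReal.rpow_one]
    have e3 : ∀ y, (k x y ^ (1 / p) * h y) ^ p = k x y * h y ^ p := fun y => by
      rw [ENNReal.mul_rpow_of_nonneg _ _ hp0.le, ← ENNReal.rpow_mul, one_div_mul_cancel hp0.ne',
        ENNReal.rpow_one]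
    simp_rw [e2, e3] at hH
    calc (∫⁻ y, k x y * h y) ^ p
        ≤ ((∫⁻ y, k x y) ^ (1 / q) * (∫⁻ y, k x y * h y ^ p) ^ (1 / p)) ^ p := by gcongr
      _ = (∫⁻ y, k x y) ^ (p - 1) * ∫⁻ y, k x y * h y ^ p := by
        rw [ENNReal.mul_rpow_of_nonneg _ _ hp0.le, ← ENNReal.rpow_mul, ← ENNReal.rpow_mul,
          one_div_mul_cancel hp0.ne', ENNReal.rpow_one]
        congr 2
        have := hpq.symm.sub_one_mul_conj
        rw [one_div, inv_mul_eq_div, div_eq_iff hq0.ne']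
        linarith [hpq.mul_eq_add]
      _ ≤ _ := by
        gcongr
        exact h1 x
  calc ∫⁻ x, (∫⁻ y, k x y * h y) ^ p ≤ ∫⁻ x, A ^ (p - 1) * ∫⁻ y, k x y * h y ^ p :=
        lintegral_mono key
    _ = A ^ (p - 1) * ∫⁻ x, ∫⁻ y, k x y * h y ^ p := by
        have hm : Measurable (Function.uncurry fun x y => k x y * h y ^ p) :=
          hk.mul ((hh.comp measurable_snd).pow_const p)
        rw [lintegral_const_mul _ hm.lintegral_prod_right]
    _ = A ^ (p - 1) * ∫⁻ y, (∫⁻ x, k x y) * h y ^ p := by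
        have hm : Measurable (Function.uncurry fun x y => k x y * h y ^ p) :=
          hk.mul ((hh.comp measurable_snd).pow_const p)
        rw [lintegral_lintegral_swap hm.aemeasurable]
        congr 1
        refine lintegral_congr fun y => ?_
        exact lintegral_mul_const _ (hk.comp measurable_prodMk_right)
    _ ≤ A ^ (p - 1) * ∫⁻ y, A * h y ^ p := by
        gcongr with y
        exact h2 y
    _ = A ^ p * ∫⁻ y, h y ^ p := by
        rw [lintegral_const_mul _ (hh.pow_const p), ← mul_assoc]
        congr 1
        nth_rewrite 2 [← ENNReal.rpow_one A]
        rw [← ENNReal.rpow_add_of_nonneg _ _ (by linarith) zero_le_one]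
        congr 1; ring

/-- Young's convolution inequality with an `L¹` kernel. -/
lemma lintegral_young {k h : ℝ → ℝ≥0∞} {p : ℝ} (hp : 1 ≤ p) (hk : Measurable k)
    (hh : Measurable h) :
    ∫⁻ x, (∫⁻ y, k (x - y) * h y) ^ p ≤ (∫⁻ y, k y) ^ p * ∫⁻ y, h y ^ p := by
  refine lintegral_schur (k := fun x y => k (x - y)) hp (hk.comp (by fun_prop)) hh
    (fun x => ?_) (fun y => ?_)
  · rw [lintegral_sub_left_eq_self (fun y => k y) x]
  · rw [lintegral_sub_right_eq_self (fun x => k x) y]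

lemma lintegral_pk {t : ℝ} (ht : 0 < t) : ∫⁻ x, ENNReal.ofReal (pk t x) = 1 := by
  have e : ∀ x, pk t x = (1 / (Real.pi * t)) * (1 + (x / t) ^ 2)⁻¹ := fun x => by
    rw [pk]; field_simp; ring
  have h1 : Integrable (fun x : ℝ => (1 + (x / t) ^ 2)⁻¹) :=
    integrable_inv_one_add_sq.comp_div ht.ne'
  have h2 : ∫ x : ℝ, (1 + (x / t) ^ 2)⁻¹ = t * Real.pi := by
    rw [Measure.integral_comp_div (fun x : ℝ => (1 + x ^ 2)⁻¹) t, integral_univ_inv_one_add_sq,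
      abs_of_pos ht, smul_eq_mul]
  simp_rw [e]
  rw [← ofReal_integral_eq_lintegral_ofReal (h1.const_mul _)
    (ae_of_all _ fun x => by positivity), integral_const_mul, h2]
  rw [show 1 / (Real.pi * t) * (t * Real.pi) = 1 by field_simp]
  simp

section

variable {E : Type*} [NormedAddCommGroup E] [NormedSpace ℝ E]

lemma lintegral_kconv_le {K : ℝ → ℝ} {f : ℝ → E} {p : ℝ} (hp : 1 ≤ p) (hK : Measurable K)
    (hf : StronglyMeasurable f) :
    ∫⁻ x, ‖∫ y, K (x - y) • f y‖ₑ ^ p ≤ (∫⁻ y, ‖K y‖ₑ) ^ p * ∫⁻ y, ‖f y‖ₑ ^ p := by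
  refine le_trans (lintegral_mono fun x => ?_) (lintegral_young hp hK.enorm hf.enorm)
  gcongr
  refine (enorm_integral_le_lintegral_enorm _).trans (le_of_eq ?_)
  exact lintegral_congr fun y => enorm_smul _ _

lemma lintegral_poisson_le {f : ℝ → E} {p t : ℝ} (hp : 1 ≤ p) (ht : 0 < t)
    (hf : StronglyMeasurable f) :
    ∫⁻ x, ‖kconv pk f t x‖ₑ ^ p ≤ ∫⁻ y, ‖f y‖ₑ ^ p := by
  refine (lintegral_kconv_le hp (measurable_pk.comp measurable_prodMk_left) hf).trans
    (le_of_eq ?_)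
  have : ∀ y, ‖pk t y‖ₑ = ENNReal.ofReal (pk t y) := fun y =>
    Real.enorm_of_nonneg (by rw [pk]; positivity)
  simp only [Function.comp_def, Function.uncurry_apply_pair, this, lintegral_pk ht,
    ENNReal.one_rpow, one_mul]

lemma lintegral_majo_le {f : ℝ → E} {p : ℝ} (hp : 1 ≤ p) (hf : StronglyMeasurable f) :
    ∫⁻ x, ‖majo f x‖ₑ ^ p ≤ ENNReal.ofReal Real.pi ^ p * ∫⁻ y, ‖f y‖ₑ ^ p := by
  have h := lintegral_kconv_le (K := fun y => 1 / (1 + y ^ 2)) hp (by fun_prop) hf.norm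
  have h1 : ∫⁻ y : ℝ, ‖1 / (1 + y ^ 2)‖ₑ = ENNReal.ofReal Real.pi := by
    rw [← integral_univ_inv_one_add_sq,
      ofReal_integral_eq_lintegral_ofReal integrable_inv_one_add_sq
      (ae_of_all _ fun x => by positivity)]
    exact lintegral_congr fun y => by rw [Real.enorm_of_nonneg (by positivity), one_div]
  simp only [h1, smul_eq_mul, enorm_norm] at h
  exact h

end

/-- A bounded convex function on the half line has controlled weighted second derivative. -/
lemma lintegral_mul_second_deriv_le {φ φ1 φ2 : ℝ → ℝ} {K : ℝ}
    (h1 : ∀ t, 0 < t → HasDerivAt φ (φ1 t) t) (h2 : ∀ t, 0 < t → HasDerivAt φ1 (φ2 t) t)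
    (hpos : ∀ t, 0 < t → 0 ≤ φ2 t) (h0 : ∀ t, 0 < t → 0 ≤ φ t) (hK : ∀ t, 0 < t → φ t ≤ K) :
    ∫⁻ t in Ioi (0 : ℝ), ENNReal.ofReal t * ENNReal.ofReal (φ2 t) ≤ ENNReal.ofReal K := by
  have hmono : MonotoneOn φ1 (Ioi 0) := by
    apply monotoneOn_of_deriv_nonneg (convex_Ioi 0)
    · exact fun t ht => (h2 t ht).continuousAt.continuousWithinAt
    · rw [interior_Ioi]
      exact fun t ht => (h2 t ht).differentiableAt.differentiableWithinAt
    · rw [interior_Ioi]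
      exact fun t ht => by rw [(h2 t ht).deriv]; exact hpos t ht
  have hneg : ∀ t, 0 < t → φ1 t ≤ 0 := by
    intro s hs
    by_contra! hc
    set T := s + (K + 1) / φ1 s with hT
    have hK0 : 0 ≤ K := (h0 s hs).trans (hK s hs)
    have hsT : s ≤ T := by rw [hT]; linarith [show 0 ≤ (K + 1) / φ1 s by positivity]
    have := Convex.mul_sub_le_image_sub_of_le_deriv (convex_Icc s T)
      (f := φ) (C := φ1 s)
      (fun t ht => (h1 t (hs.trans_le ht.1)).continuousAt.continuousWithinAt)
      (fun t ht => (h1 t (hs.trans_le (interior_subset ht).1)).differentiableAt.differentiableWithinAt)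
      (fun t ht => by
        have ht' := interior_subset ht
        rw [(h1 t (hs.trans_le ht'.1)).deriv]
        exact hmono hs (hs.trans_le ht'.1) ht'.1)
      s ⟨le_rfl, hsT⟩ T ⟨hsT, le_rfl⟩ hsT
    have e : φ1 s * (T - s) = K + 1 := by rw [hT]; field_simp; ring
    have := h0 s hs
    have := hK T (hs.trans_le hsT)
    linarith
  have hmeas : ∀ t ∈ Ioi (0 : ℝ), φ2 t = deriv φ1 t := fun t ht => (h2 t ht).deriv.symm
  have hpart : ∀ t0 T : ℝ, 0 < t0 → t0 ≤ T →
      ∫⁻ t in Ioc t0 T, ENNReal.ofReal ((t - t0) * φ2 t) ≤ ENNReal.ofReal K := by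
    intro t0 T ht0 hT
    have hd : ∀ t, 0 < t → HasDerivAt (fun t => (t - t0) * φ1 t - φ t) ((t - t0) * φ2 t) t := by
      intro t ht
      refine ((((hasDerivAt_id t).sub_const t0).mul (h2 t ht)).sub (h1 t ht)).congr_deriv ?_
      simp
    have hc : ContinuousOn (fun t => (t - t0) * φ1 t - φ t) (Icc t0 T) :=
      fun t ht => (hd t (ht0.trans_le ht.1)).continuousAt.continuousWithinAt
    have hp : ∀ t ∈ Ioo t0 T, 0 ≤ (t - t0) * φ2 t := fun t ht =>
      mul_nonneg (by linarith [ht.1]) (hpos t (ht0.trans ht.1))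
    have hInt := intervalIntegral.integrableOn_deriv_of_nonneg hc
      (fun t ht => hd t (ht0.trans ht.1)) hp
    have hI := intervalIntegral.integral_eq_sub_of_hasDerivAt_of_le hT hc
      (fun t ht => hd t (ht0.trans ht.1)) ((intervalIntegrable_iff_integrableOn_Ioc_of_le hT).2 hInt)
    rw [intervalIntegral.integral_of_le hT] at hI
    rw [← ofReal_integral_eq_lintegral_ofReal hInt, hI]
    · apply ENNReal.ofReal_le_ofReal
      have a1 := hneg T (ht0.trans_le hT)
      have a2 := h0 T (ht0.trans_le hT)
      have a3 := hK t0 ht0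
      nlinarith
    · refine (ae_restrict_iff' measurableSet_Ioc).2 (ae_of_all _ fun t ht => ?_)
      exact mul_nonneg (by linarith [ht.1]) (hpos t (ht0.trans ht.1))
  let G : ℕ → ℝ → ℝ≥0∞ := fun n => (Ioc (1 / ((n : ℝ) + 1)) (n + 1)).indicator
    fun t => ENNReal.ofReal ((t - 1 / ((n : ℝ) + 1)) * deriv φ1 t)
  have hGm : ∀ n, Measurable (G n) := fun n =>
    (by have := measurable_deriv φ1; fun_prop : Measurable fun t =>
      ENNReal.ofReal ((t - 1 / ((n : ℝ) + 1)) * deriv φ1 t)).indicator measurableSet_Ioc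
  have hGK : ∀ n, ∫⁻ t, G n t ≤ ENNReal.ofReal K := by
    intro n
    rw [lintegral_indicator measurableSet_Ioc]
    have hn : (0 : ℝ) < (n : ℝ) + 1 := by positivity
    have hn1 : 1 / ((n : ℝ) + 1) ≤ n + 1 := by
      rw [div_le_iff₀ hn]; nlinarith [show (0 : ℝ) ≤ n by positivity]
    refine le_trans (le_of_eq ?_) (hpart (1 / ((n : ℝ) + 1)) (n + 1) (by positivity) hn1)
    refine setLIntegral_congr_fun measurableSet_Ioc fun t ht => ?_
    have : 0 < t := lt_trans (by positivity) ht.1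
    simp only [hmeas t this]
  calc ∫⁻ t in Ioi (0 : ℝ), ENNReal.ofReal t * ENNReal.ofReal (φ2 t)
      = ∫⁻ t, (Ioi (0 : ℝ)).indicator (fun t => ENNReal.ofReal t * ENNReal.ofReal (φ2 t)) t :=
        (lintegral_indicator measurableSet_Ioi _).symm
    _ ≤ ∫⁻ t, Filter.liminf (fun n => G n t) Filter.atTop := by
        refine lintegral_mono fun t => ?_
        by_cases ht : t ∈ Ioi (0 : ℝ)
        · rw [indicator_of_mem ht]
          refine le_of_eq (Filter.Tendsto.liminf_eq ?_).symm
          have hlim : Filter.Tendsto (fun n : ℕ => ENNReal.ofReal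
              ((t - 1 / ((n : ℝ) + 1)) * deriv φ1 t)) Filter.atTop
              (nhds (ENNReal.ofReal t * ENNReal.ofReal (φ2 t))) := by
            rw [← ENNReal.ofReal_mul (le_of_lt ht), hmeas t ht]
            apply ENNReal.tendsto_ofReal
            apply Filter.Tendsto.mul_const
            simpa using (tendsto_one_div_add_atTop_nhds_zero_nat (𝕜 := ℝ)).const_sub t
          refine hlim.congr' ?_
          have a1 : ∀ᶠ n : ℕ in Filter.atTop, 1 / ((n : ℝ) + 1) < t :=
            (tendsto_one_div_add_atTop_nhds_zero_nat (𝕜 := ℝ)).eventually_lt_const ht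
          have a2 : ∀ᶠ n : ℕ in Filter.atTop, t ≤ (n : ℝ) :=
            tendsto_natCast_atTop_atTop.eventually_ge_atTop t
          filter_upwards [a1, a2] with n b1 b2
          simp only [G]
          rw [indicator_of_mem (show t ∈ Ioc _ _ from ⟨b1, by linarith⟩)]
        · rw [indicator_of_notMem ht]; exact bot_le
    _ ≤ Filter.liminf (fun n => ∫⁻ t, G n t) Filter.atTop := lintegral_liminf_le hGm
    _ ≤ ENNReal.ofReal K := by
        refine Filter.liminf_le_of_frequently_le' (Filter.Frequently.of_forall hGK)

noncomputable section

lemma integrable_norm_rpow {E : Type*} [NormedAddCommGroup E] {u : ℝ → E} {p : ℝ} (hp : 0 ≤ p)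
    (hu : StronglyMeasurable u) (h : ∫⁻ x, ‖u x‖ₑ ^ p ≠ ∞) :
    Integrable (fun x => ‖u x‖ ^ p) ∧ ∫ x, ‖u x‖ ^ p = (∫⁻ x, ‖u x‖ₑ ^ p).toReal := by
  have e : ∀ x, ENNReal.ofReal (‖u x‖ ^ p) = ‖u x‖ₑ ^ p := fun x => by
    rw [← ENNReal.ofReal_rpow_of_nonneg (norm_nonneg _) hp, ofReal_norm]
  have hm : AEStronglyMeasurable (fun x => ‖u x‖ ^ p) volume :=
    (hu.norm.measurable.pow_const p).aestronglyMeasurable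
  have hnn : ∀ x, 0 ≤ ‖u x‖ ^ p := fun x => by positivity
  constructor
  · refine ⟨hm, ?_⟩
    rw [hasFiniteIntegral_iff_ofReal (ae_of_all _ hnn)]
    simp_rw [e]
    exact h.lt_top
  · rw [integral_eq_lintegral_of_nonneg_ae (ae_of_all _ hnn) hm]
    simp_rw [e]

section

variable {E : Type*} [NormedAddCommGroup E] [InnerProductSpace ℝ E]

/-- Squared norm of the Poisson extension. -/
def nX (f : ℝ → E) (t x : ℝ) : ℝ := ‖kconv pk f t x‖ ^ 2

/-- The `t`-derivative of `nX`. -/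
def nXt (f : ℝ → E) (t x : ℝ) : ℝ := 2 * inner ℝ (kconv pk f t x) (kconv pkt f t x)

/-- The `x`-derivative of `nX`. -/
def nXx (f : ℝ → E) (t x : ℝ) : ℝ := 2 * inner ℝ (kconv pk f t x) (kconv pkx f t x)

/-- The second `t`-derivative of `nX`. -/
def nXtt (f : ℝ → E) (t x : ℝ) : ℝ :=
  2 * (inner ℝ (kconv pk f t x) (kconv pktt f t x) + inner ℝ (kconv pkt f t x) (kconv pkt f t x))

/-- The second `x`-derivative of `nX`. -/
def nXxx (f : ℝ → E) (t x : ℝ) : ℝ :=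
  2 * (inner ℝ (kconv pk f t x) (-kconv pktt f t x) + inner ℝ (kconv pkx f t x) (kconv pkx f t x))

/-- Length of the gradient of the Poisson extension. -/
def gradN (f : ℝ → E) (t x : ℝ) : ℝ := √(‖kconv pkt f t x‖ ^ 2 + ‖kconv pkx f t x‖ ^ 2)

variable {f : ℝ → E} {M t : ℝ}

lemma hasDerivAt_nX_t (hf : StronglyMeasurable f) (hfM : ∀ y, ‖f y‖ ≤ M) (ht : 0 < t) (x : ℝ) :
    HasDerivAt (fun s => nX f s x) (nXt f t x) t :=
  (hasDerivAt_kconv_pk_t hf hfM ht x).norm_sq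

lemma hasDerivAt_nX_x (hf : StronglyMeasurable f) (hfM : ∀ y, ‖f y‖ ≤ M) (ht : 0 < t) (x : ℝ) :
    HasDerivAt (fun z => nX f t z) (nXx f t x) x :=
  (hasDerivAt_kconv_pk_x hf hfM ht x).norm_sq

lemma hasDerivAt_nXt_t (hf : StronglyMeasurable f) (hfM : ∀ y, ‖f y‖ ≤ M) (ht : 0 < t) (x : ℝ) :
    HasDerivAt (fun s => nXt f s x) (nXtt f t x) t :=
  ((hasDerivAt_kconv_pk_t hf hfM ht x).inner ℝ (hasDerivAt_kconv_pkt_t hf hfM ht x)).const_mul 2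

lemma hasDerivAt_nXx_x (hf : StronglyMeasurable f) (hfM : ∀ y, ‖f y‖ ≤ M) (ht : 0 < t) (x : ℝ) :
    HasDerivAt (fun z => nXx f t z) (nXxx f t x) x :=
  ((hasDerivAt_kconv_pk_x hf hfM ht x).inner ℝ (hasDerivAt_kconv_pkx_x hf hfM ht x)).const_mul 2

lemma nX_bounds {t0 T : ℝ} (hf : StronglyMeasurable f) (hfM : ∀ y, ‖f y‖ ≤ M)
    (h0 : 0 < t0) (hT : t0 ≤ T) : ∃ C : ℝ, 0 ≤ C ∧ ∀ t, t0 ≤ t → t ≤ T → ∀ x,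
      nX f t x ≤ C * majo f x ^ 2 ∧ |nXt f t x| ≤ C * majo f x ^ 2 ∧
      |nXtt f t x| ≤ C * majo f x ^ 2 ∧ |nXx f t x| ≤ C * majo f x ^ 2 ∧
      |nXxx f t x| ≤ C * majo f x ^ 2 := by
  obtain ⟨C, hC0, hC⟩ := kconv_bounds hf hfM h0 hT
  refine ⟨4 * C ^ 2, by positivity, fun t h1 h2 x => ?_⟩
  obtain ⟨a1, a2, a3, a4⟩ := hC t h1 h2 x
  have hU := majo_nonneg f x
  have hin : ∀ u v : E, ‖u‖ ≤ C * majo f x → ‖v‖ ≤ C * majo f x →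
      |inner ℝ u v| ≤ (C * majo f x) ^ 2 := fun u v hu hv => by
    refine (abs_real_inner_le_norm u v).trans ?_
    rw [sq]; exact mul_le_mul hu hv (norm_nonneg _) (by positivity)
  have a5 : ‖-kconv pktt f t x‖ ≤ C * majo f x := by rwa [norm_neg]
  have e : 4 * C ^ 2 * majo f x ^ 2 = 4 * (C * majo f x) ^ 2 := by ring
  rw [e]
  have b0 := sq_nonneg (C * majo f x)
  have b1 := hin _ _ a1 a2
  have b2 := hin _ _ a1 a4
  have b3 := hin _ _ a2 a2
  have b4 := hin _ _ a1 a3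
  have b5 := hin _ _ a3 a3
  have b6 := hin _ _ a1 a5
  have hX : nX f t x ≤ (C * majo f x) ^ 2 := by rw [nX]; gcongr
  refine ⟨by linarith, ?_, ?_, ?_, ?_⟩
  · rw [nXt, abs_mul, abs_two]; linarith
  · rw [nXtt, abs_mul, abs_two]; linarith [abs_add_le (inner ℝ (kconv pk f t x) (kconv pktt f t x)) (inner ℝ (kconv pkt f t x) (kconv pkt f t x))]
  · rw [nXx, abs_mul, abs_two]; linarith
  · rw [nXxx, abs_mul, abs_two]; linarith [abs_add_le (inner ℝ (kconv pk f t x) (-kconv pktt f t x)) (inner ℝ (kconv pkx f t x) (kconv pkx f t x))]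

lemma gradN_sq (f : ℝ → E) (t x : ℝ) :
    gradN f t x ^ 2 = ‖kconv pkt f t x‖ ^ 2 + ‖kconv pkx f t x‖ ^ 2 :=
  Real.sq_sqrt (by positivity)

lemma nX_laplacian (f : ℝ → E) (t x : ℝ) : nXtt f t x + nXxx f t x = 2 * gradN f t x ^ 2 := by
  rw [gradN_sq, nXtt, nXxx, inner_neg_right, real_inner_self_eq_norm_sq,
    real_inner_self_eq_norm_sq]
  ring

lemma nX_grad_le (f : ℝ → E) (t x : ℝ) :
    nXt f t x ^ 2 + nXx f t x ^ 2 ≤ 4 * nX f t x * gradN f t x ^ 2 := by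
  have key : ∀ u v : E, (2 * inner ℝ u v) ^ 2 ≤ 4 * (‖u‖ ^ 2 * ‖v‖ ^ 2) := fun u v => by
    have := abs_real_inner_le_norm u v
    have h2 : (inner ℝ u v) ^ 2 ≤ (‖u‖ * ‖v‖) ^ 2 := by
      rw [← sq_abs]; gcongr
    nlinarith
  rw [gradN_sq, nXt, nXx, nX]
  linarith [key (kconv pk f t x) (kconv pkt f t x), key (kconv pk f t x) (kconv pkx f t x)]

lemma nX_measurable (hf : StronglyMeasurable f) (t : ℝ) : Measurable (nX f t) ∧
    Measurable (nXt f t) ∧ Measurable (nXtt f t) ∧ Measurable (nXx f t) ∧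
    Measurable (nXxx f t) ∧ Measurable (gradN f t) := by
  have m : ∀ {K : ℝ → ℝ → ℝ}, Measurable (Function.uncurry K) →
      StronglyMeasurable (kconv K f t) := fun hK =>
    (stronglyMeasurable_kconv hK hf).comp_measurable measurable_prodMk_left
  have m1 := m measurable_pk
  have m2 := m measurable_pkt
  have m3 := m measurable_pkx
  have m4 := m measurable_pktt
  refine ⟨m1.norm.measurable.pow_const 2, ((m1.inner m2).const_mul 2).measurable,
    (((m1.inner m4).add (m2.inner m2)).const_mul 2).measurable,
    ((m1.inner m3).const_mul 2).measurable,
    (((m1.inner m4.neg).add (m3.inner m3)).const_mul 2).measurable, ?_⟩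
  exact ((m2.norm.measurable.pow_const 2).add (m3.norm.measurable.pow_const 2)).sqrt

lemma integrable_majo_sq (hf : StronglyMeasurable f) (hf2 : ∫⁻ x, ‖f x‖ₑ ^ (2 : ℝ) ≠ ∞) :
    Integrable (fun x => majo f x ^ 2) := by
  have h := (integrable_norm_rpow (u := majo f) (p := 2) (by norm_num)
    (measurable_majo hf).stronglyMeasurable (ne_top_of_le_ne_top
      (ENNReal.mul_ne_top (by simp) hf2) (lintegral_majo_le (by norm_num) hf))).1
  refine h.congr (ae_of_all _ fun x => ?_)
  simp only [Real.rpow_two, Real.norm_eq_abs, sq_abs]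

end

lemma measurable_bell {r θ : ℝ} {X Z X1 Z1 X2 Z2 : ℝ → ℝ} (hX : Measurable X) (hZ : Measurable Z)
    (hX1 : Measurable X1) (hZ1 : Measurable Z1) (hX2 : Measurable X2) (hZ2 : Measurable Z2) :
    Measurable (fun x => bellB r θ (X x) (Z x)) ∧
    Measurable (fun x => bellB1 r θ (X x) (Z x) (X1 x) (Z1 x)) ∧
    Measurable (fun x => bellB2 r θ (X x) (Z x) (X1 x) (Z1 x) (X2 x) (Z2 x)) := by
  unfold bellB bellB1 bellB2
  refine ⟨by fun_prop, by fun_prop, by fun_prop⟩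

section

variable {E F : Type*} [NormedAddCommGroup E] [InnerProductSpace ℝ E]
  [NormedAddCommGroup F] [InnerProductSpace ℝ F]

theorem bilinear_embedding_eps {p q ε M : ℝ} {f : ℝ → E} {g : ℝ → F} (hpq : p.HolderConjugate q)
    (hp2 : p ≤ 2) (hε : 0 < ε) (hf : StronglyMeasurable f) (hg : StronglyMeasurable g)
    (hfM : ∀ y, ‖f y‖ ≤ M) (hgM : ∀ y, ‖g y‖ ≤ M)
    (hf2 : ∫⁻ x, ‖f x‖ₑ ^ (2 : ℝ) ≠ ∞) (hg2 : ∫⁻ x, ‖g x‖ₑ ^ (2 : ℝ) ≠ ∞)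
    (hfp : ∫⁻ x, ‖f x‖ₑ ^ p ≠ ∞) (hgq : ∫⁻ x, ‖g x‖ₑ ^ q ≠ ∞) :
    ∫⁻ t in Ioi (0 : ℝ), ENNReal.ofReal t *
        ∫⁻ x, ENNReal.ofReal (2 * (gradN f t x * gradN g t x)) ≤
      ENNReal.ofReal ((1 + 11 * (q - 1)) * ((∫⁻ x, ‖f x‖ₑ ^ p).toReal
        + q / 2 * 2 ^ (q / 2 - 1) * ((∫⁻ x, ‖g x‖ₑ ^ q).toReal
          + ε ^ (q / 2 - 1) * (∫⁻ x, ‖g x‖ₑ ^ (2 : ℝ)).toReal))) := by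
  have hp1 := hpq.lt
  have hq1 := hpq.symm.lt
  have hmul := hpq.mul_eq_add
  have hr : 1 ≤ q - 1 := by nlinarith
  set r := q - 1 with hrdef
  set θ := 1 - p / 2 with hθdef
  have hθ0 : 0 ≤ θ := by linarith
  have hθr : 2 * θ * r = r - 1 := by rw [hθdef, hrdef]; linarith
  set B0 := (1 + 11 * r) * ε ^ (q / 2) with hB0
  set cq := q / 2 * 2 ^ (q / 2 - 1) with hcq
  have hcq0 : 0 ≤ cq := by positivity
  let BB : ℝ → ℝ → ℝ := fun t x => bellB r θ (nX f t x) (nX g t x + ε)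
  let B1 : ℝ → ℝ → ℝ := fun t x => bellB1 r θ (nX f t x) (nX g t x + ε) (nXt f t x) (nXt g t x)
  let B2 : ℝ → ℝ → ℝ := fun t x => bellB2 r θ (nX f t x) (nX g t x + ε) (nXt f t x) (nXt g t x)
    (nXtt f t x) (nXtt g t x)
  let B1x : ℝ → ℝ → ℝ := fun t x => bellB1 r θ (nX f t x) (nX g t x + ε) (nXx f t x) (nXx g t x)
  let B2x : ℝ → ℝ → ℝ := fun t x => bellB2 r θ (nX f t x) (nX g t x + ε) (nXx f t x) (nXx g t x)
    (nXxx f t x) (nXxx g t x)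
  have hX0 : ∀ t x, 0 ≤ nX f t x := fun t x => by rw [nX]; positivity
  have hY0 : ∀ t x, 0 ≤ nX g t x := fun t x => by rw [nX]; positivity
  have hZ0 : ∀ t x, 0 < nX g t x + ε := fun t x => by linarith [hY0 t x]
  have hm := fun t => (nX_measurable hf t)
  have hm' := fun t => (nX_measurable hg t)
  have hmt := fun t => measurable_bell (r := r) (θ := θ) (hm t).1 ((hm' t).1.add_const ε)
    (hm t).2.1 (hm' t).2.1 (hm t).2.2.1 (hm' t).2.2.1
  have hmx := fun t => measurable_bell (r := r) (θ := θ) (hm t).1 ((hm' t).1.add_const ε)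
    (hm t).2.2.2.1 (hm' t).2.2.2.1 (hm t).2.2.2.2.1 (hm' t).2.2.2.2.1
  -- uniform bounds
  have hbd : ∀ t0 T : ℝ, 0 < t0 → t0 ≤ T → ∃ w : ℝ → ℝ, Integrable w ∧ ∀ t, t0 ≤ t → t ≤ T →
      ∀ x, |B1 t x| ≤ w x ∧ |B2 t x| ≤ w x ∧ |B1x t x| ≤ w x ∧ |B2x t x| ≤ w x := by
    intro t0 T ht0 hT
    obtain ⟨C1, hC10, hC1⟩ := nX_bounds hf hfM ht0 hT
    obtain ⟨C2, hC20, hC2⟩ := nX_bounds hg hgM ht0 hT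
    let w : ℝ → ℝ := fun x => C1 * majo f x ^ 2 + C2 * majo g x ^ 2
    have hM0 : 0 ≤ M := (norm_nonneg _).trans (hfM 0)
    set N := C1 * (Real.pi * M) ^ 2 + C2 * (Real.pi * M) ^ 2 with hN
    have hwN : ∀ x, w x ≤ N := fun x => by
      have a1 := majo_le hf hfM x
      have a2 := majo_le hg hgM x
      have := majo_nonneg f x
      have := majo_nonneg g x
      simp only [w, hN]; gcongr
    have hw0 : ∀ x, 0 ≤ w x := fun x => by simp only [w]; positivity
    have hw1 : ∀ x, C1 * majo f x ^ 2 ≤ w x := fun x => by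
      simp only [w]; linarith [show 0 ≤ C2 * majo g x ^ 2 by positivity]
    have hw2 : ∀ x, C2 * majo g x ^ 2 ≤ w x := fun x => by
      simp only [w]; linarith [show 0 ≤ C1 * majo f x ^ 2 by positivity]
    obtain ⟨K, hK0, hK⟩ := bellB_bounds r θ ε (N + ε) hε hr
    refine ⟨fun x => K * w x, (((integrable_majo_sq hf hf2).const_mul C1).add
      ((integrable_majo_sq hg hg2).const_mul C2)).const_mul K, fun t h1 h2 x => ?_⟩
    obtain ⟨a1, a2, a3, a4, a5⟩ := hC1 t h1 h2 x
    obtain ⟨b1, b2, b3, b4, b5⟩ := hC2 t h1 h2 x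
    have g1 := hw1 x
    have g2 := hw2 x
    have g3 := hwN x
    have e1 := hK (nX f t x) (nX g t x + ε) (nXt f t x) (nXt g t x) (nXtt f t x) (nXtt g t x) (w x)
      (hX0 t x) (by linarith) (by linarith [hY0 t x]) (by linarith) (hw0 x) (by linarith)
      (a2.trans g1) (b2.trans g2) (a3.trans g1) (b3.trans g2)
    have e2 := hK (nX f t x) (nX g t x + ε) (nXx f t x) (nXx g t x) (nXxx f t x) (nXxx g t x) (w x)
      (hX0 t x) (by linarith) (by linarith [hY0 t x]) (by linarith) (hw0 x) (by linarith)
      (a4.trans g1) (b4.trans g2) (a5.trans g1) (b5.trans g2)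
    exact ⟨e1.1, e1.2, e2.1, e2.2⟩
  have hInt1 : ∀ t, 0 < t → Integrable (B1 t) ∧ Integrable (B2 t) ∧ Integrable (B1x t) ∧
      Integrable (B2x t) := by
    intro t ht
    obtain ⟨w, hw, hb⟩ := hbd t t ht le_rfl
    exact ⟨hw.mono' (hmt t).2.1.aestronglyMeasurable (ae_of_all _ fun x => (hb t le_rfl le_rfl x).1),
      hw.mono' (hmt t).2.2.aestronglyMeasurable (ae_of_all _ fun x => (hb t le_rfl le_rfl x).2.1),
      hw.mono' (hmx t).2.1.aestronglyMeasurable (ae_of_all _ fun x => (hb t le_rfl le_rfl x).2.2.1),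
      hw.mono' (hmx t).2.2.aestronglyMeasurable (ae_of_all _ fun x => (hb t le_rfl le_rfl x).2.2.2)⟩
  -- size
  have hsize := fun t x => bellB_size (X := nX f t x) (Y := nX g t x) hpq hp2 (hX0 t x) (hY0 t x) hε
  have hsm : ∀ t, StronglyMeasurable (kconv pk f t) := fun t =>
    (stronglyMeasurable_kconv measurable_pk hf).comp_measurable measurable_prodMk_left
  have hsm' : ∀ t, StronglyMeasurable (kconv pk g t) := fun t =>
    (stronglyMeasurable_kconv measurable_pk hg).comp_measurable measurable_prodMk_left
  have epow : ∀ (a s : ℝ), 0 ≤ a → (a ^ 2) ^ (s / 2) = a ^ s := fun a s ha => by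
    rw [← Real.rpow_two, ← Real.rpow_mul ha]; congr 1; ring
  have hdom : ∀ t, 0 < t → ∃ G : ℝ → ℝ, Integrable G ∧ (∀ x, |BB t x - B0| ≤ G x) ∧
      ∫ x, G x ≤ (1 + 11 * r) * ((∫⁻ x, ‖f x‖ₑ ^ p).toReal
        + cq * ((∫⁻ x, ‖g x‖ₑ ^ q).toReal
          + ε ^ (q / 2 - 1) * (∫⁻ x, ‖g x‖ₑ ^ (2 : ℝ)).toReal)) := by
    intro t ht
    have l1 := lintegral_poisson_le hp1.le ht hf
    have l2 := lintegral_poisson_le hq1.le ht hg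
    have l3 := lintegral_poisson_le (p := 2) (by norm_num) ht hg
    obtain ⟨i1, j1⟩ := integrable_norm_rpow (by linarith) (hsm t) (ne_top_of_le_ne_top hfp l1)
    obtain ⟨i2, j2⟩ := integrable_norm_rpow (by linarith) (hsm' t) (ne_top_of_le_ne_top hgq l2)
    obtain ⟨i3, j3⟩ := integrable_norm_rpow (by norm_num) (hsm' t) (ne_top_of_le_ne_top hg2 l3)
    refine ⟨fun x => (1 + 11 * r) * (‖kconv pk f t x‖ ^ p + cq * (‖kconv pk g t x‖ ^ q
      + ε ^ (q / 2 - 1) * ‖kconv pk g t x‖ ^ (2 : ℝ))),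
      (i1.add ((i2.add (i3.const_mul _)).const_mul _)).const_mul _, fun x => ?_, ?_⟩
    · rw [abs_of_nonneg (hsize t x).1]
      refine (hsize t x).2.trans (le_of_eq ?_)
      simp only [nX, epow _ _ (norm_nonneg _), Real.rpow_two]
      rfl
    · have i4 : Integrable fun x => ‖kconv pk g t x‖ ^ q
          + ε ^ (q / 2 - 1) * ‖kconv pk g t x‖ ^ (2 : ℝ) := i2.add (i3.const_mul _)
      rw [integral_const_mul, integral_add i1 (i4.const_mul _), integral_const_mul,
        integral_add i2 (i3.const_mul _), integral_const_mul, j1, j2, j3]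
      have := ENNReal.toReal_mono hfp l1
      have := ENNReal.toReal_mono hgq l2
      have := ENNReal.toReal_mono hg2 l3
      gcongr
  have hBBint : ∀ t, 0 < t → Integrable (fun x => BB t x - B0) := by
    intro t ht
    obtain ⟨G, hG, hb, -⟩ := hdom t ht
    exact hG.mono' ((hmt t).1.sub_const B0).aestronglyMeasurable (ae_of_all _ hb)
  -- derivatives
  have hd1 : ∀ t, 0 < t → HasDerivAt (fun t => ∫ x, (BB t x - B0)) (∫ x, B1 t x) t := by
    intro t ht
    obtain ⟨w, hw, hb⟩ := hbd (t / 2) (2 * t) (by linarith) (by linarith)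
    refine (hasDerivAt_integral_of_dominated_loc_of_deriv_le (bound := w) (F' := B1)
      (Metric.ball_mem_nhds t (show 0 < t / 2 by linarith))
      (Filter.Eventually.of_forall fun s => ((hmt s).1.sub_const B0).aestronglyMeasurable)
      (hBBint t ht) (hmt t).2.1.aestronglyMeasurable
      (ae_of_all _ fun x s hs => (hb s (mem_ball_half hs).1 (mem_ball_half hs).2 x).1) hw
      (ae_of_all _ fun x s hs => ?_)).2
    have hs0 : 0 < s := by linarith [(mem_ball_half hs).1]
    exact (hasDerivAt_bellB (X := fun s => nX f s x) (Z := fun s => nX g s x + ε)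
      (hX0 s x) (hZ0 s x) (hasDerivAt_nX_t hf hfM hs0 x)
      ((hasDerivAt_nX_t hg hgM hs0 x).add_const ε)).sub_const B0
  have hd2 : ∀ t, 0 < t → HasDerivAt (fun t => ∫ x, B1 t x) (∫ x, B2 t x) t := by
    intro t ht
    obtain ⟨w, hw, hb⟩ := hbd (t / 2) (2 * t) (by linarith) (by linarith)
    refine (hasDerivAt_integral_of_dominated_loc_of_deriv_le (bound := w) (F' := B2)
      (Metric.ball_mem_nhds t (show 0 < t / 2 by linarith))
      (Filter.Eventually.of_forall fun s => (hmt s).2.1.aestronglyMeasurable)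
      (hInt1 t ht).1 (hmt t).2.2.aestronglyMeasurable
      (ae_of_all _ fun x s hs => (hb s (mem_ball_half hs).1 (mem_ball_half hs).2 x).2.1) hw
      (ae_of_all _ fun x s hs => ?_)).2
    have hs0 : 0 < s := by linarith [(mem_ball_half hs).1]
    exact hasDerivAt_bellB1 (X := fun s => nX f s x) (Z := fun s => nX g s x + ε)
      (X1 := fun s => nXt f s x) (Z1 := fun s => nXt g s x)
      (hX0 s x) (hZ0 s x) (hasDerivAt_nX_t hf hfM hs0 x)
      ((hasDerivAt_nX_t hg hgM hs0 x).add_const ε) (hasDerivAt_nXt_t hf hfM hs0 x)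
      (hasDerivAt_nXt_t hg hgM hs0 x)
  have hxx : ∀ t, 0 < t → ∫ x, B2x t x = 0 := by
    intro t ht
    refine integral_eq_zero_of_hasDerivAt_of_integrable (f := B1x t) (fun x => ?_)
      (hInt1 t ht).2.2.2 (hInt1 t ht).2.2.1
    exact hasDerivAt_bellB1 (X := fun z => nX f t z) (Z := fun z => nX g t z + ε)
      (X1 := fun z => nXx f t z) (Z1 := fun z => nXx g t z)
      (hX0 t x) (hZ0 t x) (hasDerivAt_nX_x hf hfM ht x)
      ((hasDerivAt_nX_x hg hgM ht x).add_const ε) (hasDerivAt_nXx_x hf hfM ht x)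
      (hasDerivAt_nXx_x hg hgM ht x)
  have hlap : ∀ t x, 2 * (gradN f t x * gradN g t x) ≤ B2 t x + B2x t x := by
    intro t x
    refine bellB2_add_ge hr hθ0 hθr (hX0 t x) (hZ0 t x) (nX_grad_le f t x) ?_
      (nX_laplacian f t x) (nX_laplacian g t x) le_rfl le_rfl
    refine (nX_grad_le g t x).trans ?_
    have := sq_nonneg (gradN g t x)
    have : nX g t x ≤ nX g t x + ε := by linarith
    gcongr
  have hg0 : ∀ t x, 0 ≤ 2 * (gradN f t x * gradN g t x) := fun t x => by
    unfold gradN; positivity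
  have hφ2 : ∀ t, 0 < t → ∫⁻ x, ENNReal.ofReal (2 * (gradN f t x * gradN g t x)) ≤
      ENNReal.ofReal (∫ x, B2 t x) := by
    intro t ht
    have : ∫ x, B2 t x = ∫ x, (B2 t x + B2x t x) := by
      rw [integral_add (hInt1 t ht).2.1 (hInt1 t ht).2.2.2, hxx t ht, add_zero]
    have hi : Integrable (fun x => B2 t x + B2x t x) := (hInt1 t ht).2.1.add (hInt1 t ht).2.2.2
    rw [this, ofReal_integral_eq_lintegral_ofReal hi
      (ae_of_all _ fun x => (hg0 t x).trans (hlap t x))]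
    exact lintegral_mono fun x => ENNReal.ofReal_le_ofReal (hlap t x)
  have hpos : ∀ t, 0 < t → 0 ≤ ∫ x, B2 t x := by
    intro t ht
    have : ∫ x, B2 t x = ∫ x, (B2 t x + B2x t x) := by
      rw [integral_add (hInt1 t ht).2.1 (hInt1 t ht).2.2.2, hxx t ht, add_zero]
    rw [this]
    exact integral_nonneg fun x => (hg0 t x).trans (hlap t x)
  refine le_trans ?_ (lintegral_mul_second_deriv_le hd1 hd2 hpos
    (fun t ht => integral_nonneg fun x => (hsize t x).1) (fun t ht => ?_))
  · refine setLIntegral_mono' measurableSet_Ioi fun t ht => ?_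
    gcongr
    exact hφ2 t ht
  · obtain ⟨G, hG, hb, hGle⟩ := hdom t ht
    exact (integral_mono (hBBint t ht) hG fun x => (le_abs_self _).trans (hb x)).trans hGle

end

end

set_option linter.unusedSectionVars false

noncomputable section

section embedding

variable {E F : Type*} [NormedAddCommGroup E] [InnerProductSpace ℝ E]
  [NormedAddCommGroup F] [InnerProductSpace ℝ F]

lemma kconv_const_smul (K : ℝ → ℝ → ℝ) (c : ℝ) (f : ℝ → E) (t x : ℝ) :
    kconv K (fun y => c • f y) t x = c • kconv K f t x := by
  unfold kconv
  rw [← integral_smul]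
  congr 1; ext y; rw [smul_comm]

lemma gradN_const_smul {c : ℝ} (hc : 0 ≤ c) (f : ℝ → E) (t x : ℝ) :
    gradN (fun y => c • f y) t x = c * gradN f t x := by
  unfold gradN
  rw [kconv_const_smul, kconv_const_smul, norm_smul, norm_smul, mul_pow, mul_pow, ← mul_add,
    Real.sqrt_mul (by positivity), Real.norm_eq_abs, sq_abs, Real.sqrt_sq hc]

lemma gradN_nonneg (f : ℝ → E) (t x : ℝ) : 0 ≤ gradN f t x := Real.sqrt_nonneg _

lemma gradN_of_ae_zero {f : ℝ → E} (hf : f =ᵐ[volume] 0) (t x : ℝ) : gradN f t x = 0 := by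
  have h : ∀ K : ℝ → ℝ → ℝ, kconv K f t x = 0 := fun K => by
    refine integral_eq_zero_of_ae ?_
    filter_upwards [hf] with y hy
    simp [hy]
  simp [gradN, h]

/-- The gradient pairing of the Poisson extensions of `f` and `g`. -/
def gradPair (f : ℝ → E) (g : ℝ → F) : ℝ≥0∞ :=
  ∫⁻ t in Ioi (0 : ℝ), ENNReal.ofReal t * ∫⁻ x, ENNReal.ofReal (gradN f t x * gradN g t x)

lemma gradPair_comm (f : ℝ → E) (g : ℝ → F) : gradPair f g = gradPair g f := by
  unfold gradPair
  simp_rw [mul_comm (gradN f _ _)]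

lemma gradPair_smul {c d : ℝ} (hc : 0 ≤ c) (hd : 0 ≤ d) (f : ℝ → E) (g : ℝ → F) :
    gradPair (fun y => c • f y) (fun y => d • g y) = ENNReal.ofReal (c * d) * gradPair f g := by
  unfold gradPair
  rw [← lintegral_const_mul' _ _ ENNReal.ofReal_ne_top]
  refine lintegral_congr fun t => ?_
  rw [mul_left_comm, ← lintegral_const_mul' (ENNReal.ofReal (c * d)) _ ENNReal.ofReal_ne_top]
  congr 1
  refine lintegral_congr fun x => ?_
  rw [gradN_const_smul hc, gradN_const_smul hd, ← ENNReal.ofReal_mul (by positivity)]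
  congr 1; ring

/-- The constant in the bilinear embedding. -/
def embC (q : ℝ) : ℝ := (1 + 11 * (q - 1)) * (1 + 2 * (q / 2 * 2 ^ (q / 2 - 1)))

lemma embC_nonneg {q : ℝ} (hq : 1 < q) : 0 ≤ embC q := by
  unfold embC
  have : 0 ≤ q - 1 := by linarith
  positivity

lemma gradPair_le_of_le_two {p q M : ℝ} {f : ℝ → E} {g : ℝ → F} (hpq : p.HolderConjugate q)
    (hp2 : p ≤ 2) (hf : StronglyMeasurable f) (hg : StronglyMeasurable g)
    (hfM : ∀ y, ‖f y‖ ≤ M) (hgM : ∀ y, ‖g y‖ ≤ M)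
    (hf2 : ∫⁻ x, ‖f x‖ₑ ^ (2 : ℝ) ≠ ∞) (hg2 : ∫⁻ x, ‖g x‖ₑ ^ (2 : ℝ) ≠ ∞)
    (hfp : ∫⁻ x, ‖f x‖ₑ ^ p = 1) (hgq : ∫⁻ x, ‖g x‖ₑ ^ q = 1) :
    gradPair f g ≤ ENNReal.ofReal (embC q) := by
  have hq1 := hpq.symm.lt
  have hp1 := hpq.lt
  have hmul := hpq.mul_eq_add
  have hq2 : 2 ≤ q := by nlinarith
  have hle : gradPair f g ≤ ∫⁻ t in Ioi (0 : ℝ), ENNReal.ofReal t *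
        ∫⁻ x, ENNReal.ofReal (2 * (gradN f t x * gradN g t x)) := by
    unfold gradPair
    refine lintegral_mono fun t => ?_
    refine mul_le_mul_right (lintegral_mono fun x => ENNReal.ofReal_le_ofReal ?_) _
    have := mul_nonneg (gradN_nonneg f t x) (gradN_nonneg g t x)
    linarith
  have hmain : ∀ ε : ℝ, 0 < ε → gradPair f g ≤ ENNReal.ofReal ((1 + 11 * (q - 1)) * (1
        + q / 2 * 2 ^ (q / 2 - 1) * (1 + ε ^ (q / 2 - 1) * (∫⁻ x, ‖g x‖ₑ ^ (2 : ℝ)).toReal))) := by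
    intro ε hε
    have := bilinear_embedding_eps hpq hp2 hε hf hg hfM hgM hf2 hg2 (by simp [hfp]) (by simp [hgq])
    rw [hfp, hgq, ENNReal.toReal_one] at this
    exact hle.trans this
  have hq0 : 0 ≤ q - 1 := by linarith
  rcases hq2.eq_or_lt with h2 | h2
  · have := hmain 1 one_pos
    have h2' : ∫⁻ x, ‖g x‖ₑ ^ (2 : ℝ) = 1 := by rw [h2, hgq]
    rw [h2', ENNReal.toReal_one, Real.one_rpow] at this
    refine this.trans (ENNReal.ofReal_le_ofReal ?_)
    unfold embC
    apply le_of_eq; ring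
  · set Q := (∫⁻ x, ‖g x‖ₑ ^ (2 : ℝ)).toReal
    have hQ : 0 ≤ Q := ENNReal.toReal_nonneg
    set s := q / 2 - 1 with hs
    have hs0 : 0 < s := by rw [hs]; linarith
    set ε := (1 / (Q + 1)) ^ s⁻¹ with hε
    have hε0 : 0 < ε := by positivity
    have hεs : ε ^ s * Q ≤ 1 := by
      rw [hε, ← Real.rpow_mul (by positivity), inv_mul_cancel₀ hs0.ne', Real.rpow_one,
        one_div, inv_mul_le_iff₀ (by positivity)]
      linarith
    refine (hmain ε hε0).trans (ENNReal.ofReal_le_ofReal ?_)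
    unfold embC
    have : 0 ≤ q / 2 * 2 ^ (q / 2 - 1) := by positivity
    rw [mul_comm (2 : ℝ) (_ * _)]
    gcongr
    linarith

lemma lintegral_rpow_normalize {f : ℝ → E} {p : ℝ} (hp : 0 < p)
    (h : eLpNorm f (ENNReal.ofReal p) volume ≠ ∞) (h0 : eLpNorm f (ENNReal.ofReal p) volume ≠ 0) :
    ∫⁻ x, ‖(eLpNorm f (ENNReal.ofReal p) volume).toReal⁻¹ • f x‖ₑ ^ p = 1 := by
  set N := eLpNorm f (ENNReal.ofReal p) volume with hN
  have hNr : 0 < N.toReal := ENNReal.toReal_pos h0 h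
  have e : ∀ x, ‖N.toReal⁻¹ • f x‖ₑ ^ p = (N⁻¹) ^ p * ‖f x‖ₑ ^ p := by
    intro x
    rw [enorm_smul, ENNReal.mul_rpow_of_nonneg _ _ hp.le, Real.enorm_eq_ofReal (by positivity),
      ENNReal.ofReal_inv_of_pos hNr, ENNReal.ofReal_toReal h]
  simp_rw [e]
  rw [lintegral_const_mul' _ _ (ENNReal.rpow_ne_top_of_nonneg hp.le (by simpa using h0))]
  have h1 : N ^ p = ∫⁻ x, ‖f x‖ₑ ^ p := by
    rw [hN, eLpNorm_eq_lintegral_rpow_enorm_toReal (by simpa using hp) ENNReal.ofReal_ne_top,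
      ENNReal.toReal_ofReal hp.le, ← ENNReal.rpow_mul, one_div, inv_mul_cancel₀ hp.ne',
      ENNReal.rpow_one]
  rw [← h1, ← ENNReal.mul_rpow_of_nonneg _ _ hp.le, ENNReal.inv_mul_cancel h0 h,
    ENNReal.one_rpow]

lemma lintegral_two_ne_top {f : ℝ → E} (hf : MemLp f 2 volume) :
    ∫⁻ x, ‖f x‖ₑ ^ (2 : ℝ) ≠ ∞ := by
  have := (lintegral_rpow_enorm_lt_top_of_eLpNorm_lt_top two_ne_zero ENNReal.ofNat_ne_top hf.2).ne
  simpa using this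

lemma gradPair_le_aux {p q M : ℝ} {f : ℝ → E} {g : ℝ → F} (hpq : p.HolderConjugate q)
    (hp2 : p ≤ 2) (hf : StronglyMeasurable f) (hg : StronglyMeasurable g)
    (hfM : ∀ y, ‖f y‖ ≤ M) (hgM : ∀ y, ‖g y‖ ≤ M)
    (hf2 : MemLp f 2 volume) (hg2 : MemLp g 2 volume)
    (hfp : MemLp f (ENNReal.ofReal p) volume) (hgq : MemLp g (ENNReal.ofReal q) volume) :
    gradPair f g ≤ ENNReal.ofReal (embC q) *
      (eLpNorm f (ENNReal.ofReal p) volume * eLpNorm g (ENNReal.ofReal q) volume) := by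
  have hp0 := hpq.pos
  have hq0 := hpq.symm.pos
  by_cases hf0 : eLpNorm f (ENNReal.ofReal p) volume = 0
  · rw [eLpNorm_eq_zero_iff hf.aestronglyMeasurable (by simpa using hp0)] at hf0
    simp [gradPair, gradN_of_ae_zero hf0]
  by_cases hg0 : eLpNorm g (ENNReal.ofReal q) volume = 0
  · rw [eLpNorm_eq_zero_iff hg.aestronglyMeasurable (by simpa using hq0)] at hg0
    simp [gradPair, gradN_of_ae_zero hg0]
  set A := eLpNorm f (ENNReal.ofReal p) volume with hA
  set B := eLpNorm g (ENNReal.ofReal q) volume with hB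
  have hAr : 0 < A.toReal := ENNReal.toReal_pos hf0 hfp.2.ne
  have hBr : 0 < B.toReal := ENNReal.toReal_pos hg0 hgq.2.ne
  have key := gradPair_le_of_le_two (M := max (A.toReal⁻¹ * M) (B.toReal⁻¹ * M))
    (f := fun y => A.toReal⁻¹ • f y) (g := fun y => B.toReal⁻¹ • g y) hpq hp2
    (hf.const_smul _) (hg.const_smul _)
    (fun y => by
      rw [norm_smul, Real.norm_eq_abs, abs_of_pos (by positivity)]
      exact le_max_of_le_left (by gcongr; exact hfM y))
    (fun y => by
      rw [norm_smul, Real.norm_eq_abs, abs_of_pos (by positivity)]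
      exact le_max_of_le_right (by gcongr; exact hgM y))
    (lintegral_two_ne_top (hf2.const_smul A.toReal⁻¹))
    (lintegral_two_ne_top (hg2.const_smul B.toReal⁻¹))
    (lintegral_rpow_normalize hp0 hfp.2.ne hf0) (lintegral_rpow_normalize hq0 hgq.2.ne hg0)
  rw [gradPair_smul (by positivity) (by positivity), ← mul_inv, ENNReal.ofReal_inv_of_pos
    (by positivity), ENNReal.ofReal_mul hAr.le, ENNReal.ofReal_toReal hfp.2.ne,
    ENNReal.ofReal_toReal hgq.2.ne] at key
  have hAB0 : A * B ≠ 0 := mul_ne_zero hf0 hg0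
  have hABt : A * B ≠ ∞ := ENNReal.mul_ne_top hfp.2.ne hgq.2.ne
  rwa [ENNReal.inv_mul_le_iff hAB0 hABt, mul_comm (A * B)] at key

/-- Bilinear embedding for gradients of Poisson extensions, with dimension-free constants. -/
theorem gradPair_le {p q M N : ℝ} {f : ℝ → E} {g : ℝ → F} (hpq : p.HolderConjugate q)
    (hf : StronglyMeasurable f) (hg : StronglyMeasurable g)
    (hfM : ∀ y, ‖f y‖ ≤ M) (hgN : ∀ y, ‖g y‖ ≤ N)
    (hf2 : MemLp f 2 volume) (hg2 : MemLp g 2 volume)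
    (hfp : MemLp f (ENNReal.ofReal p) volume) (hgq : MemLp g (ENNReal.ofReal q) volume) :
    gradPair f g ≤ ENNReal.ofReal (embC p + embC q) *
      (eLpNorm f (ENNReal.ofReal p) volume * eLpNorm g (ENNReal.ofReal q) volume) := by
  have hfM' : ∀ y, ‖f y‖ ≤ max M N := fun y => (hfM y).trans (le_max_left _ _)
  have hgN' : ∀ y, ‖g y‖ ≤ max M N := fun y => (hgN y).trans (le_max_right _ _)
  have h1 := embC_nonneg hpq.lt
  have h2 := embC_nonneg hpq.symm.lt
  rcases le_total p 2 with hp2 | hp2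
  · refine (gradPair_le_aux hpq hp2 hf hg hfM' hgN' hf2 hg2 hfp hgq).trans ?_
    gcongr
    linarith
  · have hq2 : q ≤ 2 := by
      have := hpq.mul_eq_add
      have := hpq.symm.lt
      nlinarith
    rw [gradPair_comm, mul_comm (eLpNorm f _ _)]
    refine (gradPair_le_aux hpq.symm hq2 hg hf hgN' hfM' hg2 hf2 hgq hfp).trans ?_
    gcongr
    linarith

end embedding

end

noncomputable section

lemma eChar_eq (t x : ℝ) : eChar t x = Complex.exp ((2 * Real.pi * (t * x) : ℝ) * Complex.I) := by
  unfold eChar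
  congr 1; push_cast; ring

lemma norm_eChar (t x : ℝ) : ‖eChar t x‖ = 1 := by
  rw [eChar_eq, Complex.norm_exp_ofReal_mul_I]

lemma eChar_comm (t x : ℝ) : eChar t x = eChar x t := by
  rw [eChar_eq, eChar_eq, mul_comm t x]

lemma eChar_add_left (s t x : ℝ) : eChar (s + t) x = eChar s x * eChar t x := by
  simp only [eChar_eq, ← Complex.exp_add]
  congr 1; push_cast; ring

lemma eChar_add_right (t x y : ℝ) : eChar t (x + y) = eChar t x * eChar t y := by
  rw [eChar_comm, eChar_add_left, eChar_comm x, eChar_comm y]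

lemma eChar_zero_left (x : ℝ) : eChar 0 x = 1 := by simp [eChar]

lemma continuous_eChar : Continuous (Function.uncurry eChar) := by
  unfold eChar Function.uncurry
  fun_prop

lemma continuous_eChar_left (x : ℝ) : Continuous (fun t => eChar t x) :=
  continuous_eChar.comp (by fun_prop : Continuous fun t : ℝ => (t, x))

lemma continuous_eChar_right (t : ℝ) : Continuous (eChar t) :=
  continuous_eChar.comp (by fun_prop : Continuous fun x : ℝ => (t, x))

/-- The inverse Fourier transform of `φ`. -/
def invF (φ : ℝ → ℂ) (x : ℝ) : ℂ := ∫ ξ, φ ξ * eChar ξ x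

lemma fourierInv_eq_invF (φ : ℝ → ℂ) : FourierTransformInv.fourierInv φ = invF φ := by
  ext x
  rw [Real.fourierInv_eq']
  unfold invF
  congr 1; ext ξ
  rw [eChar_eq, smul_eq_mul, mul_comm]
  simp [mul_comm]

lemma fourier_eq_fourierT (f : ℝ → ℂ) : FourierTransform.fourier f = fourierT f := by
  ext x
  rw [Real.fourier_eq']
  unfold fourierT
  congr 1; ext ξ
  rw [eChar_eq, smul_eq_mul, mul_comm]
  congr 2
  simp [mul_comm]

lemma fourierT_eq_invF (f : ℝ → ℂ) (x : ℝ) : fourierT f x = invF f (-x) := by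
  unfold fourierT invF
  simp_rw [eChar_comm (-x)]

lemma integrable_mul_eChar {φ : ℝ → ℂ} (hφ : Integrable φ) (x : ℝ) :
    Integrable (fun ξ => φ ξ * eChar ξ x) :=
  hφ.mul_bdd (c := 1) (continuous_eChar_left x).aestronglyMeasurable
    (ae_of_all _ fun ξ => (norm_eChar ξ x).le)

lemma norm_invF_le (φ : ℝ → ℂ) (x : ℝ) : ‖invF φ x‖ ≤ ∫ ξ, ‖φ ξ‖ := by
  refine (norm_integral_le_integral_norm _).trans_eq ?_
  simp [norm_eChar]

lemma continuous_invF {φ : ℝ → ℂ} (hφ : Integrable φ) : Continuous (invF φ) := by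
  refine continuous_of_dominated (bound := fun ξ => ‖φ ξ‖)
    (fun x => (integrable_mul_eChar hφ x).aestronglyMeasurable)
    (fun x => ae_of_all _ fun ξ => by simp [norm_eChar]) hφ.norm
    (ae_of_all _ fun ξ => continuous_const.mul (continuous_eChar_right ξ))

lemma invF_add {φ ψ : ℝ → ℂ} (hφ : Integrable φ) (hψ : Integrable ψ) :
    invF (fun ξ => φ ξ + ψ ξ) = fun x => invF φ x + invF ψ x := by
  ext x
  unfold invF
  simp_rw [add_mul]
  exact integral_add (integrable_mul_eChar hφ x) (integrable_mul_eChar hψ x)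

lemma invF_const_mul (c : ℂ) (φ : ℝ → ℂ) : invF (fun ξ => c * φ ξ) = fun x => c * invF φ x := by
  ext x
  unfold invF
  simp_rw [mul_assoc]
  exact integral_const_mul _ _

lemma invF_translate (φ : ℝ → ℂ) (α : ℝ) :
    invF (fun ξ => φ (ξ + α)) = fun x => eChar (-α) x * invF φ x := by
  ext x
  unfold invF
  rw [← integral_const_mul, ← integral_add_right_eq_self (fun ξ => eChar (-α) x * (φ ξ * eChar ξ x)) α]
  congr 1; ext ξ
  rw [mul_left_comm, ← eChar_add_left]
  simp

/-- The pairing of `g` with an inverse Fourier transform. -/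
lemma integral_mul_invF {φ g : ℝ → ℂ} (hφ : Integrable φ) (hg : Integrable g) :
    ∫ x, g x * invF φ x = ∫ ξ, φ ξ * invF g ξ := by
  have h : Integrable (fun z : ℝ × ℝ => g z.1 * φ z.2 * eChar z.2 z.1) (volume.prod volume) :=
    (hg.mul_prod hφ).mul_bdd (c := 1)
      (continuous_eChar.comp continuous_swap).aestronglyMeasurable
      (ae_of_all _ fun z => (norm_eChar _ _).le)
  calc ∫ x, g x * invF φ x = ∫ x, ∫ ξ, g x * φ ξ * eChar ξ x := by
        congr 1; ext x
        unfold invF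
        rw [← integral_const_mul]
        simp_rw [mul_assoc]
    _ = ∫ ξ, ∫ x, g x * φ ξ * eChar ξ x := integral_integral_swap h
    _ = ∫ ξ, φ ξ * invF g ξ := by
        congr 1; ext ξ
        unfold invF
        rw [← integral_const_mul]
        congr 1; ext x
        rw [eChar_comm ξ x]; ring

section laplace

lemma integrable_exp_neg_mul_abs {c : ℝ} (hc : 0 < c) :
    Integrable (fun x : ℝ => (Real.exp (-c * |x|) : ℂ)) := by
  rw [← integrableOn_univ, ← Iic_union_Ioi (a := (0 : ℝ))]
  refine IntegrableOn.union ?_ ?_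
  · refine (integrableOn_exp_mul_complex_Iic (a := c) (by simpa) 0).congr_fun (fun x hx => ?_)
      measurableSet_Iic
    dsimp only
    rw [abs_of_nonpos hx]; push_cast; congr 1; ring
  · refine (integrableOn_exp_mul_complex_Ioi (a := -c) (by simpa) 0).congr_fun (fun x hx => ?_)
      measurableSet_Ioi
    dsimp only
    rw [abs_of_pos hx]; push_cast; congr 1

/-- Fourier transform of the two-sided exponential. -/
lemma invF_exp_neg_mul_abs {c : ℝ} (hc : 0 < c) (ξ : ℝ) :
    invF (fun x => (Real.exp (-c * |x|) : ℂ)) ξ = ((2 * c / (c ^ 2 + (2 * Real.pi * ξ) ^ 2) : ℝ) : ℂ) := by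
  unfold invF
  set w : ℂ := (2 * Real.pi * ξ : ℝ) * Complex.I with hw
  have hre : w.re = 0 := by simp [hw]
  have h1 : ∀ x ∈ Iic (0 : ℝ), (Real.exp (-c * |x|) : ℂ) * eChar x ξ = Complex.exp ((c + w) * x) := by
    intro x hx
    rw [abs_of_nonpos hx, eChar_eq, Complex.ofReal_exp, ← Complex.exp_add]
    congr 1; rw [hw]; push_cast; ring
  have h2 : ∀ x ∈ Ioi (0 : ℝ), (Real.exp (-c * |x|) : ℂ) * eChar x ξ = Complex.exp ((-c + w) * x) := by
    intro x hx
    rw [abs_of_pos hx, eChar_eq, Complex.ofReal_exp, ← Complex.exp_add]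
    congr 1; rw [hw]; push_cast; ring
  have hi := integrable_mul_eChar (integrable_exp_neg_mul_abs hc) ξ
  rw [← setIntegral_univ, ← Iic_union_Ioi (a := (0 : ℝ)),
    setIntegral_union (Iic_disjoint_Ioi le_rfl) measurableSet_Ioi hi.integrableOn hi.integrableOn,
    setIntegral_congr_fun measurableSet_Iic h1, setIntegral_congr_fun measurableSet_Ioi h2,
    integral_exp_mul_complex_Iic (by simp [hre, hc]), integral_exp_mul_complex_Ioi (by simp [hre, hc])]
  have e1 : (c : ℂ) + w ≠ 0 := fun h => by
    have := congrArg Complex.re h; simp [hre] at this; exact hc.ne' this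
  have e2 : -(c : ℂ) + w ≠ 0 := fun h => by
    have := congrArg Complex.re h; simp [hre] at this; exact hc.ne' this
  have e3 : ((c ^ 2 + (2 * Real.pi * ξ) ^ 2 : ℝ) : ℂ) = -((c + w) * (-c + w)) := by
    rw [hw]; push_cast; ring_nf; rw [Complex.I_sq]; ring
  rw [Complex.ofReal_div, e3]
  simp only [Complex.ofReal_zero, mul_zero, Complex.exp_zero]
  field_simp
  push_cast
  ring

lemma integrable_pk {t : ℝ} (ht : 0 < t) : Integrable (pk t) := by
  refine ⟨(measurable_pk.comp (by fun_prop : Measurable fun x : ℝ => (t, x))).aestronglyMeasurable, ?_⟩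
  have h := lintegral_pk ht
  have e : ∀ x, ‖pk t x‖ₑ = ENNReal.ofReal (pk t x) := fun x =>
    Real.enorm_eq_ofReal (by unfold pk; positivity)
  simp [HasFiniteIntegral, e, h]

lemma invF_pk {t : ℝ} (ht : 0 < t) (ξ : ℝ) :
    invF (fun x => (pk t x : ℂ)) ξ = (Real.exp (-(2 * Real.pi * t) * |ξ|) : ℂ) := by
  have hc : 0 < 2 * Real.pi * t := by positivity
  have e : fourierT (fun x : ℝ => (Real.exp (-(2 * Real.pi * t) * |x|) : ℂ)) = fun x => (pk t x : ℂ) := by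
    ext x
    rw [fourierT_eq_invF, invF_exp_neg_mul_abs hc]
    congr 1
    unfold pk
    have := Real.pi_pos
    have : 0 < x ^ 2 + t ^ 2 := by positivity
    rw [div_eq_div_iff (by positivity) (by positivity)]
    ring
  have hi := integrable_exp_neg_mul_abs hc
  have h := Continuous.fourierInv_fourier_eq (f := fun x : ℝ => (Real.exp (-(2 * Real.pi * t) * |x|) : ℂ))
    (by fun_prop) hi (by rw [fourier_eq_fourierT, e]; exact (integrable_pk ht).ofReal)
  rw [fourier_eq_fourierT, e, fourierInv_eq_invF] at h
  exact congrFun h ξ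

lemma kconv_pk_eChar {t : ℝ} (ht : 0 < t) (ξ x : ℝ) :
    kconv pk (eChar ξ) t x = (Real.exp (-(2 * Real.pi * t) * |ξ|) : ℂ) * eChar ξ x := by
  rw [← invF_pk ht]
  unfold kconv invF
  rw [← integral_mul_const]
  have hs : ∀ y, pk t (x - (x + y)) = pk t y := fun y => by simp [pk]
  rw [← integral_add_left_eq_self _ x]
  refine integral_congr_ae (ae_of_all _ fun y => ?_)
  simp only [hs, eChar_add_right, eChar_comm y, Complex.real_smul]
  ring

lemma kconv_pkt_eChar {t : ℝ} (ht : 0 < t) (ξ x : ℝ) :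
    kconv pkt (eChar ξ) t x =
      ((-(2 * Real.pi * |ξ|) * Real.exp (-(2 * Real.pi * t) * |ξ|) : ℝ) : ℂ) * eChar ξ x := by
  have h1 := hasDerivAt_kconv_pk_t (M := 1) (continuous_eChar_right ξ).stronglyMeasurable
    (fun y => (norm_eChar ξ y).le) ht x
  have h2 : HasDerivAt (fun s : ℝ => Real.exp (-(2 * Real.pi * s) * |ξ|))
      (-(2 * Real.pi * |ξ|) * Real.exp (-(2 * Real.pi * t) * |ξ|)) t := by
    have := ((hasDerivAt_id' t).const_mul (-(2 * Real.pi) * |ξ|)).exp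
    convert this using 1
    · ext s; congr 1; ring
    · rw [mul_comm]; congr 1
      · congr 1; ring
      · ring
  have h3 := h2.ofReal_comp.mul_const (eChar ξ x)
  refine h1.unique (h3.congr_of_eventuallyEq ?_)
  filter_upwards [lt_mem_nhds ht] with s hs
  exact kconv_pk_eChar hs ξ x

lemma kconv_pkx_eChar {t : ℝ} (ht : 0 < t) (ξ x : ℝ) :
    kconv pkx (eChar ξ) t x =
      (2 * Real.pi * ξ * Complex.I) * (Real.exp (-(2 * Real.pi * t) * |ξ|) : ℂ) * eChar ξ x := by
  have h1 := hasDerivAt_kconv_pk_x (M := 1) (continuous_eChar_right ξ).stronglyMeasurable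
    (fun y => (norm_eChar ξ y).le) ht x
  have h2 : HasDerivAt (fun s : ℝ => eChar ξ s) ((2 * Real.pi * ξ * Complex.I) * eChar ξ x) x := by
    unfold eChar
    have := (((hasDerivAt_id' (x : ℂ)).const_mul (2 * Real.pi * Complex.I * ξ)).cexp).comp_ofReal
    convert this using 1
    ring
  have h3 := h2.const_mul (Real.exp (-(2 * Real.pi * t) * |ξ|) : ℂ)
  have h4 : (fun s => kconv pk (eChar ξ) t s) =
    fun s => (Real.exp (-(2 * Real.pi * t) * |ξ|) : ℂ) * eChar ξ s :=
    funext fun s => kconv_pk_eChar ht ξ s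
  have := h1.unique (h4 ▸ h3)
  rw [this]; ring

end laplace

end

noncomputable section

lemma conv_invF {k : ℝ → ℝ} {φ : ℝ → ℂ} (hk : Integrable k) (hφ : Integrable φ) (x : ℝ) :
    ∫ y, k (x - y) • invF φ y = ∫ ξ, φ ξ * ∫ y, k (x - y) • eChar ξ y := by
  have hk' : Integrable (fun y => (k (x - y) : ℂ)) := (hk.comp_sub_left x).ofReal
  have h := integral_mul_invF hφ hk'
  simp only [Complex.real_smul]
  rw [h]
  congr 1; ext ξ
  unfold invF
  simp_rw [eChar_comm ξ]

lemma integrable_conv_prod {k : ℝ → ℝ} {g : ℝ → ℂ} (hk : Integrable k) (hg : Integrable g) :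
    Integrable (fun z : ℝ × ℝ => k (z.1 - z.2) • g z.2) (volume.prod volume) := by
  have := Integrable.convolution_integrand (ContinuousLinearMap.mul ℝ ℂ) hg hk.ofReal
    (μ := volume) (ν := volume) (𝕜 := ℝ)
  refine this.congr (ae_of_all _ fun z => ?_)
  simp [Complex.real_smul, mul_comm]

lemma integrable_conv {k : ℝ → ℝ} {g : ℝ → ℂ} (hk : Integrable k) (hg : Integrable g) :
    Integrable (fun x => ∫ y, k (x - y) • g y) :=
  (integrable_conv_prod hk hg).integral_prod_left

lemma invF_conv {k : ℝ → ℝ} {g : ℝ → ℂ} (hk : Integrable k) (hg : Integrable g) (ξ : ℝ) :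
    invF (fun x => ∫ y, k (x - y) • g y) ξ = ∫ y, g y * ∫ x, k (x - y) • eChar ξ x := by
  have h : Integrable (fun z : ℝ × ℝ => k (z.1 - z.2) • g z.2 * eChar z.1 ξ)
      (volume.prod volume) :=
    (integrable_conv_prod hk hg).mul_bdd (c := 1)
      ((continuous_eChar_left ξ).comp continuous_fst).aestronglyMeasurable
      (ae_of_all _ fun z => (norm_eChar _ _).le)
  unfold invF
  simp_rw [← integral_mul_const]
  rw [integral_integral_swap h]
  congr 1; ext y
  rw [← integral_const_mul]
  congr 1; ext x
  simp only [Complex.real_smul, eChar_comm ξ]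
  ring

/-- Pairing of two convolutions, on the frequency side. -/
lemma integral_conv_mul_conv {k l : ℝ → ℝ} {s s' φ g : ℝ → ℂ} (hk : Integrable k)
    (hl : Integrable l) (hφ : Integrable φ) (hg : Integrable g)
    (hs : ∀ ξ x, ∫ y, k (x - y) • eChar ξ y = s ξ * eChar ξ x)
    (hs' : ∀ ξ x, ∫ y, l (x - y) • eChar ξ y = s' ξ * eChar ξ x)
    (heven : ∀ x, l (-x) = l x) (hsi : Integrable (fun ξ => φ ξ * s ξ)) :
    ∫ x, (∫ y, k (x - y) • invF φ y) * (∫ y, l (x - y) • g y) =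
      ∫ ξ, φ ξ * (s ξ * s' ξ) * invF g ξ := by
  have h1 : ∀ x, ∫ y, k (x - y) • invF φ y = invF (fun ξ => φ ξ * s ξ) x := by
    intro x
    rw [conv_invF hk hφ]
    unfold invF
    congr 1; ext ξ
    rw [hs, mul_assoc]
  simp_rw [h1, mul_comm (invF _ _)]
  rw [integral_mul_invF hsi (integrable_conv hl hg)]
  congr 1; ext ξ
  rw [invF_conv hl hg]
  have h2 : ∀ y, ∫ x, l (x - y) • eChar ξ x = s' ξ * eChar ξ y := by
    intro y
    rw [← hs']
    congr 1; ext x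
    rw [← heven, neg_sub]
  simp_rw [h2]
  unfold invF
  rw [← integral_const_mul, ← integral_const_mul]
  congr 1; ext y
  rw [eChar_comm ξ]; ring

/-- The profile `(1+s)e^{-s}`. -/
def etaF (s : ℝ) : ℝ := (1 + s) * Real.exp (-s)

/-- The symbol of the truncated square function pairing. -/
def msym (δ T ξ : ℝ) : ℝ := (etaF (4 * Real.pi * |ξ| * δ) - etaF (4 * Real.pi * |ξ| * T)) / 4

lemma hasDerivAt_etaF (s : ℝ) : HasDerivAt etaF (-s * Real.exp (-s)) s := by
  have h := ((hasDerivAt_id' s).const_add 1).mul (hasDerivAt_neg s).exp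
  refine h.congr_deriv ?_
  simp; ring

lemma continuous_etaF : Continuous etaF := by unfold etaF; fun_prop

lemma continuous_msym (δ T : ℝ) : Continuous (msym δ T) := by
  unfold msym
  have := continuous_etaF
  fun_prop

lemma etaF_nonneg {s : ℝ} (hs : 0 ≤ s) : 0 ≤ etaF s := by unfold etaF; positivity

lemma etaF_le_one (s : ℝ) : etaF s ≤ 1 := by
  unfold etaF
  have h := Real.add_one_le_exp s
  have h2 := Real.exp_pos (-s)
  calc (1 + s) * Real.exp (-s) ≤ Real.exp s * Real.exp (-s) := by gcongr; linarith
    _ = 1 := by rw [← Real.exp_add]; simp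

lemma abs_msym_le {δ T : ℝ} (hδ : 0 ≤ δ) (hT : 0 ≤ T) (ξ : ℝ) : |msym δ T ξ| ≤ 1 := by
  unfold msym
  have h1 : 0 ≤ etaF (4 * Real.pi * |ξ| * δ) := etaF_nonneg (by positivity)
  have h2 : 0 ≤ etaF (4 * Real.pi * |ξ| * T) := etaF_nonneg (by positivity)
  have h3 := etaF_le_one (4 * Real.pi * |ξ| * δ)
  have h4 := etaF_le_one (4 * Real.pi * |ξ| * T)
  rw [abs_le]; constructor <;> linarith

lemma integral_symbol (δ T ξ : ℝ) :
    ∫ t in δ..T, t * (4 * Real.pi ^ 2 * ξ ^ 2 * Real.exp (-(4 * Real.pi * |ξ| * t))) = msym δ T ξ := by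
  have h : ∀ t : ℝ, HasDerivAt (fun t => -(1 / 4) * etaF (4 * Real.pi * |ξ| * t))
      (t * (4 * Real.pi ^ 2 * ξ ^ 2 * Real.exp (-(4 * Real.pi * |ξ| * t)))) t := by
    intro t
    have h1 := (hasDerivAt_etaF (4 * Real.pi * |ξ| * t)).comp t
      ((hasDerivAt_id' t).const_mul (4 * Real.pi * |ξ|))
    refine (h1.const_mul (-(1 / 4))).congr_deriv ?_
    have : ξ ^ 2 = |ξ| * |ξ| := by rw [← sq, sq_abs]
    rw [this]; ring
  rw [intervalIntegral.integral_eq_sub_of_hasDerivAt (fun t _ => h t)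
    (Continuous.intervalIntegrable (by fun_prop) _ _)]
  unfold msym; ring

lemma sq_mul_exp_le {t : ℝ} (ht : 0 < t) (ξ : ℝ) :
    4 * Real.pi ^ 2 * ξ ^ 2 * Real.exp (-(4 * Real.pi * |ξ| * t)) ≤ 1 / t ^ 2 := by
  have h := Real.quadratic_le_exp_of_nonneg (x := 4 * Real.pi * |ξ| * t) (by positivity)
  have h0 : 0 ≤ 4 * Real.pi * |ξ| * t := by positivity
  rw [Real.exp_neg, ← div_eq_mul_inv, div_le_div_iff₀ (Real.exp_pos _) (by positivity)]
  have : (4 * Real.pi * |ξ| * t) ^ 2 = 16 * Real.pi ^ 2 * ξ ^ 2 * t ^ 2 := by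
    rw [mul_pow, mul_pow, sq_abs]; ring
  nlinarith

lemma integrable_of_kernel_bound {k : ℝ → ℝ} {C : ℝ} (hk : Measurable k)
    (h : ∀ x, |k x| ≤ C / (1 + x ^ 2)) : Integrable k := by
  refine ((integrable_inv_one_add_sq).const_mul C).mono' hk.aestronglyMeasurable
    (ae_of_all _ fun x => ?_)
  simpa [div_eq_mul_inv] using h x

lemma integrable_pkt {t : ℝ} (ht : 0 < t) : Integrable (pkt t) := by
  obtain ⟨C, -, hC⟩ := pk_bounds ht le_rfl
  exact integrable_of_kernel_bound (measurable_pkt.comp measurable_prodMk_left)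
    fun x => (hC t le_rfl le_rfl x).2.1

lemma integrable_pkx {t : ℝ} (ht : 0 < t) : Integrable (pkx t) := by
  obtain ⟨C, -, hC⟩ := pk_bounds ht le_rfl
  exact integrable_of_kernel_bound (measurable_pkx.comp measurable_prodMk_left)
    fun x => (hC t le_rfl le_rfl x).2.2.1

/-- A kernel, among `pkt` and `pkx`, together with its normalised symbol. -/
structure GradKernel (K : ℝ → ℝ → ℝ) (σ : ℝ → ℂ) : Prop where
  integrable : ∀ t, 0 < t → Integrable (K t)
  measurable : Measurable σ
  norm_le : ∀ ξ, ‖σ ξ‖ ≤ 1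
  symbol : ∀ t, 0 < t → ∀ ξ x, kconv K (eChar ξ) t x =
    σ ξ * (-(2 * Real.pi * |ξ|) * Real.exp (-(2 * Real.pi * t) * |ξ|) : ℝ) * eChar ξ x
  le_grad : ∀ (f : ℝ → ℂ) t x, ‖kconv K f t x‖ ≤ gradN f t x

lemma gradKernel_pkt : GradKernel pkt (fun _ => 1) where
  integrable _ ht := integrable_pkt ht
  measurable := measurable_const
  norm_le _ := by simp
  symbol t ht ξ x := by rw [kconv_pkt_eChar ht, one_mul]
  le_grad f t x := by
    unfold gradN
    refine Real.le_sqrt_of_sq_le ?_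
    have := sq_nonneg ‖kconv pkx f t x‖
    linarith

lemma gradKernel_pkx : GradKernel pkx (fun ξ => -Complex.I * (SignType.sign ξ : ℝ)) where
  integrable _ ht := integrable_pkx ht
  measurable := by
    have : Measurable (fun ξ : ℝ => ((SignType.sign ξ : ℝ))) := by
      have h : (fun ξ : ℝ => ((SignType.sign ξ : ℝ))) = fun ξ => if 0 < ξ then 1 else if ξ < 0 then -1 else 0 := by
        ext ξ
        rcases lt_trichotomy ξ 0 with h | h | h
        · simp [h, h.not_gt]
        · simp [h]
        · simp [h]
      rw [h]
      exact Measurable.ite measurableSet_Ioi measurable_const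
        (Measurable.ite measurableSet_Iio measurable_const measurable_const)
    fun_prop
  norm_le ξ := by
    rcases lt_trichotomy ξ 0 with h | h | h <;> simp [h]
  symbol t ht ξ x := by
    rw [kconv_pkx_eChar ht]
    have : (ξ : ℂ) = (SignType.sign ξ : ℝ) * (|ξ| : ℝ) := by
      rw [← Complex.ofReal_mul, sign_mul_abs]
    rw [this]
    push_cast
    ring
  le_grad f t x := by
    unfold gradN
    refine Real.le_sqrt_of_sq_le ?_
    have := sq_nonneg ‖kconv pkt f t x‖
    linarith

lemma norm_ofReal_mul_sq_le {t : ℝ} (ht : 0 < t) (z : ℂ) (hz : ‖z‖ ≤ 1) (ξ : ℝ) :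
    ‖z * ((4 * Real.pi ^ 2 * ξ ^ 2 * Real.exp (-(4 * Real.pi * |ξ| * t)) : ℝ) : ℂ)‖ ≤ 1 / t ^ 2 := by
  rw [norm_mul, Complex.norm_real, Real.norm_eq_abs, abs_of_nonneg (by positivity)]
  have h := sq_mul_exp_le ht ξ
  have : (0 : ℝ) ≤ 4 * Real.pi ^ 2 * ξ ^ 2 * Real.exp (-(4 * Real.pi * |ξ| * t)) := by positivity
  nlinarith [norm_nonneg z]

section pairing

variable {K : ℝ → ℝ → ℝ} {σ φ g : ℝ → ℂ}

lemma GradKernel.integral_slice (hK : GradKernel K σ) (hφ : Integrable φ) (hg : Integrable g)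
    {t : ℝ} (ht : 0 < t) :
    ∫ x, kconv K (invF φ) t x * kconv pkt g t x = ∫ ξ, φ ξ * (σ ξ *
      ((4 * Real.pi ^ 2 * ξ ^ 2 * Real.exp (-(4 * Real.pi * |ξ| * t)) : ℝ) : ℂ)) * invF g ξ := by
  have h := integral_conv_mul_conv (hK.integrable t ht) (integrable_pkt ht) hφ hg
    (hK.symbol t ht) (gradKernel_pkt.symbol t ht) (fun x => by simp [pkt]) ?_
  · refine h.trans ?_
    congr 1; ext ξ
    congr 2
    have e1 : Real.exp (-(4 * Real.pi * |ξ| * t)) =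
        Real.exp (-(2 * Real.pi * t) * |ξ|) * Real.exp (-(2 * Real.pi * t) * |ξ|) := by
      rw [← Real.exp_add]; congr 1; ring
    have e2 : ξ ^ 2 = |ξ| * |ξ| := by rw [← sq, sq_abs]
    rw [one_mul, mul_assoc, ← Complex.ofReal_mul, e1, e2]
    congr 2; ring
  · refine hφ.mul_bdd (c := 1 / t) ?_ (ae_of_all _ fun ξ => ?_)
    · exact (hK.measurable.mul (by fun_prop)).aestronglyMeasurable
    · rw [norm_mul, Complex.norm_real, Real.norm_eq_abs, abs_mul, abs_neg, Real.abs_exp,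
        abs_of_nonneg (by positivity)]
      have h1 := hK.norm_le ξ
      have h2 : 2 * Real.pi * |ξ| * Real.exp (-(2 * Real.pi * t) * |ξ|) ≤ 1 / t := by
        have := Real.add_one_le_exp (2 * Real.pi * t * |ξ|)
        rw [neg_mul, Real.exp_neg, ← div_eq_mul_inv, div_le_div_iff₀ (Real.exp_pos _) ht]
        linarith
      have h3 : 0 ≤ 2 * Real.pi * |ξ| * Real.exp (-(2 * Real.pi * t) * |ξ|) := by positivity
      nlinarith [norm_nonneg (σ ξ)]

lemma GradKernel.integral_window (hK : GradKernel K σ) (hφ : Integrable φ) (hg : Integrable g)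
    {δ T : ℝ} (hδ : 0 < δ) (hT : δ ≤ T) :
    ∫ t in Ioc δ T, (t : ℂ) * ∫ x, kconv K (invF φ) t x * kconv pkt g t x =
      ∫ ξ, φ ξ * (σ ξ * (msym δ T ξ : ℂ)) * invF g ξ := by
  have hpos : ∀ t ∈ Ioc δ T, 0 < t := fun t ht => hδ.trans ht.1
  set S : ℝ → ℝ → ℝ := fun t ξ => 4 * Real.pi ^ 2 * ξ ^ 2 * Real.exp (-(4 * Real.pi * |ξ| * t)) with hS
  have hGc := continuous_invF hg
  have hfac : Integrable (fun ξ => φ ξ * invF g ξ) :=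
    hφ.mul_bdd hGc.aestronglyMeasurable (ae_of_all _ fun ξ => norm_invF_le g ξ)
  have hInt : Integrable (fun z : ℝ × ℝ => (φ z.2 * invF g z.2) * ((z.1 : ℂ) * (σ z.2 * (S z.1 z.2 : ℂ))))
      ((volume.restrict (Ioc δ T)).prod volume) := by
    have h1 : Integrable (fun z : ℝ × ℝ => φ z.2 * invF g z.2)
        ((volume.restrict (Ioc δ T)).prod volume) := hfac.comp_snd _
    refine h1.mul_bdd (c := 1 / δ) ?_ ?_
    · refine Measurable.aestronglyMeasurable ?_
      have := hK.measurable
      simp only [hS]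
      fun_prop
    · have : ∀ᵐ z : ℝ × ℝ ∂((volume.restrict (Ioc δ T)).prod volume), z.1 ∈ Ioc δ T :=
        Measure.quasiMeasurePreserving_fst.ae (ae_restrict_mem measurableSet_Ioc)
      filter_upwards [this] with z hz
      have ht := hpos _ hz
      rw [norm_mul, Complex.norm_real, Real.norm_eq_abs, abs_of_pos ht]
      calc z.1 * _ ≤ z.1 * (1 / z.1 ^ 2) :=
            mul_le_mul_of_nonneg_left (norm_ofReal_mul_sq_le ht _ (hK.norm_le _) _) ht.le
        _ = 1 / z.1 := by field_simp
        _ ≤ 1 / δ := one_div_le_one_div_of_le hδ hz.1.le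
  calc ∫ t in Ioc δ T, (t : ℂ) * ∫ x, kconv K (invF φ) t x * kconv pkt g t x
      = ∫ t in Ioc δ T, ∫ ξ, (φ ξ * invF g ξ) * ((t : ℂ) * (σ ξ * (S t ξ : ℂ))) := by
        refine setIntegral_congr_fun measurableSet_Ioc fun t ht => ?_
        rw [hK.integral_slice hφ hg (hpos t ht), ← integral_const_mul]
        congr 1; ext ξ; ring
    _ = ∫ ξ, ∫ t in Ioc δ T, (φ ξ * invF g ξ) * ((t : ℂ) * (σ ξ * (S t ξ : ℂ))) :=
        integral_integral_swap hInt
    _ = _ := by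
        congr 1; ext ξ
        rw [integral_const_mul]
        have : ∀ t : ℝ, (t : ℂ) * (σ ξ * (S t ξ : ℂ)) = σ ξ * ((t * S t ξ : ℝ) : ℂ) := by
          intro t; push_cast; ring
        simp_rw [this]
        rw [integral_const_mul, integral_complex_ofReal, ← intervalIntegral.integral_of_le hT,
          integral_symbol]
        ring

end pairing

lemma sum_lintegral_le {α ι : Type*} [MeasurableSpace α] {μ : Measure α} (s : Finset ι)
    (f : ι → α → ℝ≥0∞) : ∑ i ∈ s, ∫⁻ a, f i a ∂μ ≤ ∫⁻ a, ∑ i ∈ s, f i a ∂μ := by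
  classical
  induction s using Finset.induction_on with
  | empty => simp
  | insert i s hi ih =>
    simp_rw [Finset.sum_insert hi]
    exact (add_le_add_right ih _).trans (le_lintegral_add _ _)

/-- Window pairings are controlled by the gradient pairing. -/
theorem GradKernel.sum_pairing_le {ι : Type*} [Fintype ι] {E F : Type*} [NormedAddCommGroup E]
    [InnerProductSpace ℝ E] [NormedAddCommGroup F] [InnerProductSpace ℝ F]
    {K : ℝ → ℝ → ℝ} {σ : ℝ → ℂ} (hK : GradKernel K σ) {φ g : ι → ℝ → ℂ} {f : ℝ → E} {h : ℝ → F}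
    (hφ : ∀ i, Integrable (φ i)) (hg : ∀ i, Integrable (g i)) {δ T : ι → ℝ} (hδ : ∀ i, 0 < δ i)
    (hT : ∀ i, δ i ≤ T i)
    (hcs : ∀ t x, 0 < t → ∑ i, (Ioc (δ i) (T i)).indicator
      (fun t => gradN (invF (φ i)) t x * gradN (g i) t x) t ≤ gradN f t x * gradN h t x) :
    ‖∑ i, ∫ ξ, φ i ξ * (σ ξ * (msym (δ i) (T i) ξ : ℂ)) * invF (g i) ξ‖ₑ ≤ gradPair f h := by
  have h1 : ∀ i, ‖∫ ξ, φ i ξ * (σ ξ * (msym (δ i) (T i) ξ : ℂ)) * invF (g i) ξ‖ₑ ≤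
      ∫⁻ t in Ioi (0 : ℝ), ENNReal.ofReal t * ∫⁻ x, ENNReal.ofReal ((Ioc (δ i) (T i)).indicator
        (fun t => gradN (invF (φ i)) t x * gradN (g i) t x) t) := by
    intro i
    rw [← hK.integral_window (hφ i) (hg i) (hδ i) (hT i)]
    refine (enorm_integral_le_lintegral_enorm _).trans ?_
    have hsub : Ioc (δ i) (T i) ⊆ Ioi 0 := fun t ht => (hδ i).trans ht.1
    refine le_trans ?_ (lintegral_mono_set hsub)
    refine setLIntegral_mono' measurableSet_Ioc fun t ht => ?_
    have ht0 : 0 < t := hsub ht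
    rw [enorm_mul, ← ofReal_norm, Complex.norm_real, Real.norm_eq_abs, abs_of_pos ht0]
    gcongr
    refine (enorm_integral_le_lintegral_enorm _).trans (lintegral_mono fun x => ?_)
    rw [indicator_of_mem ht, ← ofReal_norm, norm_mul]
    exact ENNReal.ofReal_le_ofReal (mul_le_mul (hK.le_grad _ _ _) (gradKernel_pkt.le_grad _ _ _)
      (norm_nonneg _) (gradN_nonneg _ _ _))
  refine (enorm_sum_le _ _).trans ((Finset.sum_le_sum fun i _ => h1 i).trans ?_)
  refine (sum_lintegral_le _ _).trans (setLIntegral_mono' measurableSet_Ioi fun t ht => ?_)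
  rw [← Finset.mul_sum]
  gcongr
  refine (sum_lintegral_le _ _).trans (lintegral_mono fun x => ?_)
  rw [← ENNReal.ofReal_sum_of_nonneg]
  · exact ENNReal.ofReal_le_ofReal (hcs t x ht)
  · intro i _
    exact indicator_nonneg (fun t _ => mul_nonneg (gradN_nonneg _ _ _) (gradN_nonneg _ _ _)) _

end

noncomputable section

set_option linter.unusedSectionVars false

section vec

variable {ι : Type*} [Fintype ι]

/-- The vector valued function with components `F i`. -/
def vec (F : ι → ℝ → ℂ) (x : ℝ) : EuclideanSpace ℂ ι := WithLp.toLp 2 fun i => F i x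

lemma vec_apply (F : ι → ℝ → ℂ) (x : ℝ) (i : ι) : vec F x i = F i x := rfl

lemma norm_vec_sq (F : ι → ℝ → ℂ) (x : ℝ) : ‖vec F x‖ ^ 2 = ∑ i, ‖F i x‖ ^ 2 := by
  rw [EuclideanSpace.norm_sq_eq]; rfl

lemma norm_le_norm_vec (F : ι → ℝ → ℂ) (x : ℝ) (i : ι) : ‖F i x‖ ≤ ‖vec F x‖ := by
  refine (sq_le_sq₀ (norm_nonneg _) (norm_nonneg _)).1 ?_
  rw [norm_vec_sq]
  exact Finset.single_le_sum (f := fun i => ‖F i x‖ ^ 2) (fun _ _ => by positivity) (Finset.mem_univ i)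

lemma norm_vec_le_sum (F : ι → ℝ → ℂ) (x : ℝ) : ‖vec F x‖ ≤ ∑ i, ‖F i x‖ := by
  refine (sq_le_sq₀ (norm_nonneg _) (by positivity)).1 ?_
  rw [norm_vec_sq]
  exact Finset.sum_sq_le_sq_sum_of_nonneg fun _ _ => norm_nonneg _

lemma measurable_vec {F : ι → ℝ → ℂ} (hF : ∀ i, Measurable (F i)) : Measurable (vec F) :=
  (WithLp.measurable_toLp 2 _).comp (measurable_pi_lambda _ hF)

lemma memLp_vec {F : ι → ℝ → ℂ} {p : ℝ≥0∞} (hF : ∀ i, MemLp (F i) p volume)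
    (hm : ∀ i, Measurable (F i)) : MemLp (vec F) p volume := by
  have h : MemLp (fun x => ∑ i, ‖F i x‖) p volume := memLp_finsetSum _ fun i _ => (hF i).norm
  refine h.of_le (measurable_vec hm).stronglyMeasurable.aestronglyMeasurable
    (ae_of_all _ fun x => ?_)
  rw [Real.norm_eq_abs, abs_of_nonneg (by positivity)]
  exact norm_vec_le_sum F x

lemma eLpNorm_comp_le_vec (F : ι → ℝ → ℂ) (p : ℝ≥0∞) (i : ι) :
    eLpNorm (F i) p volume ≤ eLpNorm (vec F) p volume :=
  eLpNorm_mono fun x => norm_le_norm_vec F x i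

lemma kconv_vec_apply {K : ℝ → ℝ → ℝ} {F : ι → ℝ → ℂ} {t x : ℝ}
    (h : Integrable (fun y => K t (x - y) • vec F y)) (i : ι) :
    kconv K (vec F) t x i = kconv K (F i) t x := by
  unfold kconv
  have := ((EuclideanSpace.proj i : EuclideanSpace ℂ ι →L[ℂ] ℂ).restrictScalars ℝ).integral_comp_comm h
  exact this.symm

lemma gradN_vec_sq {F : ι → ℝ → ℂ} {M t : ℝ} (hF : ∀ i, Measurable (F i))
    (hM : ∀ i y, ‖F i y‖ ≤ M) (ht : 0 < t) (x : ℝ) :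
    gradN (vec F) t x ^ 2 = ∑ i, gradN (F i) t x ^ 2 := by
  obtain ⟨C, hC0, hC⟩ := pk_bounds ht le_rfl
  have hb : ∀ y, ‖vec F y‖ ≤ ∑ _i : ι, M := fun y =>
    (norm_vec_le_sum F y).trans (Finset.sum_le_sum fun i _ => hM i y)
  have hs := (measurable_vec hF).stronglyMeasurable
  have h1 : Integrable (fun y => pkt t (x - y) • vec F y) :=
    integrable_kernel_smul (x := x)
      ((measurable_pkt.comp measurable_prodMk_left).comp (by fun_prop : Measurable fun y => x - y))
      (fun y => (hC t le_rfl le_rfl _).2.1) hs hb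
  have h2 : Integrable (fun y => pkx t (x - y) • vec F y) :=
    integrable_kernel_smul (x := x)
      ((measurable_pkx.comp measurable_prodMk_left).comp (by fun_prop : Measurable fun y => x - y))
      (fun y => (hC t le_rfl le_rfl _).2.2.1) hs hb
  rw [gradN_sq, EuclideanSpace.norm_sq_eq, EuclideanSpace.norm_sq_eq, ← Finset.sum_add_distrib]
  refine Finset.sum_congr rfl fun i _ => ?_
  rw [kconv_vec_apply h1, kconv_vec_apply h2, gradN_sq]

lemma sum_gradN_mul_le {F G : ι → ℝ → ℂ} {M N t : ℝ} (hF : ∀ i, Measurable (F i))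
    (hM : ∀ i y, ‖F i y‖ ≤ M) (hG : ∀ i, Measurable (G i)) (hN : ∀ i y, ‖G i y‖ ≤ N)
    (ht : 0 < t) (x : ℝ) :
    ∑ i, gradN (F i) t x * gradN (G i) t x ≤ gradN (vec F) t x * gradN (vec G) t x := by
  have h1 := gradN_vec_sq hF hM ht x
  have h2 := gradN_vec_sq hG hN ht x
  refine (Real.sum_mul_le_sqrt_mul_sqrt _ _ _).trans_eq ?_
  rw [← h1, ← h2, Real.sqrt_sq (gradN_nonneg _ _ _), Real.sqrt_sq (gradN_nonneg _ _ _)]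

lemma gradN_le_vec {F : ι → ℝ → ℂ} {M t : ℝ} (hF : ∀ i, Measurable (F i))
    (hM : ∀ i y, ‖F i y‖ ≤ M) (ht : 0 < t) (x : ℝ) (i : ι) :
    gradN (F i) t x ≤ gradN (vec F) t x := by
  refine (sq_le_sq₀ (gradN_nonneg _ _ _) (gradN_nonneg _ _ _)).1 ?_
  rw [gradN_vec_sq hF hM ht]
  exact Finset.single_le_sum (f := fun i => gradN (F i) t x ^ 2) (fun _ _ => by positivity)
    (Finset.mem_univ i)

end vec

/-- Bounded measurable functions with bounded support. -/
structure TestFn (g : ℝ → ℂ) (M R : ℝ) : Prop where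
  measurable : Measurable g
  bdd : ∀ x, ‖g x‖ ≤ M
  supp : ∀ x, R < |x| → g x = 0

lemma TestFn.memLp {g : ℝ → ℂ} {M R : ℝ} (hg : TestFn g M R) (p : ℝ≥0∞) : MemLp g p volume := by
  have h1 : MemLp ((Icc (-R) R).indicator fun _ => M) p (volume : Measure ℝ) :=
    memLp_indicator_const p measurableSet_Icc M (Or.inr (by simp))
  refine h1.of_le hg.measurable.aestronglyMeasurable (ae_of_all _ fun x => ?_)
  by_cases hx : x ∈ Icc (-R) R
  · rw [indicator_of_mem hx]
    exact (hg.bdd x).trans (le_abs_self _)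
  · rw [hg.supp x (by rw [mem_Icc, ← abs_le] at hx; exact not_le.1 hx)]
    simp

lemma TestFn.integrable {g : ℝ → ℂ} {M R : ℝ} (hg : TestFn g M R) : Integrable g :=
  memLp_one_iff_integrable.1 (hg.memLp 1)

section dual

variable {ι : Type*} [Fintype ι]

lemma lintegral_le_of_le_mul_rpow {I K : ℝ≥0∞} {p q : ℝ} (hpq : p.HolderConjugate q) (hI : I ≠ ∞)
    (h : I ≤ K * I ^ (1 / q)) : I ≤ K ^ p := by
  by_cases h0 : I = 0
  · simp [h0]
  have hp := hpq.pos
  have hq := hpq.symm.pos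
  have e : I = I ^ (1 / p) * I ^ (1 / q) := by
    rw [← ENNReal.rpow_add _ _ h0 hI, one_div, one_div, hpq.inv_add_inv_eq_one, ENNReal.rpow_one]
  have h1 : I ^ (1 / p) * I ^ (1 / q) ≤ K * I ^ (1 / q) := e ▸ h
  have h2 : I ^ (1 / p) ≤ K := (ENNReal.mul_le_mul_iff_left
    (by simp [h0, hI]) (ENNReal.rpow_ne_top_of_nonneg (by positivity) hI)).1 h1
  calc I = (I ^ (1 / p)) ^ p := by
        rw [← ENNReal.rpow_mul, one_div, inv_mul_cancel₀ hp.ne', ENNReal.rpow_one]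
    _ ≤ K ^ p := ENNReal.rpow_le_rpow h2 hp.le

/-- Converse Hölder inequality for vector valued functions. -/
theorem eLpNorm_vec_le_of_dual {p q B : ℝ} (hpq : p.HolderConjugate q) {F : ι → ℝ → ℂ} {K : ℝ≥0∞}
    (hF : ∀ i, Measurable (F i)) (hB : ∀ i x, ‖F i x‖ ≤ B)
    (h : ∀ (g : ι → ℝ → ℂ) (M R : ℝ), (∀ i, TestFn (g i) M R) →
      ‖∑ i, ∫ x, g i x * F i x‖ₑ ≤ K * eLpNorm (vec g) (ENNReal.ofReal q) volume) :
    eLpNorm (vec F) (ENNReal.ofReal p) volume ≤ K := by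
  have hp := hpq.pos
  have hq := hpq.symm.pos
  have hp1 := hpq.lt
  have hvF := measurable_vec hF
  set B' := ∑ _i : ι, B with hB'
  have hvB : ∀ x, ‖vec F x‖ ≤ B' := fun x =>
    (norm_vec_le_sum F x).trans (Finset.sum_le_sum fun i _ => hB i x)
  have hB0 : 0 ≤ B' := (norm_nonneg _).trans (hvB 0)
  have main : ∀ n : ℕ, ∫⁻ x in Icc (-(n : ℝ)) n, ‖vec F x‖ₑ ^ p ≤ K ^ p := by
    intro n
    set S := Icc (-(n : ℝ)) n with hS
    have hSm : MeasurableSet S := measurableSet_Icc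
    let g : ι → ℝ → ℂ := fun i => S.indicator fun x =>
      (starRingEnd ℂ) (F i x) * ((‖vec F x‖ ^ (p - 2) : ℝ) : ℂ)
    have hgn : ∀ x ∈ S, ‖vec g x‖ = ‖vec F x‖ ^ (p - 1) := by
      intro x hx
      have e : vec g x = ((‖vec F x‖ ^ (p - 2) : ℝ) : ℂ) • vec (fun i x => (starRingEnd ℂ) (F i x)) x := by
        ext i
        simp only [vec_apply, g, indicator_of_mem hx, PiLp.smul_apply, smul_eq_mul, mul_comm]
      have e2 : ‖vec (fun i x => (starRingEnd ℂ) (F i x)) x‖ = ‖vec F x‖ := by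
        rw [← sq_eq_sq₀ (norm_nonneg _) (norm_nonneg _), norm_vec_sq, norm_vec_sq]
        simp
      rw [e, norm_smul, e2, Complex.norm_real, Real.norm_eq_abs,
        abs_of_nonneg (by positivity)]
      rcases (norm_nonneg (vec F x)).eq_or_lt with h0 | h0
      · rw [← h0, mul_zero, Real.zero_rpow (by linarith)]
      · rw [← Real.rpow_add_one h0.ne']; congr 1; ring
    have hgn0 : ∀ x, x ∉ S → ‖vec g x‖ = 0 := by
      intro x hx
      have := norm_vec_sq g x
      simpa [g, indicator_of_notMem hx] using this
    have hpow : ∀ x ∈ S, ‖vec g x‖ ≤ B' ^ (p - 1) := fun x hx => by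
      rw [hgn x hx]
      exact Real.rpow_le_rpow (norm_nonneg _) (hvB x) (by linarith)
    have hgt : ∀ i, TestFn (g i) (B' ^ (p - 1)) n := by
      intro i
      refine ⟨?_, fun x => ?_, fun x hx => ?_⟩
      · refine Measurable.indicator ?_ hSm
        have := hF i
        have h1 : Measurable fun x => ‖vec F x‖ := hvF.norm
        have h2 : Measurable fun x => (‖vec F x‖ ^ (p - 2)) := h1.pow_const _
        exact (Complex.continuous_conj.measurable.comp this).mul (Complex.measurable_ofReal.comp h2)
      · refine (norm_le_norm_vec g x i).trans ?_
        by_cases hx : x ∈ S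
        · exact hpow x hx
        · rw [hgn0 x hx]; positivity
      · exact indicator_of_notMem (fun hx' => by
          rw [hS, mem_Icc, ← abs_le] at hx'; linarith) _
    have hfin : ∫⁻ x in S, ‖vec F x‖ₑ ^ p ≠ ∞ := by
      refine ne_top_of_le_ne_top (b := ∫⁻ _ in S, ENNReal.ofReal B' ^ p) ?_
        (lintegral_mono fun x => ?_)
      · rw [setLIntegral_const]
        refine ENNReal.mul_ne_top (ENNReal.rpow_ne_top_of_nonneg hp.le ENNReal.ofReal_ne_top) ?_
        simp [hS]
      · rw [← ofReal_norm]
        exact ENNReal.rpow_le_rpow (ENNReal.ofReal_le_ofReal (hvB x)) hp.le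
    refine lintegral_le_of_le_mul_rpow hpq hfin ?_
    have hL : ∑ i, ∫ x, g i x * F i x = ((∫ x in S, ‖vec F x‖ ^ p : ℝ) : ℂ) := by
      rw [← integral_finsetSum, ← integral_indicator hSm, ← integral_complex_ofReal]
      · congr 1; ext x
        by_cases hx : x ∈ S
        · rw [indicator_of_mem hx]
          have : ∀ i, g i x * F i x = ((‖vec F x‖ ^ (p - 2) * ‖F i x‖ ^ 2 : ℝ) : ℂ) := by
            intro i
            simp only [g, indicator_of_mem hx]
            have := Complex.conj_mul' (F i x)
            push_cast
            rw [← this]; ring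
          simp_rw [this]
          rw [← Complex.ofReal_sum, ← Finset.mul_sum, ← norm_vec_sq]
          congr 1
          rcases (norm_nonneg (vec F x)).eq_or_lt with h0 | h0
          · rw [← h0, Real.zero_rpow hp.ne', zero_pow two_ne_zero, mul_zero]
          · rw [← Real.rpow_add_natCast h0.ne']; congr 1; push_cast; ring
        · rw [indicator_of_notMem hx]
          simp [g, indicator_of_notMem hx]
      · intro i _
        exact (hgt i).integrable.mul_bdd (hF i).aestronglyMeasurable (ae_of_all _ (hB i))
    have hInt : IntegrableOn (fun x => ‖vec F x‖ ^ p) S := by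
      refine Measure.integrableOn_of_bounded (M := B' ^ p) (by simp [hS])
        (hvF.norm.pow_const _).aestronglyMeasurable (ae_of_all _ fun x => ?_)
      rw [Real.norm_eq_abs, abs_of_nonneg (by positivity)]
      exact Real.rpow_le_rpow (norm_nonneg _) (hvB x) hp.le
    have hL2 : ‖∑ i, ∫ x, g i x * F i x‖ₑ = ∫⁻ x in S, ‖vec F x‖ₑ ^ p := by
      rw [hL, ← ofReal_norm, Complex.norm_real, Real.norm_eq_abs,
        abs_of_nonneg (integral_nonneg fun x => by positivity),
        ofReal_integral_eq_lintegral_ofReal hInt (ae_of_all _ fun x => by positivity)]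
      refine lintegral_congr fun x => ?_
      rw [← ofReal_norm, ENNReal.ofReal_rpow_of_nonneg (norm_nonneg _) hp.le]
    have hR : eLpNorm (vec g) (ENNReal.ofReal q) volume = (∫⁻ x in S, ‖vec F x‖ₑ ^ p) ^ (1 / q) := by
      rw [eLpNorm_eq_lintegral_rpow_enorm_toReal (by simpa using hq) ENNReal.ofReal_ne_top,
        ENNReal.toReal_ofReal hq.le, ← lintegral_indicator hSm]
      congr 1
      refine lintegral_congr fun x => ?_
      by_cases hx : x ∈ S
      · rw [indicator_of_mem hx, ← ofReal_norm, hgn x hx, ← ofReal_norm,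
          ENNReal.ofReal_rpow_of_nonneg (by positivity) hq.le,
          ENNReal.ofReal_rpow_of_nonneg (by positivity) hp.le, ← Real.rpow_mul (norm_nonneg _)]
        congr 2
        have := hpq.mul_eq_add
        linarith
      · rw [indicator_of_notMem hx, ← ofReal_norm, hgn0 x hx]
        simp [hq]
    have := h g _ _ hgt
    rwa [hL2, hR] at this
  rw [eLpNorm_eq_lintegral_rpow_enorm_toReal (by simpa using hp) ENNReal.ofReal_ne_top,
    ENNReal.toReal_ofReal hp.le]
  have hU : (⋃ n : ℕ, Icc (-(n : ℝ)) n) = univ := by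
    refine eq_univ_of_forall fun x => mem_iUnion.2 ?_
    obtain ⟨n, hn⟩ := exists_nat_ge |x|
    exact ⟨n, abs_le.1 hn⟩
  have hlim : ∫⁻ x, ‖vec F x‖ₑ ^ p ≤ K ^ p := by
    rw [← setLIntegral_univ, ← hU, setLIntegral_iUnion_of_directed]
    · exact iSup_le main
    · refine Monotone.directed_le fun m n hmn => Icc_subset_Icc ?_ ?_
      · exact neg_le_neg (by exact_mod_cast hmn)
      · exact_mod_cast hmn
  calc _ ≤ (K ^ p) ^ (1 / p) := ENNReal.rpow_le_rpow hlim (by positivity)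
    _ = K := by rw [← ENNReal.rpow_mul, mul_one_div_cancel hp.ne', ENNReal.rpow_one]

end dual

end

noncomputable section

set_option linter.unusedSectionVars false

section mulbdd

variable {ι : Type*} [Fintype ι]

/-- Integrable frequency data whose inverse Fourier transform lies in `L² ∩ L^p`. -/
structure Good (p : ℝ) (φ : ℝ → ℂ) : Prop where
  int : Integrable φ
  two : MemLp (invF φ) 2 volume
  lp : MemLp (invF φ) (ENNReal.ofReal p) volume

lemma Good.to_two {p : ℝ} {φ : ℝ → ℂ} (h : Good p φ) : Good 2 φ :=
  ⟨h.int, h.two, by simpa using h.two⟩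

lemma Good.measurable {p : ℝ} {φ : ℝ → ℂ} (h : Good p φ) : Measurable (invF φ) :=
  (continuous_invF h.int).measurable

/-- The family of multipliers `N` acts boundedly on `L^p(ℓ²)` with norm at most `C p`, for every
`1 < p < ∞`; the estimate is stated through the dual pairing. -/
structure MulBdd (C : ℝ → ℝ≥0) (N : ι → ℝ → ℂ) : Prop where
  measurable : ∀ i, Measurable (N i)
  bdd : ∃ B : ℝ, ∀ i ξ, ‖N i ξ‖ ≤ B
  form_le : ∀ {p q : ℝ}, p.HolderConjugate q → ∀ (φ g : ι → ℝ → ℂ) (M R : ℝ),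
    (∀ i, Good p (φ i)) → (∀ i, TestFn (g i) M R) →
    ‖∑ i, ∫ ξ, φ i ξ * N i ξ * invF (g i) ξ‖ₑ ≤
      C p * (eLpNorm (vec fun i => invF (φ i)) (ENNReal.ofReal p) volume *
        eLpNorm (vec g) (ENNReal.ofReal q) volume)

lemma eLpNorm_vec_mono {F G : ι → ℝ → ℂ} (h : ∀ i x, ‖F i x‖ ≤ ‖G i x‖) (p : ℝ≥0∞) :
    eLpNorm (vec F) p volume ≤ eLpNorm (vec G) p volume := by
  refine eLpNorm_mono fun x => (sq_le_sq₀ (norm_nonneg _) (norm_nonneg _)).1 ?_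
  rw [norm_vec_sq, norm_vec_sq]
  exact Finset.sum_le_sum fun i _ => by gcongr; exact h i x

lemma eLpNorm_vec_congr {F G : ι → ℝ → ℂ} (h : ∀ i x, ‖F i x‖ = ‖G i x‖) (p : ℝ≥0∞) :
    eLpNorm (vec F) p volume = eLpNorm (vec G) p volume :=
  le_antisymm (eLpNorm_vec_mono (fun i x => (h i x).le) p)
    (eLpNorm_vec_mono (fun i x => (h i x).ge) p)

lemma exists_bound {α : ι → ℝ} : ∃ B, ∀ i, α i ≤ B := by
  obtain ⟨B, hB⟩ := (Set.finite_range α).bddAbove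
  exact ⟨B, fun i => hB ⟨i, rfl⟩⟩

lemma exists_norm_invF_le (φ : ι → ℝ → ℂ) : ∃ B, ∀ i x, ‖invF (φ i) x‖ ≤ B := by
  obtain ⟨B, hB⟩ := exists_bound (α := fun i => ∫ ξ, ‖φ i ξ‖)
  exact ⟨B, fun i x => (norm_invF_le _ _).trans (hB i)⟩

namespace MulBdd

variable {C C' : ℝ → ℝ≥0} {N N' : ι → ℝ → ℂ}

lemma integrable (h : MulBdd C N) {φ : ι → ℝ → ℂ} (hφ : ∀ i, Integrable (φ i)) (i : ι) :
    Integrable (fun ξ => φ i ξ * N i ξ) := by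
  obtain ⟨B, hB⟩ := h.bdd
  exact (hφ i).mul_bdd (h.measurable i).aestronglyMeasurable (ae_of_all _ (hB i))

lemma integrable_form (h : MulBdd C N) {φ g : ι → ℝ → ℂ} (hφ : ∀ i, Integrable (φ i)) {M R : ℝ}
    (hg : ∀ i, TestFn (g i) M R) (i : ι) :
    Integrable (fun ξ => φ i ξ * N i ξ * invF (g i) ξ) :=
  (h.integrable hφ i).mul_bdd (continuous_invF (hg i).integrable).aestronglyMeasurable
    (ae_of_all _ (norm_invF_le _))

lemma norm_le_aux (h : MulBdd C N) {p q : ℝ} (hpq : p.HolderConjugate q) {φ : ι → ℝ → ℂ}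
    (hφ : ∀ i, Good p (φ i)) :
    eLpNorm (vec fun i => invF fun ξ => φ i ξ * N i ξ) (ENNReal.ofReal p) volume ≤
      C p * eLpNorm (vec fun i => invF (φ i)) (ENNReal.ofReal p) volume := by
  have hi := fun i => h.integrable (fun i => (hφ i).int) i
  obtain ⟨B, hB⟩ := exists_norm_invF_le (fun i ξ => φ i ξ * N i ξ)
  refine eLpNorm_vec_le_of_dual hpq (fun i => (continuous_invF (hi i)).measurable) hB
    fun g M R hg => ?_
  rw [mul_assoc]
  refine le_trans (le_of_eq ?_) (h.form_le hpq φ g M R hφ hg)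
  congr 1
  exact Finset.sum_congr rfl fun i _ => integral_mul_invF (hi i) (hg i).integrable

lemma memLp_aux (h : MulBdd C N) {p : ℝ} (hp : 1 < p) {φ : ι → ℝ → ℂ}
    (hφ : ∀ i, Good p (φ i)) (i : ι) :
    MemLp (invF fun ξ => φ i ξ * N i ξ) (ENNReal.ofReal p) volume := by
  have hi := fun i => h.integrable (fun i => (hφ i).int) i
  refine ⟨(continuous_invF (hi i)).aestronglyMeasurable, ?_⟩
  refine (eLpNorm_comp_le_vec (fun i => invF fun ξ => φ i ξ * N i ξ) _ i).trans_lt ?_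
  refine (h.norm_le_aux (Real.HolderConjugate.conjExponent hp) hφ).trans_lt ?_
  exact ENNReal.mul_lt_top (by simp)
    (memLp_vec (fun i => (hφ i).lp) fun i => (hφ i).measurable).2

lemma good (h : MulBdd C N) {p : ℝ} (hp : 1 < p) {φ : ι → ℝ → ℂ}
    (hφ : ∀ i, Good p (φ i)) (i : ι) : Good p (fun ξ => φ i ξ * N i ξ) := by
  refine ⟨h.integrable (fun i => (hφ i).int) i, ?_, h.memLp_aux hp hφ i⟩
  have := h.memLp_aux one_lt_two (fun i => (hφ i).to_two) i
  simpa using this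

lemma norm_le (h : MulBdd C N) {p : ℝ} (hp : 1 < p) {φ : ι → ℝ → ℂ} (hφ : ∀ i, Good p (φ i)) :
    eLpNorm (vec fun i => invF fun ξ => φ i ξ * N i ξ) (ENNReal.ofReal p) volume ≤
      C p * eLpNorm (vec fun i => invF (φ i)) (ENNReal.ofReal p) volume :=
  h.norm_le_aux (Real.HolderConjugate.conjExponent hp) hφ

lemma mono (h : MulBdd C N) (hC : ∀ p, C p ≤ C' p) : MulBdd C' N where
  measurable := h.measurable
  bdd := h.bdd
  form_le hpq φ g M R hφ hg := (h.form_le hpq φ g M R hφ hg).trans (by gcongr; exact hC _)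

lemma congr_ae (h : MulBdd C N) (hm : ∀ i, Measurable (N' i)) (hb : ∃ B : ℝ, ∀ i ξ, ‖N' i ξ‖ ≤ B)
    (he : ∀ i, N i =ᵐ[volume] N' i) : MulBdd C N' where
  measurable := hm
  bdd := hb
  form_le hpq φ g M R hφ hg := by
    refine le_trans (le_of_eq ?_) (h.form_le hpq φ g M R hφ hg)
    congr 1
    refine Finset.sum_congr rfl fun i _ => integral_congr_ae ?_
    filter_upwards [he i] with ξ hξ
    rw [hξ]

lemma const_mul (h : MulBdd C N) (c : ℂ) :
    MulBdd (fun p => ‖c‖₊ * C p) (fun i ξ => c * N i ξ) where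
  measurable i := (h.measurable i).const_mul c
  bdd := by
    obtain ⟨B, hB⟩ := h.bdd
    exact ⟨‖c‖ * B, fun i ξ => by rw [norm_mul]; gcongr; exact hB i ξ⟩
  form_le hpq φ g M R hφ hg := by
    have e : ∑ i, ∫ ξ, φ i ξ * (c * N i ξ) * invF (g i) ξ =
        c * ∑ i, ∫ ξ, φ i ξ * N i ξ * invF (g i) ξ := by
      rw [Finset.mul_sum]
      refine Finset.sum_congr rfl fun i _ => ?_
      rw [← integral_const_mul]
      congr 1; ext ξ; ring
    rw [e, enorm_mul, ENNReal.coe_mul, mul_assoc]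
    gcongr
    · exact le_rfl
    · exact h.form_le hpq φ g M R hφ hg

lemma add (h : MulBdd C N) (h' : MulBdd C' N') :
    MulBdd (fun p => C p + C' p) (fun i ξ => N i ξ + N' i ξ) where
  measurable i := (h.measurable i).add (h'.measurable i)
  bdd := by
    obtain ⟨B, hB⟩ := h.bdd
    obtain ⟨B', hB'⟩ := h'.bdd
    exact ⟨B + B', fun i ξ => (norm_add_le _ _).trans (add_le_add (hB i ξ) (hB' i ξ))⟩
  form_le hpq φ g M R hφ hg := by
    have e : ∑ i, ∫ ξ, φ i ξ * (N i ξ + N' i ξ) * invF (g i) ξ =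
        (∑ i, ∫ ξ, φ i ξ * N i ξ * invF (g i) ξ) + ∑ i, ∫ ξ, φ i ξ * N' i ξ * invF (g i) ξ := by
      rw [← Finset.sum_add_distrib]
      refine Finset.sum_congr rfl fun i _ => ?_
      rw [← integral_add (h.integrable_form (fun i => (hφ i).int) hg i)
        (h'.integrable_form (fun i => (hφ i).int) hg i)]
      congr 1; ext ξ; ring
    rw [e, ENNReal.coe_add, add_mul]
    exact (enorm_add_le _ _).trans (add_le_add (h.form_le hpq φ g M R hφ hg)
      (h'.form_le hpq φ g M R hφ hg))

lemma mul (h : MulBdd C N) (h' : MulBdd C' N') :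
    MulBdd (fun p => C' p * C p) (fun i ξ => N i ξ * N' i ξ) where
  measurable i := (h.measurable i).mul (h'.measurable i)
  bdd := by
    obtain ⟨B, hB⟩ := h.bdd
    obtain ⟨B', hB'⟩ := h'.bdd
    exact ⟨B * B', fun i ξ => by
      rw [norm_mul]
      exact mul_le_mul (hB i ξ) (hB' i ξ) (norm_nonneg _) ((norm_nonneg _).trans (hB i ξ))⟩
  form_le {p q} hpq φ g M R hφ hg := by
    have := h'.form_le hpq (fun i ξ => φ i ξ * N i ξ) g M R (fun i => h.good hpq.lt hφ i) hg
    simp_rw [← mul_assoc]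
    refine this.trans ?_
    rw [ENNReal.coe_mul, ← mul_assoc, mul_assoc (C' p : ℝ≥0∞) (C p)]
    gcongr
    exact h.norm_le hpq.lt hφ

lemma translate (h : MulBdd C N) (α : ι → ℝ) : MulBdd C (fun i ξ => N i (ξ - α i)) where
  measurable i := (h.measurable i).comp (measurable_id.sub_const _)
  bdd := by
    obtain ⟨B, hB⟩ := h.bdd
    exact ⟨B, fun i ξ => hB i _⟩
  form_le {p q} hpq φ g M R hφ hg := by
    have hn : ∀ i x, ‖invF (fun ξ => φ i (ξ + α i)) x‖ = ‖invF (φ i) x‖ := fun i x => by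
      rw [invF_translate, norm_mul, norm_eChar, one_mul]
    have hgood : ∀ i, Good p (fun ξ => φ i (ξ + α i)) := by
      intro i
      have hInt := (hφ i).int.comp_add_right (α i)
      have hm := (continuous_invF hInt).aestronglyMeasurable (μ := volume)
      exact ⟨hInt, (hφ i).two.of_le hm (ae_of_all _ fun x => (hn i x).le),
        (hφ i).lp.of_le hm (ae_of_all _ fun x => (hn i x).le)⟩
    have hgt : ∀ i, TestFn (fun x => g i x * eChar (α i) x) M R := fun i =>
      ⟨(hg i).measurable.mul (continuous_eChar_right _).measurable, fun x => by
        rw [norm_mul, norm_eChar, mul_one]; exact (hg i).bdd x, fun x hx => by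
        rw [(hg i).supp x hx, zero_mul]⟩
    have := h.form_le hpq _ _ M R hgood hgt
    rw [eLpNorm_vec_congr hn, eLpNorm_vec_congr (F := fun i x => g i x * eChar (α i) x) (G := g)
      (fun i x => by rw [norm_mul, norm_eChar, mul_one])] at this
    refine le_trans (le_of_eq ?_) this
    congr 1
    refine Finset.sum_congr rfl fun i _ => ?_
    rw [← integral_add_right_eq_self (fun ξ => φ i ξ * N i (ξ - α i) * invF (g i) ξ) (α i)]
    congr 1; ext ξ
    rw [add_sub_cancel_right]
    congr 1
    unfold invF
    congr 1; ext x
    rw [mul_assoc, eChar_comm (α i), ← eChar_add_right, add_comm]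

end MulBdd

open Filter Topology in
lemma tendsto_etaF_atTop : Tendsto etaF atTop (𝓝 0) := by
  have h := (Real.tendsto_pow_mul_exp_neg_atTop_nhds_zero 0).add
    (Real.tendsto_pow_mul_exp_neg_atTop_nhds_zero 1)
  simp only [pow_zero, pow_one, one_mul, add_zero] at h
  refine h.congr fun s => ?_
  unfold etaF; ring

open Filter Topology in
lemma tendsto_msym {ξ : ℝ} (hξ : ξ ≠ 0) :
    Tendsto (fun n : ℕ => msym (1 / ((n : ℝ) + 1)) ((n : ℝ) + 1) ξ) atTop (𝓝 (1 / 4)) := by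
  have hc : 0 < 4 * Real.pi * |ξ| := by positivity
  have h1 : Tendsto (fun n : ℕ => etaF (4 * Real.pi * |ξ| * (1 / ((n : ℝ) + 1)))) atTop (𝓝 1) := by
    have := (continuous_etaF.tendsto (4 * Real.pi * |ξ| * 0)).comp
      (tendsto_one_div_add_atTop_nhds_zero_nat.const_mul (4 * Real.pi * |ξ|))
    rw [mul_zero] at this
    have e : etaF 0 = 1 := by simp [etaF]
    rw [e] at this
    exact this
  have h2 : Tendsto (fun n : ℕ => etaF (4 * Real.pi * |ξ| * ((n : ℝ) + 1))) atTop (𝓝 0) := by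
    refine tendsto_etaF_atTop.comp (Tendsto.const_mul_atTop hc ?_)
    exact tendsto_atTop_add_const_right _ _ tendsto_natCast_atTop_atTop
  have := (h1.sub h2).div_const 4
  rw [sub_zero] at this
  exact this

/-- Norm bound for the Hilbert transform. -/
def hilC (p : ℝ) : ℝ≥0 := (4 * (embC p + embC (p / (p - 1)))).toNNReal

lemma mulBdd_sign : MulBdd hilC (fun (_ : ι) ξ => ((SignType.sign ξ : ℝ) : ℂ)) where
  measurable _ := by
    refine Complex.measurable_ofReal.comp ?_
    have : (fun ξ : ℝ => ((SignType.sign ξ : SignType) : ℝ)) = fun ξ =>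
        (Ioi (0 : ℝ)).indicator (fun _ => (1 : ℝ)) ξ - (Iio (0 : ℝ)).indicator (fun _ => (1 : ℝ)) ξ := by
      ext ξ
      rcases lt_trichotomy ξ 0 with h | h | h
      · simp [h, h.le]
      · simp [h]
      · simp [h, h.le]
    rw [this]
    exact (measurable_const.indicator measurableSet_Ioi).sub
      (measurable_const.indicator measurableSet_Iio)
  bdd := ⟨1, fun _ ξ => by
    rcases lt_trichotomy ξ 0 with h | h | h <;> simp [h]⟩
  form_le {p q} hpq φ g M R hφ hg := by
    open Filter Topology in
    have hInt := fun i => (hφ i).int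
    have hgi := fun i => (hg i).integrable
    obtain ⟨B, hB⟩ := exists_norm_invF_le φ
    have hvF := memLp_vec (fun i => (hφ i).lp) fun i => (hφ i).measurable
    have hvG := fun r => memLp_vec (p := r) (fun i => (hg i).memLp r) fun i => (hg i).measurable
    set σ : ℝ → ℂ := fun ξ => -Complex.I * (SignType.sign ξ : ℝ) with hσ
    have hσ1 : ∀ ξ, ‖σ ξ‖ ≤ 1 := fun ξ => by
      rcases lt_trichotomy ξ 0 with h | h | h <;> simp [hσ, h]
    have hn : ∀ n : ℕ, ‖∑ i, ∫ ξ, φ i ξ * (σ ξ * (msym (1 / ((n : ℝ) + 1)) ((n : ℝ) + 1) ξ : ℂ)) *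
        invF (g i) ξ‖ₑ ≤ ENNReal.ofReal (embC p + embC q) *
          (eLpNorm (vec fun i => invF (φ i)) (ENNReal.ofReal p) volume *
          eLpNorm (vec g) (ENNReal.ofReal q) volume) := by
      intro n
      refine (gradKernel_pkx.sum_pairing_le (f := vec fun i => invF (φ i)) (h := vec g) hInt hgi
        (δ := fun _ => 1 / ((n : ℝ) + 1)) (T := fun _ => (n : ℝ) + 1)
        (fun _ => by positivity) (fun _ => ?_) fun t x ht => ?_).trans ?_
      · rw [div_le_iff₀ (by positivity)]
        nlinarith [(Nat.cast_nonneg n : (0 : ℝ) ≤ n)]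
      · by_cases hm : t ∈ Ioc (1 / ((n : ℝ) + 1)) ((n : ℝ) + 1)
        · simp only [indicator_of_mem hm]
          exact sum_gradN_mul_le (fun i => (hφ i).measurable) hB (fun i => (hg i).measurable)
            (fun i => (hg i).bdd) ht x
        · simp only [indicator_of_notMem hm, Finset.sum_const_zero]
          exact mul_nonneg (gradN_nonneg _ _ _) (gradN_nonneg _ _ _)
      · refine gradPair_le hpq (measurable_vec fun i => (hφ i).measurable).stronglyMeasurable
          (measurable_vec fun i => (hg i).measurable).stronglyMeasurable
          (M := ∑ _i : ι, B) (N := ∑ _i : ι, M)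
          (fun y => (norm_vec_le_sum _ y).trans (Finset.sum_le_sum fun i _ => hB i y))
          (fun y => (norm_vec_le_sum _ y).trans (Finset.sum_le_sum fun i _ => (hg i).bdd y))
          (memLp_vec (fun i => (hφ i).two) fun i => (hφ i).measurable) (hvG 2) hvF (hvG _)
    have hlim : Tendsto (fun n : ℕ => ∑ i, ∫ ξ, φ i ξ *
        (σ ξ * (msym (1 / ((n : ℝ) + 1)) ((n : ℝ) + 1) ξ : ℂ)) * invF (g i) ξ) atTop
        (𝓝 (∑ i, ∫ ξ, φ i ξ * (σ ξ * ((1 / 4 : ℝ) : ℂ)) * invF (g i) ξ)) := by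
      refine tendsto_finsetSum _ fun i _ => ?_
      refine tendsto_integral_of_dominated_convergence
        (fun ξ => ‖φ i ξ‖ * (∫ x, ‖g i x‖)) (fun n => ?_) ((hInt i).norm.mul_const _)
        (fun n => ae_of_all _ fun ξ => ?_) ?_
      · have hσm : Measurable σ := gradKernel_pkx.measurable
        exact ((hInt i).aestronglyMeasurable.mul (hσm.aestronglyMeasurable.mul
          (Complex.continuous_ofReal.comp (continuous_msym _ _)).aestronglyMeasurable)).mul
          (continuous_invF (hgi i)).aestronglyMeasurable
      · rw [norm_mul, norm_mul, norm_mul, Complex.norm_real, Real.norm_eq_abs]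
        have := abs_msym_le (δ := 1 / ((n : ℝ) + 1)) (T := (n : ℝ) + 1) (by positivity)
          (by positivity) ξ
        have h2 : ‖σ ξ‖ * |msym (1 / ((n : ℝ) + 1)) ((n : ℝ) + 1) ξ| ≤ 1 :=
          mul_le_one₀ (hσ1 ξ) (abs_nonneg _) this
        have h3 := mul_le_of_le_one_right (norm_nonneg (φ i ξ)) h2
        exact mul_le_mul h3 (norm_invF_le _ _) (norm_nonneg _) (norm_nonneg _)
      · have : ∀ᵐ ξ : ℝ, ξ ≠ 0 := by simp [ae_iff]
        filter_upwards [this] with ξ hξ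
        have h1 := (Complex.continuous_ofReal.tendsto _).comp (tendsto_msym hξ)
        exact ((h1.const_mul (σ ξ)).const_mul (φ i ξ)).mul_const _
    have hle := le_of_tendsto hlim.enorm (Eventually.of_forall hn)
    have e : ∑ i, ∫ ξ, φ i ξ * ((SignType.sign ξ : ℝ) : ℂ) * invF (g i) ξ =
        (4 * Complex.I) * ∑ i, ∫ ξ, φ i ξ * (σ ξ * ((1 / 4 : ℝ) : ℂ)) * invF (g i) ξ := by
      rw [Finset.mul_sum]
      refine Finset.sum_congr rfl fun i _ => ?_
      rw [← integral_const_mul]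
      congr 1; ext ξ
      simp only [hσ]
      push_cast
      linear_combination (φ i ξ * ((SignType.sign ξ : ℝ) : ℂ) * invF (g i) ξ) * Complex.I_sq
    rw [e, enorm_mul]
    have hq : p / (p - 1) = q := hpq.conjugate_eq.symm
    have h4 : ‖(4 * Complex.I : ℂ)‖ₑ = ENNReal.ofReal 4 := by
      rw [← ofReal_norm]; simp
    rw [h4, hilC, hq, ← ENNReal.ofReal, ENNReal.ofReal_mul (by norm_num), mul_assoc]
    gcongr

end mulbdd

end

noncomputable section

set_option linter.unusedSectionVars false

section bvl

variable {ι : Type*} [Fintype ι]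

namespace MulBdd

variable {C C' : ℝ → ℝ≥0} {N N' : ι → ℝ → ℂ}

lemma diag_mul (h : MulBdd C N) {c : ι → ℂ} {V : ℝ≥0} (hc : ∀ i, ‖c i‖ ≤ V) :
    MulBdd (fun p => V * C p) (fun i ξ => c i * N i ξ) where
  measurable i := (h.measurable i).const_mul _
  bdd := by
    obtain ⟨B, hB⟩ := h.bdd
    exact ⟨V * B, fun i ξ => by
      rw [norm_mul]
      exact mul_le_mul (hc i) (hB i ξ) (norm_nonneg _) V.2⟩
  form_le {p q} hpq φ g M R hφ hg := by
    have hgt : ∀ i, TestFn (fun x => c i * g i x) (V * M) R := fun i =>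
      ⟨(hg i).measurable.const_mul _, fun x => by
        rw [norm_mul]
        exact mul_le_mul (hc i) ((hg i).bdd x) (norm_nonneg _) V.2, fun x hx => by
        rw [(hg i).supp x hx, mul_zero]⟩
    have := h.form_le hpq φ _ _ R hφ hgt
    have e : ∀ i ξ, φ i ξ * (c i * N i ξ) * invF (g i) ξ =
        φ i ξ * N i ξ * invF (fun x => c i * g i x) ξ := fun i ξ => by
      rw [invF_const_mul]; ring
    simp_rw [e]
    refine this.trans ?_
    have hV : eLpNorm (vec fun i x => c i * g i x) (ENNReal.ofReal q) volume ≤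
        V * eLpNorm (vec g) (ENNReal.ofReal q) volume := by
      have e1 : eLpNorm (((V : ℝ) : ℂ) • vec g) (ENNReal.ofReal q) volume =
          V * eLpNorm (vec g) (ENNReal.ofReal q) volume := by
        rw [eLpNorm_const_smul]; congr 1
        rw [← ofReal_norm, Complex.norm_real, Real.norm_eq_abs, abs_of_nonneg V.coe_nonneg]
        simp
      rw [← e1]
      have e2 : ((V : ℝ) : ℂ) • vec g = vec fun i x => ((V : ℝ) : ℂ) * g i x := rfl
      rw [e2]
      refine eLpNorm_vec_mono (fun i x => ?_) _
      rw [norm_mul, norm_mul, Complex.norm_real, Real.norm_eq_abs, abs_of_nonneg V.coe_nonneg]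
      gcongr
      exact hc i
    calc _ ≤ (C p : ℝ≥0∞) * (eLpNorm (vec fun i => invF (φ i)) (ENNReal.ofReal p) volume *
          (V * eLpNorm (vec g) (ENNReal.ofReal q) volume)) := by gcongr
      _ = _ := by rw [ENNReal.coe_mul]; ring

lemma average {n : ι → ℝ → ℝ → ℂ} (hm : ∀ i, Measurable (Function.uncurry (n i))) {B : ℝ}
    (hB : ∀ i, ∀ σ ∈ Ioc (0 : ℝ) 1, ∀ ξ, ‖n i σ ξ‖ ≤ B)
    (h : ∀ σ ∈ Ioc (0 : ℝ) 1, MulBdd C fun i => n i σ) :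
    MulBdd C fun i ξ => ∫ σ in Ioc (0 : ℝ) 1, n i σ ξ where
  measurable i :=
    (StronglyMeasurable.integral_prod_left
      (f := n i) (hm i).stronglyMeasurable).measurable
  bdd := by
    refine ⟨B, fun i ξ => ?_⟩
    refine (norm_setIntegral_le_of_norm_le_const (C := B) (by simp) fun σ hσ => hB i σ hσ ξ).trans ?_
    simp
  form_le {p q} hpq φ g M R hφ hg := by
    set μ : Measure ℝ := volume.restrict (Ioc (0 : ℝ) 1) with hμ
    have hInt : ∀ i, Integrable (fun z : ℝ × ℝ => φ i z.1 * n i z.2 z.1 * invF (g i) z.1)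
        (volume.prod μ) := by
      intro i
      have h1 : Integrable (fun ξ => φ i ξ * invF (g i) ξ) :=
        (hφ i).int.mul_bdd (continuous_invF (hg i).integrable).aestronglyMeasurable
          (ae_of_all _ (norm_invF_le _))
      have h2 : Integrable (fun z : ℝ × ℝ => φ i z.1 * invF (g i) z.1 * 1) (volume.prod μ) :=
        h1.mul_prod (integrable_const (1 : ℂ))
      have h3 := h2.mul_bdd (g := fun z : ℝ × ℝ => n i z.2 z.1) (c := B)
        ((hm i).comp measurable_swap).aestronglyMeasurable (by
          have : ∀ᵐ z ∂(volume : Measure ℝ).prod μ, z.2 ∈ Ioc (0 : ℝ) 1 :=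
            Measure.quasiMeasurePreserving_snd.ae (ae_restrict_mem measurableSet_Ioc)
          filter_upwards [this] with z hz using hB i _ hz _)
      refine h3.congr (ae_of_all _ fun z => ?_)
      ring
    have e : ∀ i, ∫ ξ, φ i ξ * (∫ σ, n i σ ξ ∂μ) * invF (g i) ξ =
        ∫ σ, (∫ ξ, φ i ξ * n i σ ξ * invF (g i) ξ) ∂μ := by
      intro i
      rw [← integral_integral_swap (f := fun ξ σ => φ i ξ * n i σ ξ * invF (g i) ξ) (hInt i)]
      congr 1; ext ξ
      rw [integral_mul_const, integral_const_mul]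
    simp_rw [e]
    rw [← integral_finsetSum _ fun i _ => (hInt i).integral_prod_right]
    refine (enorm_integral_le_lintegral_enorm _).trans ?_
    set K := (C p : ℝ≥0∞) * (eLpNorm (vec fun i => invF (φ i)) (ENNReal.ofReal p) volume *
        eLpNorm (vec g) (ENNReal.ofReal q) volume)
    calc _ ≤ ∫⁻ _, K ∂μ := by
          refine setLIntegral_mono' measurableSet_Ioc fun σ hσ => ?_
          exact (h σ hσ).form_le hpq φ g M R hφ hg
      _ = K := by simp [hμ]

end MulBdd

/-- Norm bound for sharp frequency cutoffs. -/
def intC (p : ℝ) : ℝ≥0 := 1 + hilC p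

lemma mulBdd_sign_sub (α β : ι → ℝ) : MulBdd intC (fun i ξ =>
    (1 / 2 : ℂ) * (((SignType.sign (ξ - α i) : ℝ) : ℂ) + -1 * ((SignType.sign (ξ - β i) : ℝ) : ℂ))) := by
  refine (((mulBdd_sign.translate α).add ((mulBdd_sign.translate β).const_mul (-1))).const_mul
    (1 / 2)).mono fun p => ?_
  rw [intC]
  have : ‖(1 / 2 : ℂ)‖₊ * (hilC p + ‖(-1 : ℂ)‖₊ * hilC p) = hilC p := by
    ext; push_cast; norm_num; ring
  rw [this]
  exact le_add_self

lemma mulBdd_Ico {α β : ι → ℝ} (h : ∀ i, α i ≤ β i) :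
    MulBdd intC (fun i => (Ico (α i) (β i)).indicator 1) := by
  refine (mulBdd_sign_sub α β).congr_ae (fun i => measurable_one.indicator measurableSet_Ico)
    ⟨1, fun i ξ => ?_⟩ fun i => ?_
  · refine (norm_indicator_le_norm_self _ _).trans (by simp)
  · have h1 : ∀ᵐ ξ : ℝ, ξ ≠ α i := by simp [ae_iff]
    have h2 : ∀ᵐ ξ : ℝ, ξ ≠ β i := by simp [ae_iff]
    filter_upwards [h1, h2] with ξ ha hb
    rcases lt_or_gt_of_ne ha with ha | ha
    · have hb : ξ < β i := ha.trans_le (h i)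
      rw [indicator_of_notMem (by simp [ha]), sign_neg (by linarith), sign_neg (by linarith)]
      simp
    · rcases lt_or_gt_of_ne hb with hb | hb
      · rw [indicator_of_mem (mem_Ico.2 ⟨ha.le, hb⟩), sign_pos (by linarith), sign_neg (by linarith)]
        simp; norm_num
      · rw [indicator_of_notMem (by simp [hb.le]), sign_pos (by linarith), sign_pos (by linarith)]
        simp

lemma eq_add_integral_of_hasDerivAt {α β ξ V : ℝ} {n d : ℝ → ℂ} (hd : Measurable d)
    (hn : ∀ s ∈ Icc α β, HasDerivAt n (d s) s) (hdV : ∀ s ∈ Icc α β, ‖d s‖ * (β - α) ≤ V)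
    (hξ : ξ ∈ Ico α β) :
    n ξ = n α + ∫ σ in Ioc (0 : ℝ) 1, ((β - α : ℝ) * d (α + σ * (β - α))) *
      (Ico (α + σ * (β - α)) β).indicator 1 ξ := by
  obtain ⟨h1, h2⟩ := hξ
  have hl : 0 < β - α := by linarith
  set τ := (ξ - α) / (β - α) with hτ
  have hτ0 : 0 ≤ τ := div_nonneg (by linarith) hl.le
  have hτ1 : τ ≤ 1 := (div_le_one hl).2 (by linarith)
  have hξτ : α + τ * (β - α) = ξ := by rw [hτ, div_mul_cancel₀ _ hl.ne']; ring
  have hmem : ∀ σ ∈ Icc (0 : ℝ) 1, α + σ * (β - α) ∈ Icc α β := fun σ hσ =>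
    ⟨by nlinarith [hσ.1], by nlinarith [hσ.2]⟩
  have hmeas : Measurable fun σ : ℝ => ((β - α : ℝ) : ℂ) * d (α + σ * (β - α)) :=
    (hd.comp (by fun_prop)).const_mul _
  have hFTC : ∫ σ in (0 : ℝ)..τ, ((β - α : ℝ) : ℂ) * d (α + σ * (β - α)) =
      n (α + τ * (β - α)) - n (α + 0 * (β - α)) := by
    refine intervalIntegral.integral_eq_sub_of_hasDerivAt
      (f := fun σ => n (α + σ * (β - α))) (fun σ hσ => ?_) ?_
    · rw [uIcc_of_le hτ0] at hσ
      have h3 : HasDerivAt (fun σ : ℝ => α + σ * (β - α)) (β - α) σ := by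
        simpa using ((hasDerivAt_id' σ).mul_const (β - α)).const_add α
      have := (hn _ (hmem σ ⟨hσ.1, hσ.2.trans hτ1⟩)).scomp σ h3
      simpa [Function.comp_def] using this
    · rw [intervalIntegrable_iff_integrableOn_Ioc_of_le hτ0]
      refine Measure.integrableOn_of_bounded (M := V) (by simp) hmeas.aestronglyMeasurable ?_
      filter_upwards [ae_restrict_mem measurableSet_Ioc] with σ hσ
      rw [norm_mul, Complex.norm_real, Real.norm_eq_abs, abs_of_pos hl, mul_comm]
      exact hdV _ (hmem σ ⟨hσ.1.le, hσ.2.trans hτ1⟩)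
  rw [hξτ, zero_mul, add_zero, intervalIntegral.integral_of_le hτ0] at hFTC
  have e : ∫ σ in Ioc (0 : ℝ) 1, ((β - α : ℝ) * d (α + σ * (β - α))) *
      (Ico (α + σ * (β - α)) β).indicator 1 ξ =
      ∫ σ in Ioc (0 : ℝ) τ, ((β - α : ℝ) : ℂ) * d (α + σ * (β - α)) := by
    have hs : Ioc (0 : ℝ) τ = Ioc 0 1 ∩ Iic τ := by
      ext σ; simp only [mem_Ioc, mem_inter_iff, mem_Iic]
      exact ⟨fun h => ⟨⟨h.1, h.2.trans hτ1⟩, h.2⟩, fun h => ⟨h.1.1, h.2⟩⟩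
    rw [hs, ← setIntegral_indicator measurableSet_Iic]
    congr 1; ext σ
    have hiff : α + σ * (β - α) ≤ ξ ↔ σ ≤ τ := by
      rw [hτ, le_div_iff₀ hl]; constructor <;> intro h <;> linarith
    by_cases hσ : σ ≤ τ
    · rw [indicator_of_mem (show σ ∈ Iic τ from hσ), indicator_of_mem (mem_Ico.2 ⟨hiff.2 hσ, h2⟩)]
      simp
    · rw [indicator_of_notMem (show σ ∉ Iic τ from hσ),
        indicator_of_notMem (fun h => hσ (hiff.1 h.1)), mul_zero]
  rw [e, hFTC]; ring

/-- Multipliers of bounded variation supported on intervals. -/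
theorem mulBdd_of_hasDerivAt {α β : ι → ℝ} (hαβ : ∀ i, α i ≤ β i) {n d : ι → ℝ → ℂ} {V : ℝ≥0}
    (hm : ∀ i, Measurable (n i)) (hd : ∀ i, Measurable (d i))
    (hn : ∀ i, ∀ s ∈ Icc (α i) (β i), HasDerivAt (n i) (d i s) s)
    (hnV : ∀ i, ∀ s ∈ Icc (α i) (β i), ‖n i s‖ ≤ V)
    (hdV : ∀ i, ∀ s ∈ Icc (α i) (β i), ‖d i s‖ * (β i - α i) ≤ V) :
    MulBdd (fun p => 2 * V * intC p) (fun i => (Ico (α i) (β i)).indicator (n i)) := by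
  have hmem : ∀ i, ∀ σ ∈ Icc (0 : ℝ) 1, α i + σ * (β i - α i) ∈ Icc (α i) (β i) := fun i σ hσ =>
    ⟨by nlinarith [hσ.1, hαβ i], by nlinarith [hσ.2, hαβ i]⟩
  have hc : ∀ i, ∀ σ ∈ Ioc (0 : ℝ) 1,
      ‖((β i - α i : ℝ) : ℂ) * d i (α i + σ * (β i - α i))‖ ≤ V := by
    intro i σ hσ
    rw [norm_mul, Complex.norm_real, Real.norm_eq_abs, abs_of_nonneg (sub_nonneg.2 (hαβ i)), mul_comm]
    exact hdV i _ (hmem i σ ⟨hσ.1.le, hσ.2⟩)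
  have h1 : MulBdd (fun p => V * intC p) (fun i ξ => ∫ σ in Ioc (0 : ℝ) 1,
      ((β i - α i : ℝ) * d i (α i + σ * (β i - α i))) *
        (Ico (α i + σ * (β i - α i)) (β i)).indicator 1 ξ) := by
    refine MulBdd.average (B := V) (fun i => ?_) (fun i σ hσ ξ => ?_) fun σ hσ => ?_
    · refine Measurable.mul ?_ ?_
      · exact ((hd i).comp (by fun_prop : Measurable fun z : ℝ × ℝ => α i + z.1 * (β i - α i))).const_mul _
      · have : MeasurableSet {z : ℝ × ℝ | α i + z.1 * (β i - α i) ≤ z.2 ∧ z.2 < β i} :=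
          (measurableSet_le (by fun_prop) measurable_snd).inter
            (measurableSet_lt measurable_snd measurable_const)
        exact measurable_one.indicator this
    · rw [norm_mul]
      refine mul_le_of_le_one_right (norm_nonneg _) ?_ |>.trans (hc i σ hσ)
      exact (norm_indicator_le_norm_self _ _).trans (by simp)
    · exact (mulBdd_Ico fun i => (hmem i σ ⟨hσ.1.le, hσ.2⟩).2).diag_mul fun i => hc i σ hσ
  have h2 := ((mulBdd_Ico hαβ).diag_mul (c := fun i => n i (α i)) fun i =>
    hnV i _ ⟨le_rfl, hαβ i⟩).add h1
  refine (h2.mono (C' := fun p => 2 * V * intC p) fun p => le_of_eq (by ring)).congr_ae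
    (fun i => (hm i).indicator measurableSet_Ico) ⟨V, fun i ξ => ?_⟩ fun i => ae_of_all _ fun ξ => ?_
  · by_cases hξ : ξ ∈ Ico (α i) (β i)
    · rw [indicator_of_mem hξ]
      exact hnV i ξ (Ico_subset_Icc_self hξ)
    · rw [indicator_of_notMem hξ, norm_zero]
      exact V.2
  · by_cases hξ : ξ ∈ Ico (α i) (β i)
    · simp only [indicator_of_mem hξ]
      rw [eq_add_integral_of_hasDerivAt (hd i) (hn i) (hdV i) hξ]
      simp
    · simp only [indicator_of_notMem hξ, mul_zero, zero_add]
      rw [← integral_zero ℝ ℂ (μ := volume.restrict (Ioc 0 1))]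
      refine setIntegral_congr_fun measurableSet_Ioc fun σ hσ => ?_
      have : ξ ∉ Ico (α i + σ * (β i - α i)) (β i) := fun h =>
        hξ ⟨(hmem i σ ⟨hσ.1.le, hσ.2⟩).1.trans h.1, h.2⟩
      simp only [indicator_of_notMem this, mul_zero]

end bvl

end

noncomputable section

set_option linter.unusedSectionVars false

lemma etaF_lt {s t : ℝ} (hs : 0 ≤ s) (hst : s < t) : etaF t < etaF s := by
  refine strictAntiOn_of_deriv_neg (convex_Ici 0) continuous_etaF.continuousOn (fun x hx => ?_)
    (mem_Ici.2 hs) (mem_Ici.2 (hs.trans hst.le)) hst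
  rw [interior_Ici] at hx
  rw [(hasDerivAt_etaF x).deriv, neg_mul]
  have := mem_Ioi.1 hx
  exact neg_neg_of_pos (by positivity)

/-- The profile of the Littlewood–Paley symbols on the positive half line. -/
def lpProf (ρ s : ℝ) : ℝ := (etaF (4 * Real.pi * s) - etaF (4 * Real.pi * ρ * s)) / 4

lemma lpProf_pos {ρ s : ℝ} (hρ : 1 < ρ) (hs : 0 < s) : 0 < lpProf ρ s := by
  have hpi := Real.pi_pos
  have h : 4 * Real.pi * s < 4 * Real.pi * ρ * s := by
    have : 4 * Real.pi * s * 1 < 4 * Real.pi * s * ρ := by gcongr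
    nlinarith
  have := etaF_lt (by positivity) h
  unfold lpProf
  linarith

/-- Derivative of `lpProf`. -/
def lpProf' (ρ s : ℝ) : ℝ :=
  (-(4 * Real.pi * s) * Real.exp (-(4 * Real.pi * s)) * (4 * Real.pi) -
    -(4 * Real.pi * ρ * s) * Real.exp (-(4 * Real.pi * ρ * s)) * (4 * Real.pi * ρ)) / 4

lemma hasDerivAt_lpProf (ρ s : ℝ) : HasDerivAt (lpProf ρ) (lpProf' ρ s) s := by
  have h1 : ∀ c : ℝ, HasDerivAt (fun s => etaF (c * s)) (-(c * s) * Real.exp (-(c * s)) * c) s := by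
    intro c
    have := (hasDerivAt_etaF (c * s)).comp s ((hasDerivAt_id' s).const_mul c)
    rw [mul_one] at this
    exact this
  exact ((h1 _).sub (h1 _)).div_const 4

lemma continuous_lpProf (ρ : ℝ) : Continuous (lpProf ρ) :=
  continuous_iff_continuousAt.2 fun s => (hasDerivAt_lpProf ρ s).continuousAt

lemma continuous_lpProf' (ρ : ℝ) : Continuous (lpProf' ρ) := by
  unfold lpProf'
  fun_prop

lemma msym_eq_lpProf {ρ A ε ξ : ℝ} (hA : 0 < A) (hε : |ε| = 1) (h : 0 ≤ ε * ξ / A) :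
    msym (1 / A) (ρ / A) ξ = lpProf ρ (ε * ξ / A) := by
  have e : |ξ| = ε * ξ := by
    have h1 : 0 ≤ ε * ξ := by
      have := mul_nonneg h hA.le
      rwa [div_mul_cancel₀ _ hA.ne'] at this
    rw [← abs_of_nonneg h1, abs_mul, hε, one_mul]
  unfold msym lpProf
  rw [e]
  congr 3 <;> ring

lemma exists_bound_inv_lpProf {ρ κ : ℝ} (hρ : 1 < ρ) (hκ : 1 ≤ κ) :
    ∃ V : ℝ≥0, ∀ s ∈ Icc κ⁻¹ κ, |(lpProf ρ s)⁻¹| ≤ V ∧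
      |-lpProf' ρ s / lpProf ρ s ^ 2| * κ ≤ V := by
  have hpos : ∀ s ∈ Icc κ⁻¹ κ, lpProf ρ s ≠ 0 := fun s hs =>
    (lpProf_pos hρ ((inv_pos.2 (by linarith)).trans_le hs.1)).ne'
  obtain ⟨V1, h1⟩ := isCompact_Icc.exists_bound_of_continuousOn
    ((continuous_lpProf ρ).continuousOn.inv₀ hpos)
  obtain ⟨V2, h2⟩ := isCompact_Icc.exists_bound_of_continuousOn
    (((continuous_lpProf' ρ).neg.continuousOn (s := Icc κ⁻¹ κ)).div
      ((continuous_lpProf ρ).continuousOn.pow 2) fun s hs => pow_ne_zero 2 (hpos s hs))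
  refine ⟨(max V1 (V2 * κ)).toNNReal, fun s hs => ⟨?_, ?_⟩⟩
  · exact (h1 s hs).trans ((le_max_left _ _).trans (Real.le_coe_toNNReal _))
  · refine le_trans ?_ ((le_max_right _ _).trans (Real.le_coe_toNNReal _))
    exact mul_le_mul_of_nonneg_right (h2 s hs) (by linarith)

/-- A family of intervals `[α i, β i)` on one side of the origin, comparable with the dyadic-like
frequencies `A i`, whose dual time windows are disjoint. -/
structure Lacunary {ι : Type} (ρ κ : ℝ) (A α β : ι → ℝ) : Prop where
  pos : ∀ i, 0 < A i
  le : ∀ i, α i ≤ β i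
  disj : ∀ i j, i ≠ j → Disjoint (Ioc (1 / A i) (ρ / A i)) (Ioc (1 / A j) (ρ / A j))
  mem : ∃ ε : ℝ, |ε| = 1 ∧ ∀ i, ∀ s ∈ Icc (α i) (β i), ε * s / A i ∈ Icc κ⁻¹ κ

lemma measurable_msym (δ T : ℝ) : Measurable fun ξ => (msym δ T ξ : ℂ) :=
  (Complex.continuous_ofReal.comp (continuous_msym δ T)).measurable

lemma exists_mulBdd_inv_msym {ρ κ : ℝ} (hρ : 1 < ρ) (hκ : 1 ≤ κ) :
    ∃ C : ℝ → ℝ≥0, ∀ (ι : Type) [Fintype ι] (A α β : ι → ℝ), Lacunary ρ κ A α β →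
      MulBdd C (fun i => (Ico (α i) (β i)).indicator
        fun ξ => (msym (1 / A i) (ρ / A i) ξ : ℂ)⁻¹) := by
  obtain ⟨V, hV⟩ := exists_bound_inv_lpProf hρ hκ
  have hκ0 : 0 < κ⁻¹ := inv_pos.2 (by linarith)
  refine ⟨fun p => 2 * V * intC p, fun ι _ A α β hL => ?_⟩
  obtain ⟨ε, hε, hmem⟩ := hL.mem
  have key := mulBdd_of_hasDerivAt hL.le (V := V)
    (n := fun i ξ => (((lpProf ρ (ε * ξ / A i))⁻¹ : ℝ) : ℂ))
    (d := fun i ξ => ((-lpProf' ρ (ε * ξ / A i) / lpProf ρ (ε * ξ / A i) ^ 2 * (ε / A i) : ℝ) : ℂ))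
    (fun i => ?_) (fun i => ?_) (fun i s hs => ?_) (fun i s hs => ?_) (fun i s hs => ?_)
  · refine key.congr_ae (fun i => (measurable_msym _ _).inv.indicator measurableSet_Ico)
      ⟨V, fun i ξ => ?_⟩ fun i => ae_of_all _ fun ξ => ?_
    · by_cases hξ : ξ ∈ Ico (α i) (β i)
      · have hm := hmem i ξ (Ico_subset_Icc_self hξ)
        rw [indicator_of_mem hξ, msym_eq_lpProf (hL.pos i) hε (hκ0.le.trans hm.1),
          ← Complex.ofReal_inv, Complex.norm_real]
        exact (hV _ hm).1
      · rw [indicator_of_notMem hξ, norm_zero]; exact V.coe_nonneg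
    · by_cases hξ : ξ ∈ Ico (α i) (β i)
      · have hm := hmem i ξ (Ico_subset_Icc_self hξ)
        simp only [indicator_of_mem hξ]
        rw [msym_eq_lpProf (hL.pos i) hε (hκ0.le.trans hm.1), Complex.ofReal_inv]
      · simp only [indicator_of_notMem hξ]
  · exact Complex.measurable_ofReal.comp
      (((continuous_lpProf ρ).measurable.comp (by fun_prop)).inv)
  · refine Complex.measurable_ofReal.comp (Measurable.mul_const (Measurable.div ?_ ?_) _)
    · exact ((continuous_lpProf' ρ).measurable.comp (by fun_prop)).neg
    · exact ((continuous_lpProf ρ).measurable.comp (by fun_prop)).pow_const 2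
  · have hm := hmem i s hs
    have h1 : HasDerivAt (fun ξ : ℝ => ε * ξ / A i) (ε / A i) s := by
      simpa using ((hasDerivAt_id' s).const_mul ε).div_const (A i)
    have h2 := ((hasDerivAt_lpProf ρ (ε * s / A i)).inv
      (lpProf_pos hρ (hκ0.trans_le hm.1)).ne').comp s h1
    exact h2.ofReal_comp
  · rw [Complex.norm_real]
    exact (hV _ (hmem i s hs)).1
  · have hm := hmem i s hs
    have hA := hL.pos i
    have ha := hmem i _ ⟨le_rfl, hL.le i⟩
    have hb := hmem i _ ⟨hL.le i, le_rfl⟩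
    have hlen : (β i - α i) / A i ≤ κ := by
      have h1 : (β i - α i) / A i = |ε * β i / A i - ε * α i / A i| := by
        rw [← sub_div, ← mul_sub, abs_div, abs_mul, hε, one_mul, abs_of_pos hA,
          abs_of_nonneg (sub_nonneg.2 (hL.le i))]
      rw [h1, abs_le]
      constructor <;> linarith [ha.1, ha.2, hb.1, hb.2]
    refine le_trans (le_of_eq ?_) ((mul_le_mul_of_nonneg_left hlen (abs_nonneg _)).trans (hV _ hm).2)
    rw [Complex.norm_real, Real.norm_eq_abs, abs_mul, abs_div ε, hε, abs_of_pos hA]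
    ring

section LP

variable {ι : Type} [Fintype ι]

lemma eLpNorm_vec_unit (F : ℝ → ℂ) (p : ℝ≥0∞) :
    eLpNorm (vec fun _ : Unit => F) p volume = eLpNorm F p volume := by
  refine eLpNorm_congr_norm_ae (ae_of_all _ fun x => ?_)
  rw [← sq_eq_sq₀ (norm_nonneg _) (norm_nonneg _), norm_vec_sq]
  simp

lemma sum_indicator_le_of_disjoint {S : ι → Set ℝ} (hS : ∀ i j, i ≠ j → Disjoint (S i) (S j))
    {u : ι → ℝ → ℝ} {b t : ℝ} (hb : 0 ≤ b) (hu : ∀ i, u i t ≤ b) :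
    ∑ i, (S i).indicator (u i) t ≤ b := by
  classical
  by_cases h : ∃ i, t ∈ S i
  · obtain ⟨i, hi⟩ := h
    rw [Finset.sum_eq_single i, indicator_of_mem hi]
    · exact hu i
    · exact fun j _ hj => indicator_of_notMem (fun hj' => disjoint_left.1 (hS j i hj) hj' hi) _
    · simp
  · push Not at h
    rw [Finset.sum_eq_zero fun i _ => indicator_of_notMem (h i) _]
    exact hb

/-- Norm bound for smooth Littlewood–Paley decompositions. -/
def lpC (p : ℝ) : ℝ≥0 := (embC p + embC (p / (p - 1))).toNNReal

lemma lpC_eq {p q : ℝ} (hpq : p.HolderConjugate q) :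
    (lpC p : ℝ≥0∞) = ENNReal.ofReal (embC p + embC q) := by
  rw [lpC, ← hpq.conjugate_eq]; rfl

namespace Lacunary

variable {ρ κ : ℝ} {A α β : ι → ℝ}

lemma smooth_forward_form (hL : Lacunary ρ κ A α β) (hρ : 1 < ρ) {p q : ℝ}
    (hpq : p.HolderConjugate q) {φ : ℝ → ℂ} (hφ : Good p φ) {g : ι → ℝ → ℂ} {M R : ℝ}
    (hg : ∀ i, TestFn (g i) M R) :
    ‖∑ i, ∫ ξ, φ ξ * (msym (1 / A i) (ρ / A i) ξ : ℂ) * invF (g i) ξ‖ₑ ≤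
      lpC p * (eLpNorm (invF φ) (ENNReal.ofReal p) volume *
        eLpNorm (vec g) (ENNReal.ofReal q) volume) := by
  have hgv := fun r => memLp_vec (p := r) (fun i => (hg i).memLp r) fun i => (hg i).measurable
  have h1 := gradKernel_pkt.sum_pairing_le (φ := fun _ => φ) (g := g) (f := invF φ) (h := vec g)
    (fun _ => hφ.int) (fun i => (hg i).integrable) (δ := fun i => 1 / A i) (T := fun i => ρ / A i)
    (fun i => by have := hL.pos i; positivity)
    (fun i => by have := hL.pos i; gcongr)
    (fun t x ht => sum_indicator_le_of_disjoint hL.disj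
      (u := fun i t => gradN (invF φ) t x * gradN (g i) t x)
      (mul_nonneg (gradN_nonneg _ _ _) (gradN_nonneg _ _ _))
      fun i => mul_le_mul_of_nonneg_left (gradN_le_vec (fun i => (hg i).measurable)
        (fun i => (hg i).bdd) ht x i) (gradN_nonneg _ _ _))
  simp only [one_mul] at h1
  refine h1.trans ?_
  rw [lpC_eq hpq]
  exact gradPair_le hpq hφ.measurable.stronglyMeasurable
    (measurable_vec fun i => (hg i).measurable).stronglyMeasurable (norm_invF_le _)
    (fun y => (norm_vec_le_sum _ y).trans (Finset.sum_le_sum fun i _ => (hg i).bdd y))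
    hφ.two (hgv 2) hφ.lp (hgv _)

lemma integrable_mul_msym (hL : Lacunary ρ κ A α β) (hρ : 1 < ρ) {φ : ℝ → ℂ}
    (hφ : Integrable φ) (i : ι) :
    Integrable fun ξ => φ ξ * (msym (1 / A i) (ρ / A i) ξ : ℂ) := by
  refine hφ.mul_bdd (measurable_msym _ _).aestronglyMeasurable (c := 1) (ae_of_all _ fun ξ => ?_)
  have := hL.pos i
  rw [Complex.norm_real]
  exact abs_msym_le (by positivity) (by positivity) ξ

lemma smooth_forward (hL : Lacunary ρ κ A α β) (hρ : 1 < ρ) {p : ℝ} (hp : 1 < p)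
    {φ : ℝ → ℂ} (hφ : Good p φ) :
    eLpNorm (vec fun i => invF fun ξ => φ ξ * (msym (1 / A i) (ρ / A i) ξ : ℂ))
      (ENNReal.ofReal p) volume ≤ lpC p * eLpNorm (invF φ) (ENNReal.ofReal p) volume := by
  have hi := fun i => hL.integrable_mul_msym hρ hφ.int i
  obtain ⟨B, hB⟩ := exists_norm_invF_le fun i ξ => φ ξ * (msym (1 / A i) (ρ / A i) ξ : ℂ)
  have hpq := Real.HolderConjugate.conjExponent hp
  refine eLpNorm_vec_le_of_dual hpq (fun i => (continuous_invF (hi i)).measurable)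
    hB fun g M R hg => ?_
  rw [mul_assoc]
  refine le_trans (le_of_eq ?_) (hL.smooth_forward_form hρ hpq hφ hg)
  congr 1
  exact Finset.sum_congr rfl fun i _ => integral_mul_invF (hi i) (hg i).integrable

lemma good_smooth (hL : Lacunary ρ κ A α β) (hρ : 1 < ρ) {p : ℝ} (hp : 1 < p)
    {φ : ℝ → ℂ} (hφ : Good p φ) (i : ι) :
    Good p fun ξ => φ ξ * (msym (1 / A i) (ρ / A i) ξ : ℂ) := by
  have hi := fun i => hL.integrable_mul_msym hρ hφ.int i
  have key : ∀ {r : ℝ}, 1 < r → Good r φ →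
      MemLp (invF fun ξ => φ ξ * (msym (1 / A i) (ρ / A i) ξ : ℂ)) (ENNReal.ofReal r) volume := by
    intro r hr h
    refine ⟨(continuous_invF (hi i)).aestronglyMeasurable, ?_⟩
    refine (eLpNorm_comp_le_vec (fun i => invF fun ξ => φ ξ * (msym (1 / A i) (ρ / A i) ξ : ℂ))
      _ i).trans_lt ((hL.smooth_forward hρ hr h).trans_lt ?_)
    exact ENNReal.mul_lt_top (by simp) h.lp.2
  exact ⟨hi i, by simpa using key one_lt_two hφ.to_two, key hp hφ⟩

lemma smooth_reverse (hL : Lacunary ρ κ A α β) (hρ : 1 < ρ) {p : ℝ} (hp : 1 < p)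
    {φ : ι → ℝ → ℂ} (hφ : ∀ i, Good p (φ i)) :
    eLpNorm (invF fun ξ => ∑ i, φ i ξ * (msym (1 / A i) (ρ / A i) ξ : ℂ))
      (ENNReal.ofReal p) volume ≤
      lpC p * eLpNorm (vec fun i => invF (φ i)) (ENNReal.ofReal p) volume := by
  have hpq := Real.HolderConjugate.conjExponent hp
  have hi := fun i => hL.integrable_mul_msym hρ (hφ i).int i
  have hs : Integrable fun ξ => ∑ i, φ i ξ * (msym (1 / A i) (ρ / A i) ξ : ℂ) :=
    integrable_finsetSum _ fun i _ => hi i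
  obtain ⟨B, hB⟩ := exists_norm_invF_le φ
  rw [← eLpNorm_vec_unit]
  refine eLpNorm_vec_le_of_dual hpq (fun _ => (continuous_invF hs).measurable)
    (fun _ => norm_invF_le _) fun g M R hg => ?_
  have hg := hg ()
  have e : vec g = vec fun _ : Unit => g () := rfl
  rw [e, eLpNorm_vec_unit, mul_assoc]
  have h1 := gradKernel_pkt.sum_pairing_le (φ := φ) (g := fun _ => g ())
    (f := vec fun i => invF (φ i)) (h := g ())
    (fun i => (hφ i).int) (fun i => hg.integrable) (δ := fun i => 1 / A i) (T := fun i => ρ / A i)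
    (fun i => by have := hL.pos i; positivity)
    (fun i => by have := hL.pos i; gcongr)
    (fun t x ht => sum_indicator_le_of_disjoint hL.disj
      (u := fun i t => gradN (invF (φ i)) t x * gradN (g ()) t x)
      (mul_nonneg (gradN_nonneg _ _ _) (gradN_nonneg _ _ _))
      fun i => mul_le_mul_of_nonneg_right (gradN_le_vec (fun i => (hφ i).measurable)
        hB ht x i) (gradN_nonneg _ _ _))
  simp only [one_mul] at h1
  refine le_trans (le_of_eq ?_) (h1.trans ?_)
  · congr 1
    rw [Fintype.sum_unique]
    change ∫ x, g () x * invF _ x = _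
    rw [integral_mul_invF hs hg.integrable, ← integral_finsetSum]
    · congr 1; ext ξ
      rw [Finset.sum_mul]
    · exact fun i _ => (hi i).mul_bdd (continuous_invF hg.integrable).aestronglyMeasurable
        (ae_of_all _ (norm_invF_le _))
  · rw [lpC_eq hpq]
    exact gradPair_le hpq (measurable_vec fun i => (hφ i).measurable).stronglyMeasurable
      hg.measurable.stronglyMeasurable
      (fun y => (norm_vec_le_sum _ y).trans (Finset.sum_le_sum fun i _ => hB i y)) hg.bdd
      (memLp_vec (fun i => (hφ i).two) fun i => (hφ i).measurable) (hg.memLp 2)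
      (memLp_vec (fun i => (hφ i).lp) fun i => (hφ i).measurable) (hg.memLp _)

lemma msym_ne_zero (hL : Lacunary ρ κ A α β) (hρ : 1 < ρ) (hκ : 1 ≤ κ) {i : ι} {ξ : ℝ}
    (hξ : ξ ∈ Ico (α i) (β i)) : (msym (1 / A i) (ρ / A i) ξ : ℂ) ≠ 0 := by
  obtain ⟨ε, hε, hmem⟩ := hL.mem
  have hm := hmem i ξ (Ico_subset_Icc_self hξ)
  have h0 : 0 < ε * ξ / A i := (inv_pos.2 (by linarith)).trans_le hm.1
  rw [msym_eq_lpProf (hL.pos i) hε h0.le]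
  exact Complex.ofReal_ne_zero.2 (lpProf_pos hρ h0).ne'

end Lacunary

end LP

/-- The Littlewood–Paley inequality for lacunary intervals. -/
theorem exists_lp_forward {ρ κ : ℝ} (hρ : 1 < ρ) (hκ : 1 ≤ κ) :
    ∃ C : ℝ → ℝ≥0, ∀ (ι : Type) [Fintype ι] (A α β : ι → ℝ), Lacunary ρ κ A α β →
      ∀ {p : ℝ}, 1 < p → ∀ φ : ℝ → ℂ, Good p φ →
        (∀ i, Good p ((Ico (α i) (β i)).indicator φ)) ∧
        eLpNorm (vec fun i => invF ((Ico (α i) (β i)).indicator φ)) (ENNReal.ofReal p) volume ≤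
          C p * eLpNorm (invF φ) (ENNReal.ofReal p) volume := by
  obtain ⟨C, hC⟩ := exists_mulBdd_inv_msym hρ hκ
  refine ⟨fun p => C p * lpC p, fun ι _ A α β hL p hp φ hφ => ?_⟩
  have hM := hC ι A α β hL
  have hG := hL.good_smooth hρ hp hφ
  have e : ∀ i, (Ico (α i) (β i)).indicator φ = fun ξ => φ ξ * (msym (1 / A i) (ρ / A i) ξ : ℂ) *
      (Ico (α i) (β i)).indicator (fun ξ => (msym (1 / A i) (ρ / A i) ξ : ℂ)⁻¹) ξ := by
    intro i
    ext ξ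
    by_cases hξ : ξ ∈ Ico (α i) (β i)
    · rw [indicator_of_mem hξ, indicator_of_mem hξ,
        mul_inv_cancel_right₀ (hL.msym_ne_zero hρ hκ hξ)]
    · rw [indicator_of_notMem hξ, indicator_of_notMem hξ, mul_zero]
  simp_rw [e]
  refine ⟨fun i => hM.good hp hG i, ?_⟩
  refine (hM.norm_le hp hG).trans ?_
  rw [ENNReal.coe_mul, mul_assoc]
  gcongr
  exact hL.smooth_forward hρ hp hφ

/-- The dual Littlewood–Paley inequality for functions with lacunary frequency supports. -/
theorem exists_lp_reverse {ρ κ : ℝ} (hρ : 1 < ρ) (hκ : 1 ≤ κ) :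
    ∃ C : ℝ → ℝ≥0, ∀ (ι : Type) [Fintype ι] (A α β : ι → ℝ), Lacunary ρ κ A α β →
      ∀ {p : ℝ}, 1 < p → ∀ χ : ι → ℝ → ℂ, (∀ i, Good p (χ i)) →
        (∀ i, ∀ ξ ∉ Ico (α i) (β i), χ i ξ = 0) →
        eLpNorm (invF fun ξ => ∑ i, χ i ξ) (ENNReal.ofReal p) volume ≤
          C p * eLpNorm (vec fun i => invF (χ i)) (ENNReal.ofReal p) volume := by
  obtain ⟨C, hC⟩ := exists_mulBdd_inv_msym hρ hκ
  refine ⟨fun p => lpC p * C p, fun ι _ A α β hL p hp χ hχ hs => ?_⟩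
  have hM := hC ι A α β hL
  have hG := hM.good hp hχ
  have e : ∀ i ξ, χ i ξ = χ i ξ *
      (Ico (α i) (β i)).indicator (fun ξ => (msym (1 / A i) (ρ / A i) ξ : ℂ)⁻¹) ξ *
        (msym (1 / A i) (ρ / A i) ξ : ℂ) := by
    intro i ξ
    by_cases hξ : ξ ∈ Ico (α i) (β i)
    · rw [indicator_of_mem hξ, inv_mul_cancel_right₀ (hL.msym_ne_zero hρ hκ hξ)]
    · rw [hs i ξ hξ, zero_mul, zero_mul]
  have e2 : (fun ξ => ∑ i, χ i ξ) = fun ξ => ∑ i, χ i ξ *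
      (Ico (α i) (β i)).indicator (fun ξ => (msym (1 / A i) (ρ / A i) ξ : ℂ)⁻¹) ξ *
        (msym (1 / A i) (ρ / A i) ξ : ℂ) := by
    ext ξ; exact Finset.sum_congr rfl fun i _ => e i ξ
  rw [e2]
  refine (hL.smooth_reverse hρ hp hG).trans ?_
  rw [ENNReal.coe_mul, mul_assoc]
  gcongr
  exact hM.norm_le hp hχ

end

noncomputable section

lemma add_rpow_le_real {a b q : ℝ} (ha : 0 ≤ a) (hb : 0 ≤ b) (hq : 1 < q) :
    (a + b) ^ q ≤ a ^ q + q * 2 ^ q * (b ^ q + b * a ^ (q - 1)) := by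
  have h2 : (0 : ℝ) ≤ 2 ^ q := by positivity
  rcases le_total a b with h | h
  · have h1 : (a + b) ^ q ≤ 2 ^ q * b ^ q := by
      rw [← Real.mul_rpow (by norm_num) hb]
      exact Real.rpow_le_rpow (by positivity) (by linarith) (by linarith)
    have h3 : 0 ≤ b ^ q := by positivity
    have h4 : 0 ≤ a ^ q := by positivity
    have h5 : 0 ≤ b * a ^ (q - 1) := by positivity
    have h6 : 2 ^ q * b ^ q ≤ q * 2 ^ q * b ^ q := by
      rw [mul_assoc]; exact le_mul_of_one_le_left (by positivity) hq.le
    have h7 : 0 ≤ q * 2 ^ q * (b * a ^ (q - 1)) := by positivity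
    rw [mul_add]; linarith
  · rcases ha.eq_or_lt with rfl | ha
    · have : b = 0 := le_antisymm h hb
      subst this
      rw [add_zero, Real.zero_rpow (by linarith)]
      positivity
    have hs : 0 < a + b := by linarith
    have hB := one_add_mul_self_le_rpow_one_add (s := -(b / (a + b))) (p := q)
      (by rw [neg_le_neg_iff, div_le_one hs]; linarith) hq.le
    have e1 : 1 + -(b / (a + b)) = a / (a + b) := by field_simp; ring
    rw [e1, Real.div_rpow ha.le hs.le, le_div_iff₀ (by positivity)] at hB
    have e2 : (a + b) ^ q = (a + b) ^ (q - 1) * (a + b) := by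
      rw [← Real.rpow_add_one hs.ne']; simp
    have e3 : (1 + q * -(b / (a + b))) * (a + b) ^ q
        = (a + b) ^ q - q * b * (a + b) ^ (q - 1) := by
      rw [e2]; field_simp; ring
    rw [e3] at hB
    have h1 : (a + b) ^ (q - 1) ≤ 2 ^ q * a ^ (q - 1) := by
      calc (a + b) ^ (q - 1) ≤ (2 * a) ^ (q - 1) :=
            Real.rpow_le_rpow hs.le (by linarith) (by linarith)
        _ = 2 ^ (q - 1) * a ^ (q - 1) := Real.mul_rpow (by norm_num) ha.le
        _ ≤ _ := by
            gcongr
            · norm_num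
            · linarith
    have h3 : 0 ≤ q * 2 ^ q * b ^ q := by positivity
    have h4 : q * b * (a + b) ^ (q - 1) ≤ q * b * (2 ^ q * a ^ (q - 1)) := by gcongr
    have h5 : q * 2 ^ q * (b ^ q + b * a ^ (q - 1))
      = q * 2 ^ q * b ^ q + q * b * (2 ^ q * a ^ (q - 1)) := by ring
    linarith

lemma ENNReal.add_rpow_le_add_mul (a b : ℝ≥0∞) {q : ℝ} (hq : 1 < q) :
    (a + b) ^ q ≤ a ^ q + ENNReal.ofReal (q * 2 ^ q) * (b ^ q + b * a ^ (q - 1)) := by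
  have hK : ENNReal.ofReal (q * 2 ^ q) ≠ 0 := by
    rw [ne_eq, ENNReal.ofReal_eq_zero, not_le]; positivity
  have hq0 : 0 < q := by linarith
  by_cases ha : a = ∞
  · simp [ha, hq0]
  by_cases hb : b = ∞
  · simp [hb, hq0, ENNReal.mul_top hK]
  have h := add_rpow_le_real (a := a.toReal) (b := b.toReal) (by simp) (by simp) hq
  lift a to ℝ≥0 using ha
  lift b to ℝ≥0 using hb
  have := ENNReal.ofReal_le_ofReal h
  rw [ENNReal.ofReal_add (by positivity) (by positivity), ENNReal.ofReal_mul (by positivity),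
    ENNReal.ofReal_add (by positivity) (by positivity),
    ENNReal.ofReal_mul (p := (ENNReal.toReal b)) (by positivity),
    ← ENNReal.ofReal_rpow_of_nonneg (by positivity) (by linarith),
    ← ENNReal.ofReal_rpow_of_nonneg (by positivity) (by linarith),
    ← ENNReal.ofReal_rpow_of_nonneg (by positivity) (by linarith),
    ← ENNReal.ofReal_rpow_of_nonneg (by positivity) (by linarith),
    ENNReal.ofReal_add (by positivity) (by positivity)] at this
  simpa using this

/-- The two-sided exponential probability kernel. -/
def ek (c x : ℝ) : ℝ := c / 2 * Real.exp (-c * |x|)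

lemma continuous_ek (c : ℝ) : Continuous (ek c) := by unfold ek; fun_prop

lemma ek_nonneg {c : ℝ} (hc : 0 < c) (x : ℝ) : 0 ≤ ek c x := by unfold ek; positivity

lemma integrable_ek {c : ℝ} (hc : 0 < c) : Integrable (ek c) := by
  have := (integrable_exp_neg_mul_abs hc).re.const_mul (c / 2)
  refine this.congr (ae_of_all _ fun x => ?_)
  simp only [ek, RCLike.re_eq_complex_re, Complex.ofReal_re]

lemma invF_ek {c : ℝ} (hc : 0 < c) (ξ : ℝ) :
    invF (fun x => (ek c x : ℂ)) ξ = ((c ^ 2 / (c ^ 2 + (2 * Real.pi * ξ) ^ 2) : ℝ) : ℂ) := by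
  have e : (fun x => (ek c x : ℂ)) = fun x => ((c / 2 : ℝ) : ℂ) * (Real.exp (-c * |x|) : ℂ) := by
    ext x; simp [ek]
  rw [e, invF_const_mul]
  beta_reduce
  rw [invF_exp_neg_mul_abs hc, ← Complex.ofReal_mul]
  congr 1; ring

lemma lintegral_ek {c : ℝ} (hc : 0 < c) : ∫⁻ x, ENNReal.ofReal (ek c x) = 1 := by
  rw [← ofReal_integral_eq_lintegral_ofReal (integrable_ek hc) (ae_of_all _ (ek_nonneg hc))]
  have h := invF_ek hc 0
  simp only [invF, eChar_comm _ 0, eChar_zero_left, mul_one] at h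
  rw [integral_complex_ofReal] at h
  have := Complex.ofReal_injective h
  rw [this]
  simp [hc.ne']

/-- Convolution with the two-sided exponential kernel, for nonnegative functions. -/
def expAv (c : ℝ) (h : ℝ → ℝ≥0∞) (x : ℝ) : ℝ≥0∞ := ∫⁻ y, ENNReal.ofReal (ek c (x - y)) * h y

lemma measurable_expAv {c : ℝ} {h : ℝ → ℝ≥0∞} (hh : Measurable h) : Measurable (expAv c h) := by
  refine Measurable.lintegral_prod_right'
    (f := fun z : ℝ × ℝ => ENNReal.ofReal (ek c (z.1 - z.2)) * h z.2) ?_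
  have := (continuous_ek c).measurable
  fun_prop

lemma measurable_sup_expAv (c : ℕ → ℝ) {G : ℝ → ℝ≥0∞} (hG : Measurable G) (s : Finset ℕ) :
    Measurable fun x => s.sup fun k => expAv (c k) G x := by
  simp_rw [Finset.sup_eq_iSup]
  exact .iSup fun k => .iSup fun _ => measurable_expAv hG

lemma expAv_le_of_ek_le {c c' C : ℝ} (hC : 0 ≤ C) (h : ℝ → ℝ≥0∞) (hh : Measurable h) (x x' : ℝ)
    (hk : ∀ y, ek c (x - y) ≤ C * ek c' (x' - y)) :
    expAv c h x ≤ ENNReal.ofReal C * expAv c' h x' := by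
  unfold expAv
  have := (continuous_ek c').measurable
  rw [← lintegral_const_mul _ (by fun_prop)]
  refine lintegral_mono fun y => ?_
  rw [← mul_assoc, ← ENNReal.ofReal_mul hC]
  gcongr
  exact hk y

lemma expAv_shift {c : ℝ} (hc : 0 < c) {h : ℝ → ℝ≥0∞} (hh : Measurable h) (x x' : ℝ) :
    expAv c h x' ≤ ENNReal.ofReal (Real.exp (c * |x' - x|)) * expAv c h x := by
  refine expAv_le_of_ek_le (Real.exp_pos _).le h hh x' x fun y => ?_
  unfold ek
  rw [mul_left_comm, ← Real.exp_add]
  gcongr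
  have : |x - y| ≤ |x' - x| + |x' - y| := by
    rw [abs_sub_comm x' x]; exact abs_sub_le x x' y
  nlinarith

lemma expAv_le_of_scale {c c' l : ℝ} (hc : 0 < c) (h1 : c ≤ c') (h2 : c' ≤ l * c)
    {h : ℝ → ℝ≥0∞} (hh : Measurable h) (x : ℝ) :
    expAv c' h x ≤ ENNReal.ofReal l * expAv c h x := by
  have hl : 0 ≤ l := by by_contra hl; nlinarith
  refine expAv_le_of_ek_le hl h hh x x fun y => ?_
  unfold ek
  rw [← mul_assoc]
  gcongr
  linarith

lemma lintegral_mul_expAv {c : ℝ} {u h : ℝ → ℝ≥0∞} (hu : Measurable u) (hh : Measurable h) :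
    ∫⁻ x, u x * expAv c h x = ∫⁻ x, expAv c u x * h x := by
  have hm := (continuous_ek c).measurable
  have e1 : ∀ x, u x * expAv c h x = ∫⁻ y, u x * (ENNReal.ofReal (ek c (x - y)) * h y) := fun x => by
    rw [lintegral_const_mul _ (by fun_prop), expAv]
  have e2 : ∀ x, expAv c u x * h x = ∫⁻ y, ENNReal.ofReal (ek c (x - y)) * u y * h x := fun x => by
    rw [lintegral_mul_const _ (by fun_prop), expAv]
  simp_rw [e1, e2]
  rw [lintegral_lintegral_swap (by fun_prop)]
  refine lintegral_congr fun y => lintegral_congr fun x => ?_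
  rw [show ek c (x - y) = ek c (y - x) by unfold ek; rw [abs_sub_comm]]
  ring

lemma lintegral_expAv_rpow_le {c p : ℝ} (hc : 0 < c) (hp : 1 ≤ p) {h : ℝ → ℝ≥0∞}
    (hh : Measurable h) : ∫⁻ x, expAv c h x ^ p ≤ ∫⁻ x, h x ^ p := by
  have := lintegral_young (k := fun x => ENNReal.ofReal (ek c x)) (h := h) hp
    (continuous_ek c).measurable.ennreal_ofReal hh
  rwa [lintegral_ek hc, ENNReal.one_rpow, one_mul] at this

lemma expAv_rpow_le {c c' s : ℝ} (hc : 0 < c) (hs : 0 ≤ s) (hcs : s * c' ≤ c / 2)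
    {H : ℝ → ℝ≥0∞} (x : ℝ)
    (hH : ∀ x', H x' ≤ ENNReal.ofReal (Real.exp (c' * |x' - x|)) * H x) :
    expAv c (fun y => H y ^ s) x ≤ 2 * H x ^ s := by
  have hm := (continuous_ek (c / 2)).measurable
  calc expAv c (fun y => H y ^ s) x
      ≤ ∫⁻ y, 2 * H x ^ s * ENNReal.ofReal (ek (c / 2) (x - y)) := by
        refine lintegral_mono fun y => ?_
        have h1 : H y ^ s ≤ ENNReal.ofReal (Real.exp (s * c' * |x - y|)) * H x ^ s := by
          refine (ENNReal.rpow_le_rpow (hH y) hs).trans_eq ?_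
          rw [ENNReal.mul_rpow_of_nonneg _ _ hs,
            ENNReal.ofReal_rpow_of_pos (Real.exp_pos _), ← Real.exp_mul, abs_sub_comm y x]
          congr 3; ring
        have h2 : ek c (x - y) * Real.exp (s * c' * |x - y|) ≤ 2 * ek (c / 2) (x - y) := by
          have : Real.exp (-c * |x - y|) * Real.exp (s * c' * |x - y|)
              ≤ Real.exp (-(c / 2) * |x - y|) := by
            rw [← Real.exp_add]
            gcongr
            nlinarith [abs_nonneg (x - y)]
          unfold ek
          nlinarith
        calc _ ≤ ENNReal.ofReal (ek c (x - y)) *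
              (ENNReal.ofReal (Real.exp (s * c' * |x - y|)) * H x ^ s) := by gcongr
          _ = ENNReal.ofReal (ek c (x - y) * Real.exp (s * c' * |x - y|)) * H x ^ s := by
            rw [ENNReal.ofReal_mul (ek_nonneg hc _)]; exact (mul_assoc _ _ _).symm
          _ ≤ ENNReal.ofReal (2 * ek (c / 2) (x - y)) * H x ^ s := by gcongr
          _ = _ := by
            rw [ENNReal.ofReal_mul (by norm_num), ENNReal.ofReal_ofNat]; ring
    _ = 2 * H x ^ s := by
        rw [lintegral_const_mul _ (by fun_prop), lintegral_sub_left_eq_self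
          (fun y => ENNReal.ofReal (ek (c / 2) y)), lintegral_ek (by positivity), mul_one]


lemma sum_rpow_le_rpow_sum {ι : Type*} (s : Finset ι) (f : ι → ℝ≥0∞) {q : ℝ} (hq : 1 ≤ q) :
    ∑ i ∈ s, f i ^ q ≤ (∑ i ∈ s, f i) ^ q := by
  classical
  induction s using Finset.induction_on with
  | empty => simp
  | insert i s hi ih =>
    rw [Finset.sum_insert hi, Finset.sum_insert hi]
    exact (add_le_add_right ih _).trans (ENNReal.add_rpow_le_rpow_add _ _ hq)

lemma lintegral_sum_rpow_ne_top {ι : Type*} (s : Finset ι) {f : ι → ℝ → ℝ≥0∞} {q : ℝ}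
    (hq : 1 ≤ q) (hf : ∀ i ∈ s, Measurable (f i)) (h : ∀ i ∈ s, ∫⁻ x, f i x ^ q ≠ ∞) :
    ∫⁻ x, (∑ i ∈ s, f i x) ^ q ≠ ∞ := by
  classical
  induction s using Finset.induction_on with
  | empty => simp [show 0 < q by linarith]
  | insert i s hi ih =>
    simp_rw [Finset.sum_insert hi]
    refine (ENNReal.lintegral_rpow_add_lt_top_of_lintegral_rpow_lt_top (f := f i)
      (g := fun x => ∑ j ∈ s, f j x) (hf i (by simp)).aemeasurable ?_ ?_ hq).ne
    · exact (h i (by simp)).lt_top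
    · exact (ih (fun j hj => hf j (by simp [hj])) (fun j hj => h j (by simp [hj]))).lt_top

lemma lintegral_sum_expAv_rpow_le {p q : ℝ} (hpq : q.HolderConjugate p) {c : ℕ → ℝ}
    (hc : ∀ k, 0 < c k) (hmono : Monotone c) (hgap : ∀ k, (q - 1) * c k ≤ c (k + 1) / 2)
    {h : ℕ → ℝ → ℝ≥0∞} (hh : ∀ k, Measurable (h k)) (n : ℕ) :
    ∫⁻ x, (∑ k ∈ Finset.range n, expAv (c k) (h k) x) ^ q ≤
      (3 * ENNReal.ofReal (q * 2 ^ q)) ^ q * ∫⁻ x, (∑ k ∈ Finset.range n, h k x) ^ q := by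
  have hq := hpq.lt
  have hq0 := hpq.pos
  set K := ENNReal.ofReal (q * 2 ^ q) with hK
  have hK1 : 1 ≤ K := by
    rw [hK, ENNReal.one_le_ofReal]
    have := Real.one_le_rpow (x := 2) (z := q) (by norm_num) hq0.le
    nlinarith
  set Y := ∫⁻ x, (∑ k ∈ Finset.range n, h k x) ^ q with hY
  set H : ℕ → ℝ → ℝ≥0∞ := fun m x => ∑ k ∈ Finset.range m, expAv (c k) (h k) x with hH
  have hv : ∀ k, Measurable (expAv (c k) (h k)) := fun k => measurable_expAv (hh k)
  have hHm : ∀ m, Measurable (H m) := fun m => Finset.measurable_fun_sum _ fun k _ => hv k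
  set X := ∫⁻ x, H n x ^ q with hX
  have hone : (1 : ℝ≥0∞) ≤ (3 * K) ^ q :=
    ENNReal.one_le_rpow (by calc (1 : ℝ≥0∞) ≤ 3 * 1 := by norm_num
      _ ≤ 3 * K := by gcongr) hq0
  by_cases hYt : Y = ∞
  · rw [hYt, ENNReal.mul_top (by positivity)]; exact le_top
  have hsumY : ∑ k ∈ Finset.range n, ∫⁻ x, h k x ^ q ≤ Y := by
    rw [← lintegral_finsetSum _ (fun k _ => by have := hh k; fun_prop)]
    exact lintegral_mono fun x => sum_rpow_le_rpow_sum _ _ hq.le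
  have hXt : X ≠ ∞ := by
    refine lintegral_sum_rpow_ne_top _ hq.le (fun k _ => hv k) fun k hk => ?_
    refine ((lintegral_expAv_rpow_le (hc k) hq.le (hh k)).trans_lt ?_).ne
    exact ((Finset.single_le_sum (f := fun k => ∫⁻ x, h k x ^ q) (fun _ _ => bot_le) hk).trans
      hsumY).trans_lt (lt_top_iff_ne_top.2 hYt)
  have hpt : ∀ m x, H m x ^ q ≤ ∑ k ∈ Finset.range m,
      K * (expAv (c k) (h k) x ^ q + expAv (c k) (h k) x * H k x ^ (q - 1)) := by
    intro m x
    induction m with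
    | zero => simp [hH, hq0]
    | succ m ih =>
      rw [Finset.sum_range_succ]
      have : H (m + 1) x = H m x + expAv (c m) (h m) x := Finset.sum_range_succ _ _
      rw [this]
      exact (ENNReal.add_rpow_le_add_mul _ _ hq).trans (add_le_add_left ih _)
  have hHshift : ∀ k x x', H k x' ≤ ENNReal.ofReal (Real.exp (c (k - 1) * |x' - x|)) * H k x := by
    intro k x x'
    rw [hH, Finset.mul_sum]
    refine Finset.sum_le_sum fun i hi => (expAv_shift (hc i) (hh i) x x').trans ?_
    gcongr
    exact hmono (by have := Finset.mem_range.1 hi; omega)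
  have hcross : ∀ k ∈ Finset.range n, ∫⁻ x, expAv (c k) (h k) x * H k x ^ (q - 1)
      ≤ ∫⁻ x, 2 * (h k x * H n x ^ (q - 1)) := by
    intro k hk
    have e : ∫⁻ x, expAv (c k) (h k) x * H k x ^ (q - 1)
        = ∫⁻ x, h k x * expAv (c k) (fun y => H k y ^ (q - 1)) x :=
      (lintegral_mul_expAv (hh k) (by have := hHm k; fun_prop)).symm
    rw [e]
    refine lintegral_mono fun x => ?_
    rw [mul_left_comm]
    gcongr
    have hle : H k x ≤ H n x := by
      refine Finset.sum_le_sum_of_subset ?_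
      exact Finset.range_subset_range.2 (Finset.mem_range.1 hk).le
    calc _ ≤ 2 * H k x ^ (q - 1) := by
          rcases k with _ | k
          · simp [hH, expAv, show 0 < q - 1 by linarith]
          · exact expAv_rpow_le (hc _) (by linarith) (hgap k) x (fun x' => hHshift (k + 1) x x')
      _ ≤ _ := by gcongr
  have hmain : X ≤ K * (Y + 2 * (Y ^ (1 / q) * X ^ (1 / p))) := by
    calc X ≤ ∫⁻ x, ∑ k ∈ Finset.range n,
          K * (expAv (c k) (h k) x ^ q + expAv (c k) (h k) x * H k x ^ (q - 1)) :=
          lintegral_mono fun x => hpt n x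
      _ = K * ((∑ k ∈ Finset.range n, ∫⁻ x, expAv (c k) (h k) x ^ q)
          + ∑ k ∈ Finset.range n, ∫⁻ x, expAv (c k) (h k) x * H k x ^ (q - 1)) := by
          rw [lintegral_finsetSum _ (fun k _ => by have := hv k; have := hHm k; fun_prop),
            ← Finset.sum_add_distrib, Finset.mul_sum]
          refine Finset.sum_congr rfl fun k _ => ?_
          rw [lintegral_const_mul _ (by have := hv k; have := hHm k; fun_prop),
            lintegral_add_left (by have := hv k; fun_prop)]
      _ ≤ _ := by
          gcongr
          · exact (Finset.sum_le_sum fun k _ =>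
              lintegral_expAv_rpow_le (hc k) hq.le (hh k)).trans hsumY
          · refine (Finset.sum_le_sum hcross).trans ?_
            rw [← lintegral_finsetSum _ (fun k _ => by have := hh k; have := hHm n; fun_prop)]
            have e : ∀ x, ∑ k ∈ Finset.range n, 2 * (h k x * H n x ^ (q - 1))
                = 2 * ((fun x => ∑ k ∈ Finset.range n, h k x) * fun x => H n x ^ (q - 1)) x := by
              intro x; rw [Pi.mul_apply, ← Finset.mul_sum, Finset.sum_mul]
            simp_rw [e]
            have hsm : Measurable fun x => ∑ k ∈ Finset.range n, h k x :=
              Finset.measurable_fun_sum _ fun k _ => hh k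
            have hHn := hHm n
            rw [lintegral_const_mul _ (hsm.mul (by fun_prop))]
            gcongr
            refine (ENNReal.lintegral_mul_le_Lp_mul_Lq volume hpq hsm.aemeasurable
              (by fun_prop)).trans_eq ?_
            congr 2
            refine lintegral_congr fun x => ?_
            rw [← ENNReal.rpow_mul, hpq.sub_one_mul_conj]
  rcases le_total X Y with hXY | hXY
  · calc X ≤ 1 * Y := by rwa [one_mul]
      _ ≤ _ := by gcongr
  · have e1 : Y ≤ Y ^ (1 / q) * X ^ (1 / p) := by
      have : Y = Y ^ (1 / q) * Y ^ (1 / p) := by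
        rw [← ENNReal.rpow_add_of_nonneg _ _ (by have := hpq.pos; positivity)
          (by have := hpq.symm.pos; positivity), one_div, one_div, hpq.inv_add_inv_eq_one,
          ENNReal.rpow_one]
      conv_lhs => rw [this]
      gcongr
      have := hpq.symm.pos; positivity
    have e2 : X ≤ (3 * K * Y ^ (1 / q)) * X ^ (1 / p) := by
      refine hmain.trans ?_
      calc _ ≤ K * (Y ^ (1 / q) * X ^ (1 / p) + 2 * (Y ^ (1 / q) * X ^ (1 / p))) := by gcongr
        _ = _ := by ring
    refine (lintegral_le_of_le_mul_rpow hpq hXt e2).trans_eq ?_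
    rw [ENNReal.mul_rpow_of_nonneg _ _ hq0.le, ← ENNReal.rpow_mul, one_div,
      inv_mul_cancel₀ hq0.ne', ENNReal.rpow_one]

lemma lintegral_maximal_expAv_le {p q : ℝ} (hpq : p.HolderConjugate q) {c : ℕ → ℝ}
    (hc : ∀ k, 0 < c k) (hmono : Monotone c) (hgap : ∀ k, (q - 1) * c k ≤ c (k + 1) / 2)
    {G : ℝ → ℝ≥0∞} (hG : Measurable G) (hGt : ∫⁻ x, G x ^ p ≠ ∞) (n : ℕ) :
    ∫⁻ x, ((Finset.range (n + 1)).sup fun k => expAv (c k) G x) ^ p ≤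
      (3 * ENNReal.ofReal (q * 2 ^ q)) ^ p * ∫⁻ x, G x ^ p := by
  have hp := hpq.lt
  have hp0 := hpq.pos
  have hq0 := hpq.symm.pos
  set T : ℝ → ℝ≥0∞ := fun x => (Finset.range (n + 1)).sup fun k => expAv (c k) G x with hT
  have hv : ∀ k, Measurable (expAv (c k) G) := fun k => measurable_expAv hG
  have hTm : Measurable T := measurable_sup_expAv c hG _
  set B : ℕ → Set ℝ := fun k => {x | k ≤ n ∧ T x ≤ expAv (c k) G x} with hB
  have hBm : ∀ k, MeasurableSet (B k) := fun k =>
    (MeasurableSet.const _).inter (measurableSet_le hTm (hv k))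
  have hBu : ∀ x, ∃ k, x ∈ B k := fun x => by
    obtain ⟨k, hk, he⟩ := Finset.exists_mem_eq_sup (Finset.range (n + 1)) (by simp)
      (fun k => expAv (c k) G x)
    exact ⟨k, by have := Finset.mem_range.1 hk; omega, he.le⟩
  set D := disjointed B with hD
  have hDm : ∀ k, MeasurableSet (D k) := fun k => MeasurableSet.disjointed hBm k
  have hDB : ∀ k, D k ⊆ B k := fun k => disjointed_subset B k
  have hsum : ∀ x (z : ℝ≥0∞), ∑ k ∈ Finset.range (n + 1), (D k).indicator (fun _ => z) x = z := by
    intro x z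
    have hx : x ∈ ⋃ k, D k := by
      rw [hD, iUnion_disjointed]; exact mem_iUnion.2 (hBu x)
    obtain ⟨k, hk⟩ := mem_iUnion.1 hx
    rw [Finset.sum_eq_single k]
    · simp [hk]
    · intro j _ hj
      refine indicator_of_notMem (fun hxj => ?_) _
      exact Set.disjoint_left.1 (disjoint_disjointed B hj) hxj hk
    · intro h
      exact absurd (hDB k hk).1 (by simpa using h)
  set h : ℕ → ℝ → ℝ≥0∞ := fun k => (D k).indicator fun x => T x ^ (p - 1) with hh
  have hhm : ∀ k, Measurable (h k) := fun k =>
    Measurable.indicator (by fun_prop) (hDm k)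
  have hsumh : ∀ x, ∑ k ∈ Finset.range (n + 1), h k x = T x ^ (p - 1) := by
    intro x
    rw [← hsum x (T x ^ (p - 1))]
    refine Finset.sum_congr rfl fun k _ => ?_
    by_cases hx : x ∈ D k <;> simp [hh, hx]
  have hTt : ∫⁻ x, T x ^ p ≠ ∞ := by
    refine (lt_of_le_of_lt (lintegral_mono (g := fun x =>
      (∑ k ∈ Finset.range (n + 1), expAv (c k) G x) ^ p) fun x => ?_) (lt_top_iff_ne_top.2
        (lintegral_sum_rpow_ne_top _ hp.le (fun k _ => hv k) fun k _ => ?_))).ne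
    · refine ENNReal.rpow_le_rpow (Finset.sup_le fun k hk => ?_) hp0.le
      exact Finset.single_le_sum (f := fun k => expAv (c k) G x) (fun _ _ => bot_le) hk
    · exact ((lintegral_expAv_rpow_le (hc k) hp.le hG).trans_lt (lt_top_iff_ne_top.2 hGt)).ne
  set Y := ∫⁻ x, G x ^ p
  set K := 3 * ENNReal.ofReal (q * 2 ^ q)
  have hmain : ∫⁻ x, T x ^ p ≤ (K * Y ^ (1 / p)) * (∫⁻ x, T x ^ p) ^ (1 / q) := by
    have e0 : ∀ x, T x ^ p ≤ ∑ k ∈ Finset.range (n + 1), h k x * expAv (c k) G x := by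
      intro x
      have e : T x ^ p = ∑ k ∈ Finset.range (n + 1), h k x * T x := by
        rw [← Finset.sum_mul, hsumh]
        conv_rhs => rw [← ENNReal.rpow_one (T x), ← ENNReal.rpow_mul]
        rw [← ENNReal.rpow_add_of_nonneg _ _ (by linarith) (by norm_num)]
        simp
      rw [e]
      refine Finset.sum_le_sum fun k _ => ?_
      by_cases hx : x ∈ D k
      · gcongr; exact (hDB k hx).2
      · simp [hh, hx]
    set S : ℝ → ℝ≥0∞ := fun x => ∑ k ∈ Finset.range (n + 1), expAv (c k) (h k) x with hS
    have hSm : Measurable S := Finset.measurable_fun_sum _ fun k _ => measurable_expAv (hhm k)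
    calc ∫⁻ x, T x ^ p ≤ ∫⁻ x, ∑ k ∈ Finset.range (n + 1), h k x * expAv (c k) G x :=
          lintegral_mono e0
      _ = ∫⁻ x, (S * G) x := by
          rw [lintegral_finsetSum (f := fun k x => h k x * expAv (c k) G x) _ fun k _ => (hhm k).mul (hv k)]
          simp_rw [fun k => lintegral_mul_expAv (c := c k) (hhm k) hG]
          rw [← lintegral_finsetSum (f := fun k x => expAv (c k) (h k) x * G x) _
            fun k _ => (measurable_expAv (hhm k)).mul hG]
          refine lintegral_congr fun x => ?_
          rw [Pi.mul_apply, hS, Finset.sum_mul]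
      _ ≤ (∫⁻ x, S x ^ q) ^ (1 / q) * Y ^ (1 / p) :=
          ENNReal.lintegral_mul_le_Lp_mul_Lq volume hpq.symm hSm.aemeasurable hG.aemeasurable
      _ ≤ (K ^ q * ∫⁻ x, T x ^ p) ^ (1 / q) * Y ^ (1 / p) := by
          gcongr
          refine (lintegral_sum_expAv_rpow_le hpq.symm hc hmono hgap hhm (n + 1)).trans_eq ?_
          congr 1
          refine lintegral_congr fun x => ?_
          rw [hsumh, ← ENNReal.rpow_mul, hpq.sub_one_mul_conj]
      _ = _ := by
          rw [ENNReal.mul_rpow_of_nonneg _ _ (by positivity), ← ENNReal.rpow_mul, mul_one_div,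
            div_self hq0.ne', ENNReal.rpow_one]
          ring
  refine (lintegral_le_of_le_mul_rpow hpq hTt hmain).trans_eq ?_
  rw [ENNReal.mul_rpow_of_nonneg _ _ hp0.le, ← ENNReal.rpow_mul, one_div,
    inv_mul_cancel₀ hp0.ne', ENNReal.rpow_one]

lemma exists_maximal_bound {p : ℝ} (hp : 1 < p) :
    ∃ C : ℝ≥0, ∀ {G : ℝ → ℝ≥0∞}, Measurable G → ∫⁻ x, G x ^ p ≠ ∞ → ∀ {a b : ℝ}, 0 < a →
      ∃ T : ℝ → ℝ≥0∞, Measurable T ∧ (∀ c ∈ Icc a b, ∀ x, expAv c G x ≤ T x) ∧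
        ∫⁻ x, T x ^ p ≤ C * ∫⁻ x, G x ^ p := by
  have hpq := Real.HolderConjugate.conjExponent hp
  set q := p.conjExponent
  have hq := hpq.symm.lt
  have hp0 := hpq.pos
  set l : ℝ := 2 * q with hl
  have hl1 : 1 < l := by linarith
  set K := (3 * ENNReal.ofReal (q * 2 ^ q)) ^ p with hK
  have hKt : ENNReal.ofReal l ^ p * K ≠ ∞ := by
    refine ENNReal.mul_ne_top (ENNReal.rpow_ne_top_of_nonneg hp0.le (by simp)) ?_
    exact ENNReal.rpow_ne_top_of_nonneg hp0.le (ENNReal.mul_ne_top (by simp) (by simp))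
  refine ⟨(ENNReal.ofReal l ^ p * K).toNNReal, fun {G} hG hGt a b ha => ?_⟩
  obtain ⟨n, hn⟩ := pow_unbounded_of_one_lt (b / a) hl1
  have hbn : b ≤ a * l ^ n := by
    rw [div_lt_iff₀ ha] at hn; linarith
  set c : ℕ → ℝ := fun k => a * l ^ k with hc
  have hc0 : ∀ k, 0 < c k := fun k => by positivity
  have hm : Monotone c := fun i j hij => by
    simp only [hc]; gcongr; exact hl1.le
  have hg : ∀ k, (q - 1) * c k ≤ c (k + 1) / 2 := fun k => by
    have : c (k + 1) = l * c k := by simp only [hc]; ring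
    rw [this, hl]; nlinarith [hc0 k]
  refine ⟨fun x => ENNReal.ofReal l * (Finset.range (n + 1)).sup fun k => expAv (c k) G x,
    ?_, fun d hd x => ?_, ?_⟩
  · exact (measurable_sup_expAv c hG _).const_mul _
  · have : ∃ k ∈ Finset.range (n + 1), c k ≤ d ∧ d ≤ l * c k := by
      by_contra! hcon
      have : ∀ k ≤ n, c k ≤ d := by
        intro k
        induction k with
        | zero => intro _; simpa [hc] using hd.1
        | succ k ih =>
          intro hk
          have := hcon k (by simp; omega) (ih (by omega))
          have e : c (k + 1) = l * c k := by simp only [hc]; ring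
          linarith
      have h1 := hcon n (by simp) (this n le_rfl)
      have h2 := hc0 n
      have h3 : d ≤ c n := hd.2.trans hbn
      nlinarith
    obtain ⟨k, hk, h1, h2⟩ := this
    refine (expAv_le_of_scale (hc0 k) h1 h2 hG x).trans ?_
    refine mul_le_mul' le_rfl ?_
    exact Finset.le_sup (f := fun k => expAv (c k) G x) hk
  · simp_rw [ENNReal.mul_rpow_of_nonneg _ _ hp0.le]
    rw [lintegral_const_mul' _ _ (ENNReal.rpow_ne_top_of_nonneg hp0.le (by simp)),
      ENNReal.coe_toNNReal hKt, mul_assoc]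
    refine mul_le_mul' le_rfl ?_
    exact lintegral_maximal_expAv_le hpq hc0 hm hg hG hGt n

end

noncomputable section

lemma invF_sum {ι : Type*} (s : Finset ι) {φ : ι → ℝ → ℂ} (h : ∀ i ∈ s, Integrable (φ i)) (x : ℝ) :
    invF (fun ξ => ∑ i ∈ s, φ i ξ) x = ∑ i ∈ s, invF (φ i) x := by
  unfold invF
  simp_rw [Finset.sum_mul]
  exact integral_finsetSum _ fun i hi => integrable_mul_eChar (h i hi) x

lemma Good.indicator_Ico {p : ℝ} (hp : 1 < p) {φ : ℝ → ℂ} (hφ : Good p φ) {α β : ℝ} (h : α ≤ β) :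
    Good p ((Ico α β).indicator φ) ∧ eLpNorm (invF ((Ico α β).indicator φ)) (ENNReal.ofReal p) volume
      ≤ intC p * eLpNorm (invF φ) (ENNReal.ofReal p) volume := by
  have hM := mulBdd_Ico (ι := Unit) (α := fun _ => α) (β := fun _ => β) fun _ => h
  have e : (Ico α β).indicator φ = fun ξ => φ ξ * (Ico α β).indicator 1 ξ := by
    ext ξ; by_cases hξ : ξ ∈ Ico α β <;> simp [hξ]
  refine ⟨e ▸ hM.good hp (φ := fun _ => φ) (fun _ => hφ) (), ?_⟩
  have := hM.norm_le hp (φ := fun _ => φ) (fun _ => hφ)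
  rw [eLpNorm_vec_unit (invF φ), eLpNorm_vec_unit (invF fun ξ => φ ξ * (Ico α β).indicator 1 ξ)] at this
  rwa [e]

lemma enorm_invF_mul_lorentz_le {c : ℝ} (hc : 0 < c) {φ : ℝ → ℂ} (hφ : Integrable φ) (x : ℝ) :
    ‖invF (fun ξ => φ ξ * ((c ^ 2 / (c ^ 2 + ξ ^ 2) : ℝ) : ℂ)) x‖ₑ
      ≤ expAv (2 * Real.pi * c) (fun y => ‖invF φ y‖ₑ) x := by
  have hpi := Real.pi_pos
  have hd : 0 < 2 * Real.pi * c := by positivity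
  have h := conv_invF (integrable_ek hd) hφ x
  have e : ∀ ξ, ∫ y, ek (2 * Real.pi * c) (x - y) • eChar ξ y
      = ((c ^ 2 / (c ^ 2 + ξ ^ 2) : ℝ) : ℂ) * eChar ξ x := by
    intro ξ
    rw [← integral_sub_left_eq_self _ volume x]
    have e1 : ∀ y, ek (2 * Real.pi * c) (x - (x - y)) • eChar ξ (x - y)
        = (ek (2 * Real.pi * c) y : ℂ) * eChar y (-ξ) * eChar ξ x := by
      intro y
      rw [sub_sub_cancel, Complex.real_smul, mul_assoc (_ : ℂ)]
      congr 1
      simp only [eChar, ← Complex.exp_add]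
      congr 1; push_cast; ring
    simp_rw [e1]
    rw [integral_mul_const]
    congr 1
    have := invF_ek hd (-ξ)
    unfold invF at this
    rw [this]
    congr 1
    field_simp
  simp_rw [e] at h
  have e2 : invF (fun ξ => φ ξ * ((c ^ 2 / (c ^ 2 + ξ ^ 2) : ℝ) : ℂ)) x
      = ∫ y, ek (2 * Real.pi * c) (x - y) • invF φ y := by
    rw [h]; unfold invF; simp_rw [mul_assoc]
  rw [e2]
  refine (enorm_integral_le_lintegral_enorm _).trans (le_of_eq ?_)
  refine lintegral_congr fun y => ?_
  rw [enorm_smul, Real.enorm_of_nonneg (ek_nonneg hd _)]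

lemma sum_geom_inj_le {ι : Type*} (s : Finset ι) (g : ι → ℕ) (hg : Set.InjOn g s) {ν : ℝ}
    (h0 : 0 ≤ ν) (h1 : ν < 1) : ∑ i ∈ s, ν ^ g i ≤ (1 - ν)⁻¹ := by
  classical
  rw [← Finset.sum_image (f := fun k => ν ^ k) hg, ← tsum_geometric_of_lt_one h0 h1]
  exact (summable_geometric_of_lt_one h0 h1).sum_le_tsum _ fun _ _ => by positivity

lemma sum_geom_dist_le {ι : Type*} (s : Finset ι) (g : ι → ℕ) (hg : Set.InjOn g s) (j : ℕ) {ν : ℝ}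
    (h0 : 0 ≤ ν) (h1 : ν < 1) : ∑ i ∈ s, ν ^ ((g i - j) + (j - g i)) ≤ 2 / (1 - ν) := by
  rw [← Finset.sum_filter_add_sum_filter_not s (fun i => g i < j)]
  have e : 2 / (1 - ν) = (1 - ν)⁻¹ + (1 - ν)⁻¹ := by rw [div_eq_mul_inv]; ring
  rw [e]
  refine add_le_add (sum_geom_inj_le _ _ ?_ h0 h1) (sum_geom_inj_le _ _ ?_ h0 h1)
  all_goals
    intro a ha b hb hab
    simp only [Finset.coe_filter, mem_ofPred_eq, not_lt] at ha hb
    exact hg ha.1 hb.1 (by simp only at hab; omega)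

/-- Rescaled symbol of the discrepancy between a sharp and a smooth cutoff at frequency `c` on
the piece of frequencies comparable to `β`. -/
def offSym (low : Prop) [Decidable low] (β c s : ℝ) : ℝ :=
  if low then β ^ 2 / (c ^ 2 + s ^ 2) else -((c / β) ^ 2 * (s ^ 2 / (c ^ 2 + s ^ 2)))

def offSym' (low : Prop) [Decidable low] (β c s : ℝ) : ℝ :=
  if low then -(β ^ 2 * (2 * s) / (c ^ 2 + s ^ 2) ^ 2)
  else -((c / β) ^ 2 * (2 * s * c ^ 2 / (c ^ 2 + s ^ 2) ^ 2))

section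
variable {low : Prop} [Decidable low] {β c s ν : ℝ}

lemma hasDerivAt_offSym (hc : 0 < c) : HasDerivAt (offSym low β c) (offSym' low β c s) s := by
  have h1 : c ^ 2 + s ^ 2 ≠ 0 := by positivity
  have hd : HasDerivAt (fun s => c ^ 2 + s ^ 2) (2 * s) s := by
    simpa using (hasDerivAt_pow 2 s).const_add (c ^ 2)
  have hn : HasDerivAt (fun s : ℝ => s ^ 2) (2 * s) s := by simpa using hasDerivAt_pow 2 s
  by_cases h : low
  · have e : offSym low β c = fun s => β ^ 2 / (c ^ 2 + s ^ 2) := by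
      ext; simp [offSym, h]
    rw [e]
    simp only [offSym', h, if_true]
    refine ((hasDerivAt_const s (β ^ 2)).div hd h1).congr_deriv ?_
    ring
  · have e : offSym low β c = fun s => -((c / β) ^ 2 * (s ^ 2 / (c ^ 2 + s ^ 2))) := by
      ext; simp [offSym, h]
    rw [e]
    simp only [offSym', h, if_false]
    refine ((hn.div hd h1).const_mul _).neg.congr_deriv ?_
    ring

lemma measurable_offSym : Measurable (offSym low β c) := by
  unfold offSym; split_ifs <;> fun_prop

lemma measurable_offSym' : Measurable (offSym' low β c) := by
  unfold offSym'; split_ifs <;> fun_prop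

lemma abs_offSym_le (hν : 0 < ν) (hν1 : ν < 1) (hβ : 0 < β) (hc : 0 < c)
    (hs : s ∈ Icc (ν * β) β) : |offSym low β c s| ≤ 2 * ν⁻¹ ^ 3 := by
  have hs0 : 0 < s := (by positivity : 0 < ν * β).trans_le hs.1
  have hD : 0 < c ^ 2 + s ^ 2 := by positivity
  have hi : 1 ≤ ν⁻¹ := (one_le_inv₀ hν).2 hν1.le
  by_cases h : low
  · simp only [offSym, h, if_true]
    rw [abs_of_nonneg (by positivity), div_le_iff₀ hD]
    have h1 : β ≤ ν⁻¹ * s := by rw [le_inv_mul_iff₀ hν]; exact hs.1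
    have h2 : β ^ 2 ≤ (ν⁻¹ * s) ^ 2 := by gcongr
    have h3 : ν⁻¹ ^ 2 ≤ 2 * ν⁻¹ ^ 3 := by
      have : 0 < ν⁻¹ ^ 2 := by positivity
      nlinarith
    calc β ^ 2 ≤ ν⁻¹ ^ 2 * s ^ 2 := by rwa [← mul_pow]
      _ ≤ ν⁻¹ ^ 2 * (c ^ 2 + s ^ 2) := by gcongr; nlinarith
      _ ≤ _ := by gcongr
  · simp only [offSym, h, if_false]
    rw [abs_neg, abs_of_nonneg (by positivity)]
    have h3 : (1 : ℝ) ≤ ν⁻¹ ^ 3 := one_le_pow₀ hi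
    have : (c / β) ^ 2 * (s ^ 2 / (c ^ 2 + s ^ 2)) ≤ 1 := by
      rw [div_pow, div_mul_div_comm, div_le_one (by positivity)]
      have : s ^ 2 ≤ β ^ 2 := by gcongr; exact hs.2
      have h4 : c ^ 2 * s ^ 2 ≤ c ^ 2 * β ^ 2 := by gcongr
      nlinarith [sq_nonneg (β * s)]
    linarith

lemma abs_offSym'_le (hν : 0 < ν) (hν1 : ν < 1) (hβ : 0 < β) (hc : 0 < c)
    (hs : s ∈ Icc (ν * β) β) : |offSym' low β c s| * (β - ν * β) ≤ 2 * ν⁻¹ ^ 3 := by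
  have hs0 : 0 < s := (by positivity : 0 < ν * β).trans_le hs.1
  have hD : 0 < c ^ 2 + s ^ 2 := by positivity
  have hi : 1 ≤ ν⁻¹ := (one_le_inv₀ hν).2 hν1.le
  have hb : β - ν * β ≤ β := by have := mul_pos hν hβ; linarith
  refine (mul_le_mul_of_nonneg_left hb (abs_nonneg _)).trans ?_
  by_cases h : low
  · simp only [offSym', h, if_true]
    rw [abs_neg, abs_of_nonneg (by positivity), div_mul_eq_mul_div, div_le_iff₀ (by positivity)]
    have h1 : β ≤ ν⁻¹ * s := by rw [le_inv_mul_iff₀ hν]; exact hs.1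
    have h2 : β ^ 3 ≤ (ν⁻¹ * s) ^ 3 := by gcongr
    calc β ^ 2 * (2 * s) * β = 2 * s * β ^ 3 := by ring
      _ ≤ 2 * s * (ν⁻¹ * s) ^ 3 := by gcongr
      _ = 2 * ν⁻¹ ^ 3 * (s ^ 2) ^ 2 := by ring
      _ ≤ _ := by gcongr; nlinarith
  · simp only [offSym', h, if_false]
    rw [abs_neg, abs_of_nonneg (by positivity)]
    have h3 : (1 : ℝ) ≤ ν⁻¹ ^ 3 := one_le_pow₀ hi
    have : (c / β) ^ 2 * (2 * s * c ^ 2 / (c ^ 2 + s ^ 2) ^ 2) * β ≤ 2 := by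
      have e : (c / β) ^ 2 * (2 * s * c ^ 2 / (c ^ 2 + s ^ 2) ^ 2) * β
          = 2 * s * (c ^ 2) ^ 2 / (β * (c ^ 2 + s ^ 2) ^ 2) := by field_simp
      rw [e, div_le_iff₀ (by positivity)]
      calc 2 * s * (c ^ 2) ^ 2 ≤ 2 * β * (c ^ 2 + s ^ 2) ^ 2 := by
            gcongr
            · exact hs.2
            · nlinarith
        _ = _ := by ring
    linarith
end

lemma geom_div {b0 ν : ℝ} (h0 : 0 < b0) (hν : 0 < ν) {j k : ℕ} (h : j ≤ k) :
    b0 * ν ^ k / (b0 * ν ^ j) = ν ^ (k - j) := by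
  obtain ⟨m, rfl⟩ := Nat.exists_eq_add_of_le h
  rw [pow_add, Nat.add_sub_cancel_left]; field_simp

lemma sq_mul_offSym {b0 ν : ℝ} (h0 : 0 < b0) (hν : 0 < ν) (j k : ℕ) (s : ℝ) :
    (ν ^ ((k - j) + (j - k))) ^ 2 * offSym (k < j) (b0 * ν ^ k) (b0 * ν ^ j) s
      = (if k < j then (1 : ℝ) else 0) - 1 + (b0 * ν ^ j) ^ 2 / ((b0 * ν ^ j) ^ 2 + s ^ 2) := by
  have hk : 0 < b0 * ν ^ k := by positivity
  have hj : 0 < b0 * ν ^ j := by positivity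
  by_cases h : k < j
  · have e := geom_div h0 hν h.le
    rw [Nat.sub_eq_zero_of_le h.le, zero_add, ← e]
    simp only [offSym, h, if_true]
    field_simp
    ring
  · have h' := not_lt.1 h
    have e := geom_div h0 hν h'
    rw [Nat.sub_eq_zero_of_le h', add_zero, ← e]
    simp only [offSym, h, if_false]
    field_simp
    ring

lemma exists_mem_Ico_geom {b : ℕ → ℝ} {n : ℕ} {ξ : ℝ} (h : ξ ∈ Ico (b n) (b 0)) :
    ∃ k : Fin n, ξ ∈ Ico (b (k + 1)) (b k) := by
  induction n with
  | zero => exact absurd h.1 (not_le.2 h.2)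
  | succ n ih =>
    by_cases hn : ξ < b n
    · exact ⟨Fin.last n, by simpa using ⟨h.1, hn⟩⟩
    · obtain ⟨k, hk⟩ := ih ⟨not_lt.1 hn, h.2⟩
      exact ⟨k.castSucc, by simpa using hk⟩

lemma lacunary_geom {b0 ν : ℝ} (h0 : 0 < b0) (hν : 0 < ν) (hν1 : ν < 1) (n : ℕ) :
    Lacunary ν⁻¹ ν⁻¹ (fun k : Fin n => b0 * ν ^ (k : ℕ)) (fun k => b0 * ν ^ ((k : ℕ) + 1))
      (fun k => b0 * ν ^ (k : ℕ)) where
  pos k := by positivity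
  le k := by
    rw [pow_succ, ← mul_assoc]
    exact mul_le_of_le_one_right (by positivity) hν1.le
  disj := by
    have key : ∀ i j : ℕ, i < j → Disjoint (Ioc (1 / (b0 * ν ^ i)) (ν⁻¹ / (b0 * ν ^ i)))
        (Ioc (1 / (b0 * ν ^ j)) (ν⁻¹ / (b0 * ν ^ j))) := by
      intro i j hij
      refine Set.disjoint_left.2 fun x hx hy => ?_
      have h1 : ν⁻¹ / (b0 * ν ^ i) = 1 / (b0 * ν ^ (i + 1)) := by field_simp; ring
      have h2 : 1 / (b0 * ν ^ (i + 1)) ≤ 1 / (b0 * ν ^ j) := by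
        gcongr 1 / (b0 * ?_)
        exact pow_le_pow_of_le_one hν.le hν1.le hij
      have h3 := hx.2
      have h4 := hy.1
      rw [h1] at h3
      linarith
    intro i j hij
    rcases lt_or_gt_of_ne (Fin.val_ne_of_ne hij) with h | h
    · exact key _ _ h
    · exact (key _ _ h).symm
  mem := by
    refine ⟨1, by simp, fun k s hs => ?_⟩
    have hp : 0 < b0 * ν ^ (k : ℕ) := by positivity
    rw [one_mul, inv_inv]
    constructor
    · rw [le_div_iff₀ hp]
      refine le_trans (le_of_eq ?_) hs.1
      ring
    · exact ((div_le_one hp).2 hs.2).trans ((one_le_inv₀ hν).2 hν1.le)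


lemma vec_weighted_le {ι κ : Type*} [Fintype ι] [Fintype κ] (w : ι → κ → ℝ) {S : ℝ} (hS : 1 ≤ S)
    (hw : ∀ k, ∑ j, w k j ^ 2 ≤ S) (F : ι → ℝ → ℂ) (x : ℝ) :
    ‖vec (fun i : ι × κ => fun y => (w i.1 i.2 : ℂ) * F i.1 y) x‖ ≤ S * ‖vec F x‖ := by
  rw [← abs_of_nonneg (norm_nonneg (vec _ x)), ← abs_of_nonneg (by positivity : 0 ≤ S * ‖vec F x‖)]
  refine sq_le_sq.1 ?_
  rw [mul_pow, norm_vec_sq, norm_vec_sq, Fintype.sum_prod_type, Finset.mul_sum]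
  refine Finset.sum_le_sum fun k _ => ?_
  simp_rw [norm_mul, mul_pow, Complex.norm_real, Real.norm_eq_abs, sq_abs]
  rw [← Finset.sum_mul]
  gcongr
  have := hw k
  nlinarith

theorem exists_max_cutoff_bound {ν : ℝ} (hν : 0 < ν) (hν1 : ν < 1) {p : ℝ} (hp : 1 < p) :
    ∃ C : ℝ≥0, ∀ {b0 : ℝ}, 0 < b0 → ∀ (n : ℕ) {φ : ℝ → ℂ}, Good p φ → ∃ M : ℝ → ℝ≥0∞, Measurable M ∧
      (∀ j ≤ n, ∀ x, ‖invF ((Ico (b0 * ν ^ j) b0).indicator φ) x‖ₑ ≤ M x) ∧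
      (∫⁻ x, M x ^ p) ^ (1 / p) ≤ C * eLpNorm (invF φ) (ENNReal.ofReal p) volume := by
  have hp0 : 0 < p := by linarith
  have hi : 1 < ν⁻¹ := (one_lt_inv₀ hν).2 hν1
  have hpi := Real.pi_pos
  obtain ⟨CM, hCM⟩ := exists_maximal_bound hp
  obtain ⟨CL, hCL⟩ := exists_lp_forward hi hi.le
  set S : ℝ≥0 := ⟨2 / (1 - ν), by have : 0 < 1 - ν := by linarith
                                  positivity⟩ with hS
  have hS1 : 1 ≤ (S : ℝ) := by
    show 1 ≤ 2 / (1 - ν)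
    rw [le_div_iff₀ (by linarith)]; linarith
  set V : ℝ≥0 := ⟨2 * ν⁻¹ ^ 3, by positivity⟩ with hV
  have hLp : ∀ {E : Type} [NormedAddCommGroup E] (F : ℝ → E),
      eLpNorm F (ENNReal.ofReal p) volume = (∫⁻ x, ‖F x‖ₑ ^ p) ^ (1 / p) := by
    intro E _ F
    rw [eLpNorm_eq_lintegral_rpow_enorm_toReal (by simpa) (by simp), ENNReal.toReal_ofReal hp0.le]
  refine ⟨intC p + CM ^ (1 / p) * intC p + S * ((2 * V * intC p) * (S * CL p)),
    fun {b0} h0 n {φ} hφ => ?_⟩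
  set b : ℕ → ℝ := fun k => b0 * ν ^ k with hb
  have hb0 : ∀ k, 0 < b k := fun k => by positivity
  have hanti : Antitone b := fun i j hij => by
    simp only [hb]
    gcongr b0 * ?_
    exact pow_le_pow_of_le_one hν.le hν1.le hij
  have hb00 : b 0 = b0 := by simp [hb]
  set γ := (Ico (b n) (b 0)).indicator φ with hγ
  obtain ⟨hγG, hγn⟩ := hφ.indicator_Ico hp (hanti (Nat.zero_le n))
  rw [← hγ] at hγG hγn
  set G := invF γ with hG
  have hGm : Measurable fun x => ‖G x‖ₑ := hγG.measurable.enorm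
  have hGt : ∫⁻ x, ‖G x‖ₑ ^ p ≠ ∞ := by
    have h := hγG.lp.2
    rw [hLp, ENNReal.rpow_lt_top_iff_of_pos (by positivity)] at h
    exact h.ne
  obtain ⟨T, hTm, hT, hTn⟩ := hCM hGm hGt (a := 2 * Real.pi * b n) (b := 2 * Real.pi * b 0)
    (by have := hb0 n; positivity)
  set R : Fin n → ℝ → ℂ := fun k => (Ico (b (k + 1)) (b k)).indicator φ with hR
  obtain ⟨hRG, hRn⟩ := hCL (Fin n) _ _ _ (lacunary_geom h0 hν hν1 n) hp φ hφ
  set ω : Fin n → Fin (n + 1) → ℝ := fun k j => ν ^ (((k : ℕ) - j) + ((j : ℕ) - k)) with hω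
  have hω0 : ∀ k j, 0 ≤ ω k j := fun k j => by positivity
  have hω1 : ∀ k j, ω k j ≤ 1 := fun k j => pow_le_one₀ hν.le hν1.le
  set N : Fin n × Fin (n + 1) → ℝ → ℂ := fun i => (Ico (b (i.1 + 1)) (b i.1)).indicator
    fun s => (offSym ((i.1 : ℕ) < i.2) (b i.1) (b i.2) s : ℂ) with hN
  have hbs : ∀ k, b (k + 1) = ν * b k := fun k => by simp only [hb]; ring
  have hM : MulBdd (fun p => 2 * V * intC p) N := by
    refine mulBdd_of_hasDerivAt (fun i => hanti (Nat.le_succ _))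
      (d := fun i s => (offSym' ((i.1 : ℕ) < i.2) (b i.1) (b i.2) s : ℂ))
      (fun i => measurable_offSym.complex_ofReal) (fun i => measurable_offSym'.complex_ofReal)
      (fun i s _ => (hasDerivAt_offSym (hb0 _)).ofReal_comp) (fun i s hs => ?_) (fun i s hs => ?_)
    · rw [hbs] at hs
      rw [Complex.norm_real]
      exact abs_offSym_le hν hν1 (hb0 _) (hb0 _) hs
    · rw [hbs] at hs
      rw [Complex.norm_real, hbs]
      exact abs_offSym'_le hν hν1 (hb0 _) (hb0 _) hs
  set ψ : Fin n × Fin (n + 1) → ℝ → ℂ := fun i ξ => (ω i.1 i.2 : ℂ) * R i.1 ξ with hψ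
  have hψi : ∀ i, invF (ψ i) = fun x => (ω i.1 i.2 : ℂ) * invF (R i.1) x := fun i =>
    invF_const_mul _ _
  have hψG : ∀ i, Good p (ψ i) := fun i =>
    { int := (hRG i.1).int.const_mul _
      two := by rw [hψi]; exact (hRG i.1).two.const_mul _
      lp := by rw [hψi]; exact (hRG i.1).lp.const_mul _ }
  set U : Fin n × Fin (n + 1) → ℝ → ℂ := fun i => invF fun ξ => ψ i ξ * N i ξ with hU
  have hUm : Measurable (vec U) := measurable_vec fun i => (hM.good hp hψG i).measurable
  have hUn : eLpNorm (vec U) (ENNReal.ofReal p) volume ≤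
      (2 * V * intC p : ℝ≥0) * (S * (CL p * eLpNorm (invF φ) (ENNReal.ofReal p) volume)) := by
    refine (hM.norm_le hp hψG).trans ?_
    refine mul_le_mul' le_rfl ?_
    refine le_trans ?_ (mul_le_mul' le_rfl hRn)
    simp_rw [hψi]
    refine eLpNorm_le_nnreal_smul_eLpNorm_of_ae_le_mul (c := S) (ae_of_all _ fun x => ?_) _
    refine vec_weighted_le ω hS1 (fun k => ?_) (fun k => invF (R k)) x
    refine le_trans (Finset.sum_le_sum fun j _ => ?_)
      (sum_geom_dist_le (Finset.univ : Finset (Fin (n + 1))) (fun j => (j : ℕ))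
        (fun a _ b _ h => Fin.ext h) k hν.le hν1)
    rw [add_comm ((j : ℕ) - k)]
    calc ω k j ^ 2 ≤ ω k j := by nlinarith [hω0 k j, hω1 k j]
      _ = _ := rfl
  refine ⟨fun x => ‖G x‖ₑ + T x + S * ‖vec U x‖ₑ, (hGm.add hTm).add (hUm.enorm.const_mul _),
    fun j hj x => ?_, ?_⟩
  · set j' : Fin (n + 1) := ⟨j, by omega⟩ with hj'
    have hdec : (Ico (b0 * ν ^ j) b0).indicator φ = fun ξ => γ ξ +
        ((-1 : ℂ) * (γ ξ * ((b j ^ 2 / (b j ^ 2 + ξ ^ 2) : ℝ) : ℂ))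
          + ∑ k : Fin n, (ω k j' : ℂ) * (ψ (k, j') ξ * N (k, j') ξ)) := by
      ext ξ
      by_cases hξ : ξ ∈ Ico (b n) (b 0)
      · obtain ⟨k, hk⟩ := exists_mem_Ico_geom hξ
        have hγξ : γ ξ = φ ξ := by simp [hγ, hξ]
        rw [hγξ, Finset.sum_eq_single k]
        · have e1 : ψ (k, j') ξ = ω k j' * φ ξ := by simp only [hψ, hR, indicator_of_mem hk]
          have e2 : N (k, j') ξ = (offSym ((k : ℕ) < j) (b k) (b j) ξ : ℂ) := by
            simp only [hN, indicator_of_mem hk]; rfl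
          have e3 : (ω k j' : ℂ) * (ω k j' * φ ξ * (offSym ((k : ℕ) < j) (b k) (b j) ξ : ℂ))
              = ((ω k j' ^ 2 * offSym ((k : ℕ) < j) (b k) (b j) ξ : ℝ) : ℂ) * φ ξ := by
            push_cast; ring
          rw [e1, e2, e3]
          simp only [hω, hj', hb]
          rw [sq_mul_offSym h0 hν]
          have e4 : (Ico (b0 * ν ^ j) b0).indicator φ ξ = if (k : ℕ) < j then φ ξ else 0 := by
            split_ifs with h
            · have hm : ξ ∈ Ico (b0 * ν ^ j) b0 :=
                ⟨(hanti (Nat.succ_le_of_lt h)).trans hk.1, by rw [← hb00]; exact hξ.2⟩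
              exact indicator_of_mem hm _
            · refine indicator_of_notMem (fun hcon => ?_) _
              have h1 : b k ≤ b j := hanti (not_lt.1 h)
              have h2 : b j ≤ ξ := hcon.1
              have h3 := hk.2
              linarith
          rw [e4]
          split_ifs <;> push_cast <;> ring
        · intro i _ hik
          have : ξ ∉ Ico (b (i + 1)) (b i) := by
            intro h
            rcases lt_or_gt_of_ne (Fin.val_ne_of_ne hik) with hlt | hlt
            · have h1 : b k ≤ b (i + 1) := hanti hlt
              have h2 := h.1
              have h3 := hk.2
              linarith
            · have h1 : b i ≤ b (k + 1) := hanti hlt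
              have h2 := h.2
              have h3 := hk.1
              linarith
          simp [hψ, hR, this]
        · simp
      · have h1 : ξ ∉ Ico (b0 * ν ^ j) b0 := fun h => hξ ⟨(hanti hj).trans h.1, by rw [hb00]; exact h.2⟩
        have h2 : ∀ k : Fin n, ξ ∉ Ico (b (k + 1)) (b k) := fun k h =>
          hξ ⟨(hanti k.2).trans h.1, h.2.trans_le (hanti (Nat.zero_le _))⟩
        simp [h1, hγ, hξ, hψ, hR, h2]
    have hbd : ∀ ξ, ‖((b j ^ 2 / (b j ^ 2 + ξ ^ 2) : ℝ) : ℂ)‖ ≤ 1 := fun ξ => by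
      have := hb0 j
      rw [Complex.norm_real, Real.norm_of_nonneg (by positivity), div_le_one (by positivity)]
      nlinarith [sq_nonneg ξ]
    have hi1 : Integrable fun ξ => γ ξ * ((b j ^ 2 / (b j ^ 2 + ξ ^ 2) : ℝ) : ℂ) :=
      hγG.int.mul_bdd (c := 1) (Measurable.complex_ofReal (by fun_prop)).aestronglyMeasurable (ae_of_all _ hbd)
    have hi2 : ∀ k ∈ (Finset.univ : Finset (Fin n)),
        Integrable fun ξ => (ω k j' : ℂ) * (ψ (k, j') ξ * N (k, j') ξ) := fun k _ =>
      (hM.good hp hψG (k, j')).int.const_mul _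
    have hi3 := integrable_finsetSum _ hi2
    have hi4 : Integrable fun ξ => (-1 : ℂ) * (γ ξ * ((b j ^ 2 / (b j ^ 2 + ξ ^ 2) : ℝ) : ℂ))
        + ∑ k : Fin n, (ω k j' : ℂ) * (ψ (k, j') ξ * N (k, j') ξ) := (hi1.const_mul _).add hi3
    rw [hdec, invF_add hγG.int hi4, invF_add (hi1.const_mul _) hi3,
      invF_const_mul]
    beta_reduce
    rw [invF_sum _ hi2]
    refine (enorm_add_le _ _).trans ?_
    rw [add_assoc]
    refine add_le_add le_rfl ((enorm_add_le _ _).trans (add_le_add ?_ ?_))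
    · rw [neg_one_mul, enorm_neg]
      refine (enorm_invF_mul_lorentz_le (hb0 j) hγG.int x).trans (hT _ ⟨?_, ?_⟩ x)
      · have := hanti hj; gcongr
      · have := hanti (Nat.zero_le j); gcongr
    · rw [← ofReal_norm (vec U x), ← ENNReal.ofReal_coe_nnreal, ← ENNReal.ofReal_mul S.coe_nonneg,
        ← ofReal_norm]
      refine ENNReal.ofReal_le_ofReal ((norm_sum_le _ _).trans ?_)
      calc _ ≤ ∑ k : Fin n, ω k j' * ‖vec U x‖ := by
            refine Finset.sum_le_sum fun k _ => ?_
            rw [invF_const_mul]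
            beta_reduce
            rw [norm_mul, Complex.norm_real, Real.norm_of_nonneg (hω0 _ _)]
            exact mul_le_mul_of_nonneg_left (norm_le_norm_vec U x (k, j')) (hω0 _ _)
        _ = (∑ k : Fin n, ω k j') * ‖vec U x‖ := (Finset.sum_mul ..).symm
        _ ≤ _ := by
            gcongr
            exact sum_geom_dist_le (Finset.univ : Finset (Fin n)) (fun j => (j : ℕ))
              (fun a _ b _ h => Fin.ext h) j hν.le hν1
  · have hadd : ∀ {f g : ℝ → ℝ≥0∞}, Measurable f → Measurable g →
        (∫⁻ x, (f x + g x) ^ p) ^ (1 / p) ≤ (∫⁻ x, f x ^ p) ^ (1 / p) + (∫⁻ x, g x ^ p) ^ (1 / p) :=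
      fun hf hg => ENNReal.lintegral_Lp_add_le hf.aemeasurable hg.aemeasurable hp.le
    refine (hadd (hGm.add hTm) (hUm.enorm.const_mul _)).trans ?_
    refine (add_le_add (hadd hGm hTm) le_rfl).trans ?_
    push_cast
    rw [add_mul, add_mul]
    have hG2 : (∫⁻ x, ‖G x‖ₑ ^ p) ^ (1 / p) ≤ intC p * eLpNorm (invF φ) (ENNReal.ofReal p) volume := by
      rw [← hLp]; exact hγn
    refine add_le_add (add_le_add hG2 ?_) ?_
    · refine (ENNReal.rpow_le_rpow hTn (by positivity)).trans ?_
      rw [ENNReal.mul_rpow_of_nonneg _ _ (by positivity), ENNReal.coe_rpow_of_nonneg _ (by positivity),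
        mul_assoc]
      exact mul_le_mul' le_rfl hG2
    · have e : ∀ x, ((S : ℝ≥0∞) * ‖vec U x‖ₑ) ^ p = (S : ℝ≥0∞) ^ p * ‖vec U x‖ₑ ^ p := fun x =>
        ENNReal.mul_rpow_of_nonneg _ _ hp0.le
      simp_rw [e]
      rw [lintegral_const_mul' _ _ (ENNReal.rpow_ne_top_of_nonneg hp0.le (by simp)),
        ENNReal.mul_rpow_of_nonneg _ _ (by positivity), ← ENNReal.rpow_mul, mul_one_div,
        div_self hp0.ne', ENNReal.rpow_one, ← hLp, mul_assoc]
      refine mul_le_mul' le_rfl (hUn.trans (le_of_eq ?_))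
      push_cast
      ring

end

noncomputable section

/-! ### Products of functions and convolution of spectra -/

lemma integrable_specConv {φ ψ : ℝ → ℂ} (hφ : Integrable φ) (hψ : Integrable ψ) :
    Integrable fun ξ => ∫ t, φ t * ψ (ξ - t) :=
  (hφ.convolution_integrand (ContinuousLinearMap.mul ℝ ℂ) hψ).integral_prod_left

lemma invF_specConv {φ ψ : ℝ → ℂ} (hφ : Integrable φ) (hψ : Integrable ψ) (x : ℝ) :
    invF (fun ξ => ∫ t, φ t * ψ (ξ - t)) x = invF φ x * invF ψ x := by
  have h : Integrable (fun z : ℝ × ℝ => φ z.2 * ψ (z.1 - z.2) * eChar z.1 x)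
      (volume.prod volume) :=
    (hφ.convolution_integrand (ContinuousLinearMap.mul ℝ ℂ) hψ).mul_bdd (c := 1)
      ((continuous_eChar_left x).comp continuous_fst).aestronglyMeasurable
      (ae_of_all _ fun z => (norm_eChar _ _).le)
  unfold invF
  simp_rw [← integral_mul_const]
  rw [integral_integral_swap h]
  congr 1; ext t
  rw [← integral_const_mul,
    ← integral_add_right_eq_self (fun ξ => φ t * ψ (ξ - t) * eChar ξ x) t]
  congr 1; ext ξ
  rw [add_sub_cancel_right, eChar_add_left]
  ring

lemma Good.specConv {p q r : ℝ} (hp : 0 < p) (hq : 0 < q) (hr : 0 < r)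
    (hpqr : 1 / r = 1 / p + 1 / q) {φ ψ : ℝ → ℂ} (hφ : Good p φ) (hψ : Good q ψ) :
    Good r fun ξ => ∫ t, φ t * ψ (ξ - t) := by
  have e : invF (fun ξ => ∫ t, φ t * ψ (ξ - t)) = fun x => invF φ x * invF ψ x :=
    funext fun x => invF_specConv hφ.int hψ.int x
  have hb : MemLp (invF φ) ∞ volume :=
    memLp_top_of_bound hφ.measurable.aestronglyMeasurable _
      (ae_of_all _ fun x => norm_invF_le φ x)
  have : ENNReal.HolderTriple (ENNReal.ofReal p) (ENNReal.ofReal q) (ENNReal.ofReal r) := by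
    constructor
    rw [← ENNReal.ofReal_inv_of_pos hp, ← ENNReal.ofReal_inv_of_pos hq,
      ← ENNReal.ofReal_inv_of_pos hr, ← ENNReal.ofReal_add (by positivity) (by positivity)]
    simp only [one_div] at hpqr
    rw [hpqr]
  refine ⟨integrable_specConv hφ.int hψ.int, ?_, ?_⟩
  · rw [e]; exact hψ.two.mul hb
  · rw [e]; exact hψ.lp.mul hφ.lp

/-! ### Hölder's inequality for square functions -/

lemma enorm_vec_mul_le {ι : Type*} [Fintype ι] (F G : ι → ℝ → ℂ) (x : ℝ) {B : ℝ≥0∞}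
    (hB : ∀ i, ‖G i x‖ₑ ≤ B) : ‖vec (fun i x => F i x * G i x) x‖ₑ ≤ ‖vec F x‖ₑ * B := by
  set m : ℝ≥0 := Finset.univ.sup fun i => ‖G i x‖₊ with hm
  have hmB : (m : ℝ≥0∞) ≤ B := by
    rw [hm, ENNReal.coe_finset_sup]
    exact Finset.sup_le fun i _ => hB i
  refine le_trans ?_ (mul_le_mul' le_rfl hmB)
  have h : ‖vec (fun i x => F i x * G i x) x‖ ≤ ‖vec F x‖ * m := by
    refine le_of_sq_le_sq ?_ (by positivity)
    rw [mul_pow, norm_vec_sq, norm_vec_sq, Finset.sum_mul]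
    refine Finset.sum_le_sum fun i _ => ?_
    rw [norm_mul, mul_pow]
    gcongr
    exact_mod_cast Finset.le_sup (f := fun i => ‖G i x‖₊) (Finset.mem_univ i)
  rw [← enorm_norm, ← enorm_norm (vec F x)]
  have h2 := ENNReal.ofReal_le_ofReal h
  rwa [ENNReal.ofReal_mul (norm_nonneg _), ENNReal.ofReal_coe_nnreal, ofReal_norm, ofReal_norm,
    ← enorm_norm, ← enorm_norm (vec F x)] at h2

lemma eLpNorm_vec_mul_le {ι : Type*} [Fintype ι] {p q r : ℝ} (hr : 0 < r) (hrp : r < p)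
    (hpqr : 1 / r = 1 / p + 1 / q) {F G : ι → ℝ → ℂ} (hF : ∀ i, Measurable (F i))
    {M : ℝ → ℝ≥0∞} (hM : Measurable M) (hGM : ∀ i x, ‖G i x‖ₑ ≤ M x) :
    eLpNorm (vec fun i x => F i x * G i x) (ENNReal.ofReal r) volume ≤
      eLpNorm (vec F) (ENNReal.ofReal p) volume * (∫⁻ x, M x ^ q) ^ (1 / q) := by
  rw [eLpNorm_eq_lintegral_rpow_enorm_toReal (by simpa) (by simp), ENNReal.toReal_ofReal hr.le,
    eLpNorm_eq_lintegral_rpow_enorm_toReal (by simpa using hr.trans hrp) (by simp),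
    ENNReal.toReal_ofReal (hr.trans hrp).le]
  refine le_trans ?_ (ENNReal.lintegral_Lp_mul_le_Lq_mul_Lr hr hrp hpqr volume
    (measurable_vec hF).enorm.aemeasurable hM.aemeasurable)
  refine ENNReal.rpow_le_rpow (lintegral_mono fun x => ?_) (by positivity)
  exact ENNReal.rpow_le_rpow (enorm_vec_mul_le F G x fun i => hGM i x) hr.le

/-! ### The paraproduct -/

lemma lacunary_neg_geom {A0 ρ b0 : ℝ} (hA0 : 0 < A0) (hρ : 1 < ρ) (hb0 : 0 ≤ b0)
    (hAb : 2 * b0 ≤ A0) (n : ℕ) :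
    Lacunary ρ (2 * ρ) (fun k : Fin n => A0 * ρ ^ (k : ℕ)) (fun k => -(A0 * ρ ^ ((k : ℕ) + 1)))
      (fun k => -(A0 * ρ ^ (k : ℕ)) + b0) where
  pos k := by positivity
  le k := by
    have : A0 * ρ ^ (k : ℕ) ≤ A0 * ρ ^ ((k : ℕ) + 1) := by
      gcongr A0 * ?_
      exact pow_le_pow_right₀ hρ.le (Nat.le_succ _)
    linarith
  disj := by
    have key : ∀ i j : ℕ, i < j → Disjoint (Ioc (1 / (A0 * ρ ^ i)) (ρ / (A0 * ρ ^ i)))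
        (Ioc (1 / (A0 * ρ ^ j)) (ρ / (A0 * ρ ^ j))) := by
      intro i j hij
      refine Set.disjoint_left.2 fun x hx hy => ?_
      obtain ⟨k, rfl⟩ := Nat.exists_eq_add_of_lt hij
      have h1 : ρ / (A0 * ρ ^ (i + k + 1)) = 1 / (A0 * ρ ^ (i + k)) := by field_simp; ring
      have h2 : 1 / (A0 * ρ ^ (i + k)) ≤ 1 / (A0 * ρ ^ i) := by
        gcongr 1 / (A0 * ?_)
        exact pow_le_pow_right₀ hρ.le (Nat.le_add_right _ _)
      have h3 := hx.1
      have h4 := hy.2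
      rw [h1] at h4
      linarith
    intro i j hij
    rcases lt_or_gt_of_ne (Fin.val_ne_of_ne hij) with h | h
    · exact key _ _ h
    · exact (key _ _ h).symm
  mem := by
    refine ⟨-1, by simp, fun k s hs => ?_⟩
    have hA : A0 ≤ A0 * ρ ^ (k : ℕ) := le_mul_of_one_le_right hA0.le (one_le_pow₀ hρ.le)
    set A := A0 * ρ ^ (k : ℕ) with hAdef
    have h1 : A0 * ρ ^ ((k : ℕ) + 1) = A * ρ := by rw [hAdef]; ring
    have hApos : 0 < A := hA0.trans_le hA
    obtain ⟨hs1, hs2⟩ := hs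
    rw [h1] at hs1
    have hAρ : 0 < A * ρ := by positivity
    constructor
    · rw [le_div_iff₀ hApos, mul_inv]
      have : ρ⁻¹ ≤ 1 := inv_le_one_of_one_le₀ hρ.le
      have : 2⁻¹ * ρ⁻¹ * A ≤ 2⁻¹ * 1 * A := by gcongr
      linarith
    · rw [div_le_iff₀ hApos]
      linarith

/-- Uniform bound for partial sums of a paraproduct whose first family of intervals is
separated from the second. -/
lemma exists_paraproduct_separated_bound {ρ ν p q r : ℝ} (hρ : 1 < ρ) (hν : 0 < ν) (hν1 : ν < 1)
    (hp : 1 < p) (hq : 1 < q) (hr : 1 < r) (hpqr : 1 / r = 1 / p + 1 / q) :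
    ∃ C : ℝ≥0, ∀ {A0 b0 : ℝ}, 0 < A0 → 0 < b0 → 2 * b0 ≤ A0 → ∀ {φ ψ : ℝ → ℂ}, Good p φ →
      Good q ψ → ∀ s n : ℕ,
        eLpNorm (fun x => ∑ j ∈ Finset.range n,
          invF ((Ico (-(A0 * ρ ^ (j + 1))) (-(A0 * ρ ^ j))).indicator φ) x *
            invF ((Ico (b0 * ν ^ (s + j)) b0).indicator ψ) x) (ENNReal.ofReal r) volume ≤
          C * eLpNorm (invF φ) (ENNReal.ofReal p) volume *
            eLpNorm (invF ψ) (ENNReal.ofReal q) volume := by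
  obtain ⟨C1, hC1⟩ := exists_lp_forward hρ (κ := 2 * ρ) (by linarith)
  obtain ⟨C2, hC2⟩ := exists_lp_reverse hρ (κ := 2 * ρ) (by linarith)
  obtain ⟨C3, hC3⟩ := exists_max_cutoff_bound hν hν1 hq
  have hp0 : 0 < p := by linarith
  have hq0 : 0 < q := by linarith
  have hr0 : 0 < r := by linarith
  have hrp : r < p := by
    have : 1 / p < 1 / r := by rw [hpqr]; have : 0 < 1 / q := by positivity
                               linarith
    exact (one_div_lt_one_div hp0 hr0).1 this
  refine ⟨C2 r * (C1 p * C3), fun {A0 b0} hA0 hb0 hAb {φ ψ} hφ hψ s n => ?_⟩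
  obtain ⟨hFG, hFn⟩ := hC1 (Fin n) _ _ _
    (lacunary_neg_geom hA0 hρ le_rfl (by linarith : 2 * (0 : ℝ) ≤ A0) n) hp φ hφ
  simp only [add_zero] at hFG hFn
  obtain ⟨M, hMm, hM, hMn⟩ := hC3 hb0 (s + n) hψ
  set F : Fin n → ℝ → ℂ :=
    fun j => (Ico (-(A0 * ρ ^ ((j : ℕ) + 1))) (-(A0 * ρ ^ (j : ℕ)))).indicator φ with hF
  set G : Fin n → ℝ → ℂ := fun j => (Ico (b0 * ν ^ (s + (j : ℕ))) b0).indicator ψ with hG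
  have hGG : ∀ j, Good q (G j) := fun j => (hψ.indicator_Ico hq
    (mul_le_of_le_one_right hb0.le (pow_le_one₀ hν.le hν1.le))).1
  set χ : Fin n → ℝ → ℂ := fun j ξ => ∫ t, F j t * G j (ξ - t) with hχ
  have hχG : ∀ j, Good r (χ j) := fun j => (hFG j).specConv hp0 hq0 hr0 hpqr (hGG j)
  have hχi : ∀ j, invF (χ j) = fun x => invF (F j) x * invF (G j) x := fun j =>
    funext fun x => invF_specConv (hFG j).int (hGG j).int x
  have hsupp : ∀ j : Fin n, ∀ ξ ∉ Ico (-(A0 * ρ ^ ((j : ℕ) + 1))) (-(A0 * ρ ^ (j : ℕ)) + b0),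
      χ j ξ = 0 := by
    intro j ξ hξ
    refine integral_eq_zero_of_ae (ae_of_all _ fun t => ?_)
    by_contra hne
    obtain ⟨h1, h2⟩ := mul_ne_zero_iff.1 hne
    have h3 := mem_of_indicator_ne_zero h1
    have h4 := mem_of_indicator_ne_zero h2
    have h5 : 0 < b0 * ν ^ (s + (j : ℕ)) := by positivity
    exact hξ ⟨by linarith [h3.1, h4.1], by linarith [h3.2, h4.2]⟩
  have hrev := hC2 (Fin n) _ _ _ (lacunary_neg_geom hA0 hρ hb0.le hAb n) hr χ hχG hsupp
  have hsum : invF (fun ξ => ∑ j, χ j ξ) = fun x => ∑ j ∈ Finset.range n,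
      invF ((Ico (-(A0 * ρ ^ (j + 1))) (-(A0 * ρ ^ j))).indicator φ) x *
        invF ((Ico (b0 * ν ^ (s + j)) b0).indicator ψ) x := by
    ext x
    rw [invF_sum _ fun j _ => (hχG j).int, Finset.sum_range]
    simp_rw [hχi]
    rfl
  rw [hsum] at hrev
  refine hrev.trans ?_
  simp_rw [hχi]
  push_cast
  rw [mul_assoc, mul_assoc]
  refine mul_le_mul' le_rfl ?_
  refine (eLpNorm_vec_mul_le hr0 hrp hpqr (fun j => (hFG j).measurable) hMm
    fun j x => hM _ (by omega) x).trans ?_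
  refine (mul_le_mul' hFn hMn).trans (le_of_eq ?_)
  ring

/-- Uniform bound for partial sums of the paraproduct with geometric nodes. -/
theorem exists_paraproduct_geom_bound {A0 b0 ρ ν p q r : ℝ} (hA0 : 0 < A0) (hb0 : 0 < b0)
    (hρ : 1 < ρ) (hν : 0 < ν) (hν1 : ν < 1) (hp : 1 < p) (hq : 1 < q) (hr : 1 < r)
    (hpqr : 1 / r = 1 / p + 1 / q) :
    ∃ (C : ℝ≥0) (J : ℕ), ∀ {φ ψ : ℝ → ℂ}, Good p φ → Good q ψ → ∀ n : ℕ,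
      eLpNorm (fun x => ∑ j ∈ Finset.range (J + n),
        invF ((Ico (-(A0 * ρ ^ (j + 2))) (-(A0 * ρ ^ (j + 1)))).indicator φ) x *
          invF ((Ico (b0 * ν ^ (j + 1)) b0).indicator ψ) x) (ENNReal.ofReal r) volume ≤
        C * eLpNorm (invF φ) (ENNReal.ofReal p) volume *
          eLpNorm (invF ψ) (ENNReal.ofReal q) volume := by
  obtain ⟨C, hC⟩ := exists_paraproduct_separated_bound hρ hν hν1 hp hq hr hpqr
  obtain ⟨J, hJ⟩ := pow_unbounded_of_one_lt (2 * b0 / A0) hρ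
  have hJ' : 2 * b0 ≤ A0 * ρ ^ (J + 1) := by
    rw [div_lt_iff₀ hA0] at hJ
    have : ρ ^ J ≤ ρ ^ (J + 1) := pow_le_pow_right₀ hρ.le (Nat.le_succ _)
    have : ρ ^ J * A0 ≤ ρ ^ (J + 1) * A0 := by gcongr
    linarith
  have hp0 : 0 < p := by linarith
  have hq0 : 0 < q := by linarith
  have hr0 : 0 < r := by linarith
  have : ENNReal.HolderTriple (ENNReal.ofReal p) (ENNReal.ofReal q) (ENNReal.ofReal r) := by
    constructor
    rw [← ENNReal.ofReal_inv_of_pos hp0, ← ENNReal.ofReal_inv_of_pos hq0,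
      ← ENNReal.ofReal_inv_of_pos hr0, ← ENNReal.ofReal_add (by positivity) (by positivity)]
    simp only [one_div] at hpqr
    rw [hpqr]
  have hr1 : 1 ≤ ENNReal.ofReal r := by simpa using hr.le
  refine ⟨J * (intC p * intC q) + C, J, fun {φ ψ} hφ hψ n => ?_⟩
  have hP : ∀ j : ℕ, -(A0 * ρ ^ (j + 2)) ≤ -(A0 * ρ ^ (j + 1)) := fun j => by
    gcongr -(A0 * ?_)
    exact pow_le_pow_right₀ hρ.le (Nat.le_succ _)
  have hQ : ∀ j : ℕ, b0 * ν ^ (j + 1) ≤ b0 := fun j =>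
    mul_le_of_le_one_right hb0.le (pow_le_one₀ hν.le hν1.le)
  set W : ℕ → ℝ → ℂ := fun j x =>
    invF ((Ico (-(A0 * ρ ^ (j + 2))) (-(A0 * ρ ^ (j + 1)))).indicator φ) x *
      invF ((Ico (b0 * ν ^ (j + 1)) b0).indicator ψ) x with hW
  have hWm : ∀ j, Measurable (W j) := fun j =>
    (hφ.indicator_Ico hp (hP j)).1.measurable.mul (hψ.indicator_Ico hq (hQ j)).1.measurable
  have hWn : ∀ j, eLpNorm (W j) (ENNReal.ofReal r) volume ≤
      (intC p * intC q) * (eLpNorm (invF φ) (ENNReal.ofReal p) volume *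
        eLpNorm (invF ψ) (ENNReal.ofReal q) volume) := fun j => by
    obtain ⟨h1, h2⟩ := hφ.indicator_Ico hp (hP j)
    obtain ⟨h3, h4⟩ := hψ.indicator_Ico hq (hQ j)
    refine le_trans (eLpNorm_smul_le_mul_eLpNorm (p := ENNReal.ofReal p) (q := ENNReal.ofReal q)
      (φ := invF ((Ico (-(A0 * ρ ^ (j + 2))) (-(A0 * ρ ^ (j + 1)))).indicator φ))
      h3.measurable.aestronglyMeasurable h1.measurable.aestronglyMeasurable) ?_
    refine (mul_le_mul' h2 h4).trans (le_of_eq ?_)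
    ring
  have hsplit : (fun x => ∑ j ∈ Finset.range (J + n), W j x) =
      (∑ j ∈ Finset.range J, W j) + fun x => ∑ j ∈ Finset.range n, W (J + j) x := by
    ext x
    rw [Finset.sum_range_add, Pi.add_apply, Finset.sum_apply]
  have htail := hC (by positivity : 0 < A0 * ρ ^ (J + 1)) hb0 hJ' hφ hψ (J + 1) n
  have htail' : (fun x => ∑ j ∈ Finset.range n, W (J + j) x) = fun x => ∑ j ∈ Finset.range n,
      invF ((Ico (-(A0 * ρ ^ (J + 1) * ρ ^ (j + 1))) (-(A0 * ρ ^ (J + 1) * ρ ^ j))).indicator φ) x *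
        invF ((Ico (b0 * ν ^ (J + 1 + j)) b0).indicator ψ) x := by
    ext x
    refine Finset.sum_congr rfl fun j _ => ?_
    have e1 : A0 * ρ ^ (J + 1) * ρ ^ (j + 1) = A0 * ρ ^ (J + j + 2) := by ring
    have e2 : A0 * ρ ^ (J + 1) * ρ ^ j = A0 * ρ ^ (J + j + 1) := by ring
    have e3 : J + 1 + j = J + j + 1 := by ring
    rw [e1, e2, e3]
  rw [← htail'] at htail
  rw [hsplit]
  refine (eLpNorm_add_le ?_ ?_ hr1).trans ?_
  · rw [show ∑ j ∈ Finset.range J, W j = fun x => ∑ j ∈ Finset.range J, W j x from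
      funext fun x => Finset.sum_apply ..]
    exact (Finset.measurable_fun_sum _ fun j _ => hWm j).aestronglyMeasurable
  · exact (Finset.measurable_fun_sum _ fun j _ => hWm (J + j)).aestronglyMeasurable
  push_cast
  rw [add_mul, add_mul]
  refine add_le_add ((eLpNorm_sum_le (fun j _ => (hWm j).aestronglyMeasurable) hr1).trans ?_) htail
  refine (Finset.sum_le_sum fun j _ => hWn j).trans (le_of_eq ?_)
  rw [Finset.sum_const, Finset.card_range, nsmul_eq_mul]
  ring

end

noncomputable section

open Filter Topology

/-! ### The paraproduct as a limit of partial sums -/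

lemma indC_mul (s : Set ℝ) (φ : ℝ → ℂ) (ξ : ℝ) : indC s ξ * φ ξ = s.indicator φ ξ := by
  by_cases h : ξ ∈ s <;> simp [indC, h]

lemma exists_unique_Ico_of_antitone {a : ℕ → ℝ} (ha : Antitone a) (ξ : ℝ) :
    ∃ k, ∀ j ≠ k, ξ ∉ Ico (a (j + 2)) (a (j + 1)) := by
  by_cases h : ∃ k, ξ ∈ Ico (a (k + 2)) (a (k + 1))
  · obtain ⟨k, hk⟩ := h
    refine ⟨k, fun j hj hξ => ?_⟩
    rcases lt_or_gt_of_ne hj with hlt | hlt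
    · have h1 : a (k + 1) ≤ a (j + 2) := ha (by omega)
      linarith [hξ.1, hk.2]
    · have h1 : a (j + 1) ≤ a (k + 2) := ha (by omega)
      linarith [hk.1, hξ.2]
  · exact ⟨0, fun j _ hξ => h ⟨j, hξ⟩⟩

theorem tendsto_Bm_mab {a b : ℕ → ℝ} (ha : Antitone a) {f g : ℝ → ℂ}
    (hf : Integrable (fourierT f)) (hg : Integrable (fourierT g)) (x : ℝ) :
    Tendsto (fun n => ∑ j ∈ Finset.range n,
      invF ((Ico (a (j + 2)) (a (j + 1))).indicator (fourierT f)) x *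
        invF ((Ico (b (j + 1)) (b 0)).indicator (fourierT g)) x) atTop
      (𝓝 (Bm (mab a b) f g x)) := by
  set φ := fourierT f with hφ
  set ψ := fourierT g with hψ
  set P : ℕ → ℝ → ℂ := fun j => (Ico (a (j + 2)) (a (j + 1))).indicator φ with hP
  set q : ℕ → ℂ := fun j => invF ((Ico (b (j + 1)) (b 0)).indicator ψ) x with hq
  have hPi : ∀ j, Integrable (P j) := fun j => hf.indicator measurableSet_Ico
  set I : ℕ → ℝ → ℂ := fun n ξ => ∑ j ∈ Finset.range n, P j ξ * q j * eChar ξ x with hI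
  have hterm : ∀ j, Integrable fun ξ => P j ξ * q j * eChar ξ x := fun j =>
    integrable_mul_eChar ((hPi j).mul_const _) x
  have hsum : ∀ n, ∑ j ∈ Finset.range n, invF (P j) x * q j = ∫ ξ, I n ξ := fun n => by
    rw [integral_finsetSum _ fun j _ => hterm j]
    refine Finset.sum_congr rfl fun j _ => ?_
    unfold invF
    rw [← integral_mul_const]
    congr 1; ext ξ; ring
  refine Tendsto.congr (fun n => (hsum n).symm) ?_
  have hqn : ∀ j, ‖q j‖ ≤ ∫ η, ‖ψ η‖ := fun j => by
    refine (norm_invF_le _ _).trans (integral_mono (hg.indicator measurableSet_Ico).norm hg.norm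
      fun η => ?_)
    exact norm_indicator_le_norm_self _ _
  unfold Bm
  refine tendsto_integral_of_dominated_convergence (fun ξ => ‖φ ξ‖ * ∫ η, ‖ψ η‖)
    (fun n => (integrable_finsetSum _ fun j _ => hterm j).aestronglyMeasurable)
    (hf.norm.mul_const _) (fun n => ae_of_all _ fun ξ => ?_) (ae_of_all _ fun ξ => ?_)
  · obtain ⟨k, hk⟩ := exists_unique_Ico_of_antitone ha ξ
    have hle : ‖P k ξ * q k * eChar ξ x‖ ≤ ‖φ ξ‖ * ∫ η, ‖ψ η‖ := by
      rw [norm_mul, norm_eChar, mul_one, norm_mul]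
      exact mul_le_mul (norm_indicator_le_norm_self _ _) (hqn k) (norm_nonneg _) (norm_nonneg _)
    have h0 : ∀ j ≠ k, P j ξ * q j * eChar ξ x = 0 := fun j hj => by
      simp [hP, indicator_of_notMem (hk j hj)]
    by_cases hkn : k ∈ Finset.range n
    · simp only [hI]
      rwa [Finset.sum_eq_single_of_mem k hkn fun j _ hj => h0 j hj]
    · simp only [hI]
      rw [Finset.sum_eq_zero fun j hj => h0 j fun h => hkn (h ▸ hj), norm_zero]
      exact (norm_nonneg _).trans hle
  · obtain ⟨k, hk⟩ := exists_unique_Ico_of_antitone ha ξ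
    refine tendsto_const_nhds.congr' ?_
    filter_upwards [eventually_gt_atTop k] with n hn
    have h0 : ∀ j ≠ k, P j ξ * q j * eChar ξ x = 0 := fun j hj => by
      simp [hP, indicator_of_notMem (hk j hj)]
    simp only [hI]
    rw [Finset.sum_eq_single_of_mem k (Finset.mem_range.2 hn) fun j _ hj => h0 j hj]
    have hm : ∀ η, mab a b ξ η = indC (Ico (a (k + 2)) (a (k + 1))) ξ *
        indC (Ico (b (k + 1)) (b 0)) η := fun η =>
      tsum_eq_single k fun j hj => by simp [indC, indicator_of_notMem (hk j hj)]
    simp_rw [hm, eChar_add_left]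
    simp only [hP, hq, invF]
    rw [← integral_const_mul, ← integral_mul_const]
    congr 1; ext η
    rw [← indC_mul, ← indC_mul]
    ring

lemma good_fourierT {p : ℝ} (f : SchwartzMap ℝ ℂ) :
    Good p (fourierT f) ∧ invF (fourierT f) = f := by
  have hi : Integrable (fourierT f) := by
    rw [← fourier_eq_fourierT, ← SchwartzMap.fourier_coe]
    exact (FourierTransform.fourier f).integrable
  have e : invF (fourierT f) = f := by
    rw [← fourierInv_eq_invF, ← fourier_eq_fourierT]
    refine Continuous.fourierInv_fourier_eq f.continuous f.integrable ?_
    rw [fourier_eq_fourierT]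
    exact hi
  exact ⟨⟨hi, by rw [e]; exact f.memLp _, by rw [e]; exact f.memLp _⟩, e⟩

/-- Paraproducts with geometric nodes are bounded. -/
theorem exists_Bm_mab_geom_bound {A0 b0 ρ ν p q r : ℝ} (hA0 : 0 < A0) (hb0 : 0 < b0)
    (hρ : 1 < ρ) (hν : 0 < ν) (hν1 : ν < 1) (hp : 1 < p) (hq : 1 < q) (hr : 1 < r)
    (hpqr : 1 / r = 1 / p + 1 / q) :
    ∃ C : ℝ≥0, ∀ f g : SchwartzMap ℝ ℂ,
      eLpNorm (Bm (mab (fun j => -(A0 * ρ ^ j)) fun j => b0 * ν ^ j) f g) (ENNReal.ofReal r) volume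
        ≤ C * eLpNorm f (ENNReal.ofReal p) volume * eLpNorm g (ENNReal.ofReal q) volume := by
  obtain ⟨C, J, hC⟩ := exists_paraproduct_geom_bound hA0 hb0 hρ hν hν1 hp hq hr hpqr
  refine ⟨C, fun f g => ?_⟩
  obtain ⟨hf, ef⟩ := good_fourierT (p := p) f
  obtain ⟨hg, eg⟩ := good_fourierT (p := q) g
  have ha : Antitone fun j : ℕ => -(A0 * ρ ^ j) := fun i j hij => by
    beta_reduce
    gcongr -(A0 * ?_)
    exact pow_le_pow_right₀ hρ.le hij
  have hlim := fun x => tendsto_Bm_mab (b := fun j => b0 * ν ^ j) ha hf.int hg.int x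
  have hlim' := fun x => (tendsto_add_atTop_iff_nat J).2 (hlim x)
  simp only [pow_zero, mul_one] at hlim'
  refine (Lp.eLpNorm_lim_le_liminf_eLpNorm (fun n => ?_) _ (ae_of_all _ hlim')).trans ?_
  · refine (Finset.measurable_fun_sum _ fun j _ => ?_).aestronglyMeasurable
    exact (continuous_invF (hf.int.indicator measurableSet_Ico)).measurable.mul
      (continuous_invF (hg.int.indicator measurableSet_Ico)).measurable
  · refine liminf_le_of_le (by isBoundedDefault) fun B hB => ?_
    obtain ⟨n, hn⟩ := hB.exists
    have h := hC hf hg n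
    rw [ef, eg] at h
    rw [add_comm n J] at hn
    exact hn.trans h

end

/-- The staircase paraproduct inscribed in the curve `η = |ξ|^{-c}`, `ξ < 0`, with
`a_j = -(c 2^j)^{1/(c+1)}` and `b_j = |a_j|^{-c}`, is bounded for all
`1 < p₁, p₂, p₃ < ∞` with `1/p₁ + 1/p₂ + 1/p₃ = 1`. -/
theorem hyperbola_paraproduct_full_bound (c : ℝ) (hc : 0 < c) (p1 p2 p3 : ℝ)
    (hp1 : 1 < p1) (hp2 : 1 < p2) (hp3 : 1 < p3)
    (hsum : 1 / p1 + 1 / p2 + 1 / p3 = 1) :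
    ∃ C : ℝ, 0 < C ∧
      ∀ f g : SchwartzMap ℝ ℂ,
        eLpNorm
            (Bm (mab (fun j => -((c * 2 ^ j) ^ (1 / (c + 1))))
                (fun j => |(-((c * 2 ^ j) ^ (1 / (c + 1)) : ℝ))| ^ (-c))) (⇑f) (⇑g))
            (ENNReal.ofReal (p3 / (p3 - 1))) volume ≤
          ENNReal.ofReal C * eLpNorm (⇑f) (ENNReal.ofReal p1) volume *
            eLpNorm (⇑g) (ENNReal.ofReal p2) volume := by
  set A0 : ℝ := c ^ (1 / (c + 1)) with hA0
  set ρ : ℝ := 2 ^ (1 / (c + 1)) with hρ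
  have hA0' : 0 < A0 := Real.rpow_pos_of_pos hc _
  have hρ1 : 1 < ρ := Real.one_lt_rpow (by norm_num) (by positivity)
  have hρ0 : 0 < ρ := by linarith
  have hA : ∀ j : ℕ, (c * 2 ^ j) ^ (1 / (c + 1)) = A0 * ρ ^ j := fun j => by
    rw [Real.mul_rpow hc.le (by positivity), hρ, ← Real.rpow_natCast, ← Real.rpow_natCast,
      ← Real.rpow_mul (by norm_num), ← Real.rpow_mul (by norm_num), mul_comm (j : ℝ)]
  have hB : ∀ j : ℕ, |(-((c * 2 ^ j) ^ (1 / (c + 1)) : ℝ))| ^ (-c) = A0 ^ (-c) * (ρ ^ (-c)) ^ j :=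
    fun j => by
      rw [abs_neg, hA, abs_of_pos (by positivity), Real.mul_rpow hA0'.le (by positivity),
        ← Real.rpow_natCast, ← Real.rpow_natCast, ← Real.rpow_mul hρ0.le, ← Real.rpow_mul hρ0.le,
        mul_comm (j : ℝ)]
  have h31 : 0 < p3 - 1 := by linarith
  have hr : 1 < p3 / (p3 - 1) := by rw [lt_div_iff₀ h31]; linarith
  have hpqr : 1 / (p3 / (p3 - 1)) = 1 / p1 + 1 / p2 := by
    have : 1 / (p3 / (p3 - 1)) = 1 - 1 / p3 := by field_simp
    linarith
  obtain ⟨C, hC⟩ := exists_Bm_mab_geom_bound hA0' (Real.rpow_pos_of_pos hA0' (-c)) hρ1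
    (Real.rpow_pos_of_pos hρ0 _) (Real.rpow_lt_one_of_one_lt_of_neg hρ1 (neg_lt_zero.2 hc))
    hp1 hp2 hr hpqr
  refine ⟨C + 1, by positivity, fun f g => ?_⟩
  simp_rw [hB, hA]
  refine (hC f g).trans ?_
  gcongr
  rw [← ENNReal.ofReal_coe_nnreal]
  exact ENNReal.ofReal_le_ofReal (by linarith)
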